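/- There is an absolute constant c such that for every real p with 4 < p < 6, with α := (p−4)/(p−2), every integer b ≥ 1, and all δ, ν with 1/δ ∈ ℕ, 1/ν ∈ ℕ, ν ∈ (0,1/100), and ν^{2b}/δ ∈ ℕ, the bilinear constant satisfies M_{p,b}(δ,ν) ≤ c · ν^{−1/p} · (b · log(1/ν))^{1/2} · M_{p,2b}(δ,ν)^{1−α} · D_p(δ/ν^b)^{α}. -/

import Mathlib

open MeasureTheory

noncomputable section

/-- The weight `w_B` attached to the axis-parallel square of center `c` and side length `R`:
`w_B(x) = (1 + |x - c|/R)^(-100)` with `|·|` the Euclidean norm on `ℝ²`. -/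
def wB (c : ℝ × ℝ) (R : ℝ) (x : ℝ × ℝ) : ℝ :=
  (1 + Real.sqrt ((x.1 - c.1) ^ 2 + (x.2 - c.2) ^ 2) / R) ^ (-100 : ℤ)

/-- The product weight `w̃_B(x) = (1 + |x₁ - c₁|/R)^(-100) * (1 + |x₂ - c₂|/R)^(-100)`. -/
def wtB (c : ℝ × ℝ) (R : ℝ) (x : ℝ × ℝ) : ℝ :=
  (1 + |x.1 - c.1| / R) ^ (-100 : ℤ) * (1 + |x.2 - c.2| / R) ^ (-100 : ℤ)

/-- The axis-parallel square `B(c, R)` with center `c` and side length `R`, as a subset of `ℝ²`. -/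
def sqr (c : ℝ × ℝ) (R : ℝ) : Set (ℝ × ℝ) :=
  Set.Icc (c.1 - R / 2) (c.1 + R / 2) ×ˢ Set.Icc (c.2 - R / 2) (c.2 + R / 2)

/-- The extension operator associated to the parabola, over the interval `[a, b]`:
`(E_{[a,b]} g)(x) = ∫_{[a,b]} g(ξ) e(ξ x₁ + ξ² x₂) dξ`. -/
def extOp (a b : ℝ) (g : ℝ → ℂ) (x : ℝ × ℝ) : ℂ :=
  ∫ ξ in Set.Icc a b,
    g ξ * Complex.exp (2 * Real.pi * Complex.I * ((ξ * x.1 + ξ ^ 2 * x.2 : ℝ) : ℂ))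

/-- Weighted `L^p` norm `‖f‖_{L^p(w)} = (∫_{ℝ²} |f|^p w)^{1/p}`. -/
def wLp (p : ℝ) (w : ℝ × ℝ → ℝ) (f : ℝ × ℝ → ℂ) : ℝ :=
  (∫ x : ℝ × ℝ, ‖f x‖ ^ p * w x) ^ (1 / p)

/-- `L^p` norm over the square of center `c` and side `R`. -/
def sqLp (p : ℝ) (c : ℝ × ℝ) (R : ℝ) (f : ℝ × ℝ → ℂ) : ℝ :=
  (∫ x in sqr c R, ‖f x‖ ^ p) ^ (1 / p)

/-- Normalized weighted `L^p` norm `‖f‖_{L^p_#(w)} = (|B|⁻¹ ∫_{ℝ²} |f|^p w)^{1/p}` where the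
normalizing square has side length `R` (so `|B| = R²`). -/
def shLp (p R : ℝ) (w : ℝ × ℝ → ℝ) (f : ℝ × ℝ → ℂ) : ℝ :=
  ((R ^ 2)⁻¹ * ∫ x : ℝ × ℝ, ‖f x‖ ^ p * w x) ^ (1 / p)

/-- Normalized `L^p` norm over the square of center `c` and side `R`:
`‖f‖_{L^p_#(B)} = (|B|⁻¹ ∫_B |f|^p)^{1/p}`. -/
def shLpSq (p : ℝ) (c : ℝ × ℝ) (R : ℝ) (f : ℝ × ℝ → ℂ) : ℝ :=
  ((R ^ 2)⁻¹ * ∫ x in sqr c R, ‖f x‖ ^ p) ^ (1 / p)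

/-- `DecIneq p n D` says that the constant `D` is admissible in the `l²L^p` decoupling
inequality for the parabola at scale `δ = 1/n`: for every integrable `g : [0,1] → ℂ` and every
axis-parallel square `B` of side length `δ⁻² = n²`,
`‖E_{[0,1]} g‖_{L^p(B)} ≤ D (Σ_{J ∈ P_δ([0,1])} ‖E_J g‖_{L^p(w_B)}²)^{1/2}`. -/
def DecIneq (p : ℝ) (n : ℕ) (D : ℝ) : Prop :=
  ∀ g : ℝ → ℂ, IntegrableOn g (Set.Icc 0 1) → ∀ c : ℝ × ℝ,
    sqLp p c ((n : ℝ) ^ 2) (extOp 0 1 g) ≤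
      D * (∑ k ∈ Finset.range n,
        wLp p (wB c ((n : ℝ) ^ 2)) (extOp ((k : ℝ) / (n : ℝ)) (((k : ℝ) + 1) / (n : ℝ)) g) ^ 2)
        ^ (1 / 2 : ℝ)

/-- The decoupling constant `D_p(δ)` for the parabola at scale `δ = 1/n`, i.e. the smallest
admissible constant in the decoupling inequality. -/
def Dconst (p : ℝ) (n : ℕ) : ℝ := sInf {D : ℝ | 0 ≤ D ∧ DecIneq p n D}

/-- Center of the `(i,j)` square in the partition of the axis-parallel square of center `c` and
side length `Rb` into axis-parallel squares of side length `r`. -/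
def subCtr (c : ℝ × ℝ) (Rb r : ℝ) (i j : ℕ) : ℝ × ℝ :=
  (c.1 - Rb / 2 + ((i : ℝ) + 1 / 2) * r, c.2 - Rb / 2 + ((j : ℝ) + 1 / 2) * r)

/-- `BilIneq p n k b M` says `M` is admissible in the bilinear decoupling inequality with
`δ = 1/n`, `ν = 1/k`: for every square `B` of side `δ⁻² = n²`, every integrable `g`, and all
`ν`-separated intervals `I = [i/k, (i+1)/k]`, `I' = [i'/k, (i'+1)/k]` of the partition
`P_ν([0,1])`,
`Avg_{Δ ∈ P_{ν^{-b}}(B)} Π (Σ_{J ∈ P_{ν^b}} ‖E_J g‖_{L²_#(w̃_Δ)}²)^{p/4}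
  ≤ M^p Π (Σ_{J ∈ P_δ} ‖E_J g‖_{L^p_#(w_B)}²)^{p/4}`. -/
def BilIneq (p : ℝ) (n k b : ℕ) (M : ℝ) : Prop :=
  ∀ g : ℝ → ℂ, IntegrableOn g (Set.Icc 0 1) → ∀ c : ℝ × ℝ,
    ∀ i i' : ℕ, i < k → i' < k → (i + 1 < i' ∨ i' + 1 < i) →
    (((n ^ 2 / k ^ b : ℕ) : ℝ) ^ 2)⁻¹ *
        ∑ a ∈ Finset.range (n ^ 2 / k ^ b), ∑ a' ∈ Finset.range (n ^ 2 / k ^ b),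
          ((∑ J ∈ Finset.range (k ^ (b - 1)),
              shLp 2 ((k : ℝ) ^ b)
                (wtB (subCtr c ((n : ℝ) ^ 2) ((k : ℝ) ^ b) a a') ((k : ℝ) ^ b))
                (extOp ((i : ℝ) / (k : ℝ) + (J : ℝ) / (k : ℝ) ^ b)
                  ((i : ℝ) / (k : ℝ) + ((J : ℝ) + 1) / (k : ℝ) ^ b) g) ^ 2) ^ (p / 4) *
            (∑ J ∈ Finset.range (k ^ (b - 1)),
              shLp 2 ((k : ℝ) ^ b)
                (wtB (subCtr c ((n : ℝ) ^ 2) ((k : ℝ) ^ b) a a') ((k : ℝ) ^ b))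
                (extOp ((i' : ℝ) / (k : ℝ) + (J : ℝ) / (k : ℝ) ^ b)
                  ((i' : ℝ) / (k : ℝ) + ((J : ℝ) + 1) / (k : ℝ) ^ b) g) ^ 2) ^ (p / 4))
      ≤ M ^ p *
        ((∑ J ∈ Finset.range (n / k),
            shLp p ((n : ℝ) ^ 2) (wB c ((n : ℝ) ^ 2))
              (extOp ((i : ℝ) / (k : ℝ) + (J : ℝ) / (n : ℝ))
                ((i : ℝ) / (k : ℝ) + ((J : ℝ) + 1) / (n : ℝ)) g) ^ 2) ^ (p / 4) *
          (∑ J ∈ Finset.range (n / k),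
            shLp p ((n : ℝ) ^ 2) (wB c ((n : ℝ) ^ 2))
              (extOp ((i' : ℝ) / (k : ℝ) + (J : ℝ) / (n : ℝ))
                ((i' : ℝ) / (k : ℝ) + ((J : ℝ) + 1) / (n : ℝ)) g) ^ 2) ^ (p / 4))

/-- The bilinear decoupling constant `M_{p,b}(δ, ν)` with `δ = 1/n`, `ν = 1/k`. -/
def Mconst (p : ℝ) (n k b : ℕ) : ℝ := sInf {M : ℝ | 0 ≤ M ∧ BilIneq p n k b M}

/-- The Fourier transform of a function on `ℝ²`. -/
def ftR2 (η : ℝ × ℝ → ℝ) (ξ : ℝ × ℝ) : ℂ :=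
  ∫ x : ℝ × ℝ, (η x : ℂ) * Complex.exp (-(2 * Real.pi * Complex.I) * ((x.1 * ξ.1 + x.2 * ξ.2 : ℝ) : ℂ))

end

open FourierTransform SchwartzMap
open scoped ENNReal ComplexConjugate

noncomputable section

/-- The character `e(t) = exp(2πit)`. -/
def ec (t : ℝ) : ℂ := Complex.exp (2 * Real.pi * Complex.I * (t : ℂ))

lemma ec_add (s t : ℝ) : ec (s + t) = ec s * ec t := by
  rw [ec, ec, ec, ← Complex.exp_add]; push_cast; ring_nf

lemma norm_ec (t : ℝ) : ‖ec t‖ = 1 := by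
  rw [ec, show 2 * (Real.pi : ℂ) * Complex.I * (t : ℂ) = ((2 * Real.pi * t : ℝ) : ℂ) * Complex.I by
    push_cast; ring, Complex.norm_exp_ofReal_mul_I]

lemma enorm_ec (t : ℝ) : ‖ec t‖ₑ = 1 := by
  rw [← ofReal_norm, norm_ec]; simp

lemma conj_ec (t : ℝ) : conj (ec t) = ec (-t) := by
  rw [ec, ec, ← Complex.exp_conj]
  simp [Complex.conj_ofNat]

@[fun_prop]
lemma continuous_ec : Continuous ec := by unfold ec; fun_prop

@[fun_prop]
lemma measurable_ec : Measurable ec := continuous_ec.measurable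

lemma integral_mul_ec_eq_fourier (f : ℝ → ℂ) (w : ℝ) :
    ∫ y, f y * ec (-(y * w)) = 𝓕 f w := by
  rw [Real.fourier_real_eq_integral_exp_smul]
  congr 1; ext y
  rw [smul_eq_mul, mul_comm, ec]; congr 2; push_cast; ring

lemma SchwartzMap.exists_norm_le_inv_pow (f : 𝓢(ℝ, ℂ)) (N : ℕ) :
    ∃ C : ℝ, 1 ≤ C ∧ ∀ y, ‖f y‖ ≤ C * ((1 + |y|) ^ N)⁻¹ := by
  refine ⟨max 1 (2 ^ N * ((Finset.Iic (N, 0)).sup fun m => SchwartzMap.seminorm ℝ m.1 m.2) f),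
    le_max_left _ _, fun y => ?_⟩
  have h := SchwartzMap.one_add_le_sup_seminorm_apply (𝕜 := ℝ) (m := (N, 0)) (k := N) (n := 0)
    le_rfl le_rfl f y
  rw [norm_iteratedFDeriv_zero, Real.norm_eq_abs] at h
  rw [← div_eq_mul_inv, le_div_iff₀ (by positivity), mul_comm]
  exact h.trans (le_max_right _ _)

lemma exists_schwartz_of_multiplier {φ : ℝ → ℂ} (hc : HasCompactSupport φ)
    (hs : ContDiff ℝ (⊤ : ℕ∞) φ) :
    ∃ ρ : 𝓢(ℝ, ℂ), (∀ w, ∫ y, ρ y * ec (-(y * w)) = φ w) ∧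
      ∀ u, ρ u = ∫ w, φ w * ec (w * u) := by
  refine ⟨𝓕⁻ (hc.toSchwartzMap hs), fun w => ?_, fun u => ?_⟩
  · rw [integral_mul_ec_eq_fourier, ← SchwartzMap.fourier_coe, fourier_fourierInv_eq]; rfl
  · rw [SchwartzMap.fourierInv_coe, Real.fourierInv_eq_fourier_neg, ← integral_mul_ec_eq_fourier]
    congr 1; ext w; congr 2; ring

/-- A smooth compactly supported function equal to `1` on `[-10,10]`. -/
lemma exists_cutoff : ∃ φ : ℝ → ℝ, HasCompactSupport φ ∧ ContDiff ℝ (⊤ : ℕ∞) φ ∧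
    ∀ w, |w| ≤ 10 → φ w = 1 := by
  let f : ContDiffBump (0 : ℝ) := ⟨10, 11, by norm_num, by norm_num⟩
  refine ⟨f, f.hasCompactSupport, f.contDiff, fun w hw => f.one_of_mem_closedBall ?_⟩
  simpa using hw

lemma exists_reproducing_kernel : ∃ ρ : 𝓢(ℝ, ℂ), ∀ w, |w| ≤ 10 →
    ∫ y, ρ y * ec (-(y * w)) = 1 := by
  obtain ⟨φ, hc, hs, h1⟩ := exists_cutoff
  have hc' : HasCompactSupport (fun w => (φ w : ℂ)) := hc.comp_left (g := fun x : ℝ => (x : ℂ)) (by simp)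
  obtain ⟨ρ, hρ, -⟩ := exists_schwartz_of_multiplier hc' (Complex.ofRealCLM.contDiff.comp hs)
  exact ⟨ρ, fun w hw => by rw [hρ, h1 w hw]; simp⟩

/-- Kernels whose Fourier multiplier is the chirp `e(sω²)` near the origin, with `L¹` norms
growing at most linearly in `s`. -/
lemma exists_chirp_kernel : ∃ C : ℝ, 1 ≤ C ∧ ∀ s : ℝ, ∃ κ : ℝ → ℂ, Integrable κ ∧
    ∫ y, ‖κ y‖ ≤ C * (1 + |s|) ∧ ∀ w, |w| ≤ 10 → ∫ y, κ y * ec (-(y * w)) = ec (s * w ^ 2) := by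
  obtain ⟨φ, hc, hs, h1⟩ := exists_cutoff
  have hc' : HasCompactSupport (fun w => (φ w : ℂ) * Complex.exp (Real.pi * (w : ℂ) ^ 2)) :=
    (hc.comp_left (g := fun x : ℝ => (x : ℂ)) (by simp)).mul_right
  have hs' : ContDiff ℝ (⊤ : ℕ∞) (fun w : ℝ => (φ w : ℂ) * Complex.exp (Real.pi * (w : ℂ) ^ 2)) := by
    have := Complex.ofRealCLM.contDiff (n := (⊤ : ℕ∞))
    have h2 : ContDiff ℝ (⊤ : ℕ∞) (fun w : ℝ => (w : ℂ)) := this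
    exact (this.comp hs).mul ((contDiff_const.mul (h2.pow 2)).cexp)
  obtain ⟨ρ, hρ, -⟩ := exists_schwartz_of_multiplier hc' hs'
  have hnn : 0 ≤ ∫ y, ‖ρ y‖ := integral_nonneg fun y => norm_nonneg _
  refine ⟨max 1 (2 * ∫ y, ‖ρ y‖), le_max_left _ _, fun s => ?_⟩
  set b : ℂ := (1 - 2 * s * Complex.I)⁻¹ with hb
  have hns : Complex.normSq (1 - 2 * s * Complex.I) = 1 + 4 * s ^ 2 := by
    simp [Complex.normSq_apply]; ring
  have hpos : 0 < 1 + 4 * s ^ 2 := by positivity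
  have hbre : b.re = (1 + 4 * s ^ 2)⁻¹ := by
    rw [hb, Complex.inv_re, hns]; simp
  have hbre0 : 0 < b.re := by rw [hbre]; positivity
  have hb0 : b ≠ 0 := fun h => by simp [h] at hbre0
  have hbn : ‖b‖ ≤ 1 := by
    rw [hb, norm_inv]
    apply inv_le_one_of_one_le₀
    calc (1 : ℝ) = (1 - 2 * s * Complex.I).re := by simp
      _ ≤ _ := Complex.re_le_norm _
  set g : ℝ → ℂ := fun x => b ^ (1 / 2 : ℂ) * Complex.exp (-Real.pi * b * x ^ 2) with hg
  have hgi : Integrable g := by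
    apply Integrable.const_mul
    have := integrable_cexp_neg_mul_sq (b := Real.pi * b) (by
      rw [Complex.re_ofReal_mul]; positivity)
    simpa [neg_mul] using this
  have hgn : ∫ x, ‖g x‖ ≤ 1 + 2 * |s| := by
    have h1 : ∀ x, ‖g x‖ ≤ Real.exp (-(Real.pi * b.re) * x ^ 2) := fun x => by
      rw [hg, norm_mul]
      have h2 : ‖b ^ (1 / 2 : ℂ)‖ ≤ 1 := by
        rw [show (1 / 2 : ℂ) = ((1 / 2 : ℝ) : ℂ) by push_cast; rfl,
          Complex.norm_cpow_real]
        exact Real.rpow_le_one (norm_nonneg _) hbn (by norm_num)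
      have h3 : ‖Complex.exp (-Real.pi * b * x ^ 2)‖ = Real.exp (-(Real.pi * b.re) * x ^ 2) := by
        rw [Complex.norm_exp]; congr 1
        rw [show -(Real.pi : ℂ) * b * x ^ 2 = ((-(Real.pi * x ^ 2) : ℝ) : ℂ) * b by push_cast; ring,
          Complex.re_ofReal_mul]; ring
      rw [h3]
      exact mul_le_of_le_one_left (Real.exp_nonneg _) h2
    calc ∫ x, ‖g x‖ ≤ ∫ x, Real.exp (-(Real.pi * b.re) * x ^ 2) :=
          integral_mono hgi.norm (integrable_exp_neg_mul_sq (by positivity)) h1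
      _ = Real.sqrt (1 + 4 * s ^ 2) := by
          rw [integral_gaussian, hbre]; congr 1; field_simp
      _ ≤ 1 + 2 * |s| := by
          rw [Real.sqrt_le_left (by positivity)]
          nlinarith [abs_nonneg s, sq_abs s]
  have hgf : ∀ w, 𝓕 g w = Complex.exp (-Real.pi * (1 - 2 * s * Complex.I) * w ^ 2) := fun w => by
    have h1 := congrFun (fourier_gaussian_pi hbre0) w
    rw [← integral_mul_ec_eq_fourier] at h1 ⊢
    simp only [hg, mul_assoc (b ^ (1 / 2 : ℂ))]
    rw [integral_const_mul, h1, ← mul_assoc, mul_one_div, div_self (by simp [hb0]), one_mul, hb]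
    simp only [div_inv_eq_mul]
  have hρi := ρ.integrable (μ := volume)
  refine ⟨convolution ρ g (ContinuousLinearMap.mul ℂ ℂ) volume,
    hρi.integrable_convolution _ hgi, ?_, fun w hw => ?_⟩
  · have h1 := (hρi.norm.convolution_integrand (ContinuousLinearMap.mul ℝ ℝ) hgi.norm)
    simp only [ContinuousLinearMap.mul_apply'] at h1
    calc ∫ y, ‖convolution ρ g (ContinuousLinearMap.mul ℂ ℂ) volume y‖
        ≤ ∫ y, ∫ t, ‖ρ t‖ * ‖g (y - t)‖ := by
          refine integral_mono (hρi.integrable_convolution _ hgi).norm h1.integral_prod_left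
            fun y => (norm_integral_le_integral_norm _).trans_eq ?_
          simp
      _ = ∫ t, ∫ y, ‖ρ t‖ * ‖g (y - t)‖ := integral_integral_swap h1
      _ = (∫ t, ‖ρ t‖) * ∫ y, ‖g y‖ := by
          rw [← integral_mul_const]
          congr 1; ext t
          rw [integral_const_mul, integral_sub_right_eq_self (fun y => ‖g y‖) t]
      _ ≤ (∫ t, ‖ρ t‖) * (1 + 2 * |s|) := by gcongr
      _ ≤ (2 * ∫ t, ‖ρ t‖) * (1 + |s|) := by nlinarith [abs_nonneg s]
      _ ≤ _ := by gcongr; exact le_max_right _ _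
  · rw [integral_mul_ec_eq_fourier, Real.fourier_mul_convolution_eq hρi hgi, hgf,
      ← integral_mul_ec_eq_fourier, hρ, h1 w hw, ec, Complex.ofReal_one, one_mul, ← Complex.exp_add]
    congr 1; push_cast; ring

lemma integral_mul_multiplier {V : Type*} [MeasurableSpace V] {μ : Measure V} [SFinite μ]
    {H : V → ℂ} (hH : Integrable H μ) {ω : V → ℝ} (hω : Measurable ω) {ρ : ℝ → ℂ}
    (hρ : Integrable ρ) :
    ∫ v, H v * (∫ y, ρ y * ec (-(y * ω v))) ∂μ = ∫ y, ρ y * (∫ v, H v * ec (-(y * ω v)) ∂μ) := by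
  have hint : Integrable (Function.uncurry fun v y => H v * (ρ y * ec (-(y * ω v))))
      (μ.prod volume) := by
    have h1 : Integrable (fun z : V × ℝ => H z.1 * ρ z.2) (μ.prod volume) := hH.mul_prod hρ
    refine (h1.mul_bdd (c := 1) (f := fun z : V × ℝ => H z.1 * ρ z.2)
      (g := fun z : V × ℝ => ec (-(z.2 * ω z.1))) ?_ ?_).congr ?_
    · exact (measurable_ec.comp (by fun_prop)).aestronglyMeasurable
    · exact Filter.Eventually.of_forall fun z => (norm_ec _).le
    · exact Filter.Eventually.of_forall fun z => by simp [Function.uncurry, mul_assoc]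
  calc _ = ∫ v, (∫ y, H v * (ρ y * ec (-(y * ω v)))) ∂μ := by simp_rw [integral_const_mul]
    _ = ∫ y, (∫ v, H v * (ρ y * ec (-(y * ω v))) ∂μ) := integral_integral_swap hint
    _ = _ := by
      congr 1; ext y
      rw [← integral_const_mul]
      congr 1; ext v; ring

lemma lintegral_mul_rpow_le {α : Type*} [MeasurableSpace α] {μ : Measure α} {k g : α → ℝ≥0∞}
    (hk : AEMeasurable k μ) (hg : AEMeasurable g μ) {p : ℝ} (hp : 1 ≤ p) :
    (∫⁻ x, k x * g x ∂μ) ^ p ≤ (∫⁻ x, k x ∂μ) ^ (p - 1) * ∫⁻ x, k x * g x ^ p ∂μ := by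
  have hp0 : 0 < p := by linarith
  have h1 : ∀ x, k x * g x = k x ^ (1 - 1 / p) * (k x * g x ^ p) ^ (1 / p) := fun x => by
    rw [ENNReal.mul_rpow_of_nonneg _ _ (by positivity), ← mul_assoc,
      ← ENNReal.rpow_add_of_nonneg, ← ENNReal.rpow_mul]
    · simp [hp0.ne']
    · rw [sub_nonneg, div_le_one hp0]; exact hp
    · positivity
  simp_rw [h1]
  have h2 := ENNReal.lintegral_mul_norm_pow_le hk (hk.mul (hg.pow_const p)) (p := 1 - 1 / p)
    (q := 1 / p) (by rw [sub_nonneg, div_le_one hp0]; exact hp) (by positivity) (by ring)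
  refine (ENNReal.rpow_le_rpow h2 hp0.le).trans_eq ?_
  rw [ENNReal.mul_rpow_of_nonneg _ _ hp0.le, ← ENNReal.rpow_mul, ← ENNReal.rpow_mul]
  congr 2
  · field_simp
  · field_simp; exact ENNReal.rpow_one _

lemma enorm_integral_mul_rpow_le {α : Type*} [MeasurableSpace α] {μ : Measure α} {k g : α → ℂ}
    (hk : AEMeasurable k μ) (hg : AEMeasurable g μ) {p : ℝ} (hp : 1 ≤ p) :
    ‖∫ x, k x * g x ∂μ‖ₑ ^ p ≤
      (∫⁻ x, ‖k x‖ₑ ∂μ) ^ (p - 1) * ∫⁻ x, ‖k x‖ₑ * ‖g x‖ₑ ^ p ∂μ := by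
  refine le_trans ?_ (lintegral_mul_rpow_le hk.enorm hg.enorm hp)
  refine ENNReal.rpow_le_rpow ((enorm_integral_le_lintegral_enorm _).trans_eq ?_) (by linarith)
  simp_rw [enorm_mul]

lemma integrable_mul_ec {V : Type*} [MeasurableSpace V] {μ : Measure V} {H : V → ℂ}
    (hH : Integrable H μ) {φ : V → ℝ} (hφ : Measurable φ) :
    Integrable (fun v => H v * ec (φ v)) μ :=
  hH.mul_bdd (c := 1) (measurable_ec.comp hφ).aestronglyMeasurable
    (Filter.Eventually.of_forall fun _ => (norm_ec _).le)

/-- If `ρ` has Fourier multiplier `m` on the range of `ω`, then multiplying the density `H` by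
`m ∘ ω` averages the modulated integrals of `H` against `ρ`. -/
lemma enorm_integral_multiplier_rpow_le {V : Type*} [MeasurableSpace V] {μ : Measure V}
    [SFinite μ] {H m : V → ℂ} (hH : Integrable H μ) {ω : V → ℝ} (hω : Measurable ω) {ρ : ℝ → ℂ}
    (hρ : Integrable ρ) (hm : ∀ v, H v ≠ 0 → ∫ y, ρ y * ec (-(y * ω v)) = m v)
    {p : ℝ} (hp : 1 ≤ p) :
    ‖∫ v, H v * m v ∂μ‖ₑ ^ p ≤ (∫⁻ y, ‖ρ y‖ₑ) ^ (p - 1) *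
      ∫⁻ y, ‖ρ y‖ₑ * ‖∫ v, H v * ec (-(y * ω v)) ∂μ‖ₑ ^ p := by
  have h1 : ∫ v, H v * m v ∂μ = ∫ y, ρ y * (∫ v, H v * ec (-(y * ω v)) ∂μ) := by
    rw [← integral_mul_multiplier hH hω hρ]
    congr 1; ext v
    by_cases hv : H v = 0
    · simp [hv]
    · rw [hm v hv]
  rw [h1]
  refine enorm_integral_mul_rpow_le hρ.aemeasurable ?_ hp
  refine Continuous.aemeasurable ?_
  refine continuous_of_dominated (bound := fun v => ‖H v‖) ?_ ?_ hH.norm ?_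
  · exact fun y => (integrable_mul_ec hH (by fun_prop)).aestronglyMeasurable
  · exact fun y => Filter.Eventually.of_forall fun v => by rw [norm_mul, norm_ec, mul_one]
  · exact Filter.Eventually.of_forall fun v => by fun_prop

/-- A window `θ`, rapidly decaying and bounded below near the origin, whose Fourier transform
`χ` is supported in `[-1/100, 1/100]`. -/
lemma exists_window : ∃ (χ θ : 𝓢(ℝ, ℂ)) (c : ℝ), 0 < c ∧
    (∀ w, (1 / 100 : ℝ) < |w| → χ w = 0) ∧ (∀ w, ∫ y, θ y * ec (-(y * w)) = χ w) ∧
    (∀ u, θ u = ∫ w, χ w * ec (w * u)) ∧ (∀ u, |u| ≤ 2 → c ≤ ‖θ u‖) := by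
  let f : ContDiffBump (0 : ℝ) := ⟨1 / 200, 1 / 100, by norm_num, by norm_num⟩
  have hfc : HasCompactSupport f := f.hasCompactSupport
  have hfs : ContDiff ℝ (⊤ : ℕ∞) f := f.contDiff
  have hc : HasCompactSupport (fun w => (f w : ℂ)) :=
    hfc.comp_left (g := fun x : ℝ => (x : ℂ)) (by simp)
  have hs : ContDiff ℝ (⊤ : ℕ∞) (fun w => (f w : ℂ)) := Complex.ofRealCLM.contDiff.comp hfs
  obtain ⟨θ, h1, h2⟩ := exists_schwartz_of_multiplier hc hs
  have hfi : Integrable f := f.continuous.integrable_of_hasCompactSupport hfc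
  have hf0 : ∀ w, (1 / 100 : ℝ) < |w| → f w = 0 := fun w hw =>
    f.zero_of_le_dist (by simpa [f] using hw.le)
  refine ⟨hc.toSchwartzMap hs, θ, (∫ w, f w) / 2, ?_, ?_, h1, h2, ?_⟩
  · have := f.integral_pos (μ := volume); linarith
  · intro w hw
    change (f w : ℂ) = 0
    rw [hf0 w hw]; simp
  · intro u hu
    refine le_trans ?_ (Complex.re_le_norm _)
    rw [h2, ← RCLike.re_eq_complex_re, ← integral_re]
    · rw [← integral_div]
      refine integral_mono (hfi.div_const 2) ?_ fun w => ?_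
      · exact (integrable_mul_ec (hfi.ofReal (𝕜 := ℂ)) (φ := fun w => w * u) (by fun_prop)).re
      · by_cases hw : (1 / 100 : ℝ) < |w|
        · simp [hf0 w hw]
        · push Not at hw
          have h3 : |2 * Real.pi * (w * u)| ≤ Real.pi / 3 := by
            rw [abs_mul, abs_mul w u, abs_of_pos (by positivity)]
            have := Real.pi_pos
            have := mul_le_mul hw hu (abs_nonneg _) (by norm_num)
            nlinarith
          have h4 : 1 / 2 ≤ Real.cos (2 * Real.pi * (w * u)) := by
            rw [← Real.cos_abs, ← Real.cos_pi_div_three]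
            exact Real.cos_le_cos_of_nonneg_of_le_pi (abs_nonneg _)
              (by linarith [Real.pi_pos]) h3
          have h5 : (ec (w * u)).re = Real.cos (2 * Real.pi * (w * u)) := by
            rw [ec, show 2 * (Real.pi : ℂ) * Complex.I * ((w * u : ℝ) : ℂ)
              = ((2 * Real.pi * (w * u) : ℝ) : ℂ) * Complex.I by push_cast; ring,
              Complex.exp_ofReal_mul_I_re]
          change f w / 2 ≤ ((f w : ℂ) * ec (w * u)).re
          rw [Complex.re_ofReal_mul, h5]
          nlinarith [f.nonneg (x := w)]
    · exact (integrable_mul_ec (hfi.ofReal (𝕜 := ℂ)) (φ := fun w => w * u) (by fun_prop))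

lemma lintegral_sum_rpow_le {α ι : Type*} [MeasurableSpace α] {μ : Measure α} (s : Finset ι)
    {f : ι → α → ℝ≥0∞} (hf : ∀ i, AEMeasurable (f i) μ) {r : ℝ} (hr : 1 ≤ r) :
    ∫⁻ x, (∑ i ∈ s, f i x) ^ r ∂μ ≤ (∑ i ∈ s, (∫⁻ x, f i x ^ r ∂μ) ^ (1 / r)) ^ r := by
  have hr0 : 0 < r := by linarith
  have key : (∫⁻ x, (∑ i ∈ s, f i x) ^ r ∂μ) ^ (1 / r) ≤
      ∑ i ∈ s, (∫⁻ x, f i x ^ r ∂μ) ^ (1 / r) := by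
    classical
    induction s using Finset.induction_on with
    | empty => simp [ENNReal.zero_rpow_of_pos hr0, hr0]
    | insert a s ha ih =>
      simp only [Finset.sum_insert ha]
      refine (ENNReal.lintegral_Lp_add_le (hf a)
        (Finset.aemeasurable_fun_sum s fun i _ => hf i) hr).trans ?_
      gcongr
  have h2 := ENNReal.rpow_le_rpow key hr0.le
  rwa [← ENNReal.rpow_mul, one_div, inv_mul_cancel₀ hr0.ne', ENNReal.rpow_one, ← one_div] at h2

lemma sum_sum_rpow_le {ι κ : Type*} (t : Finset κ) (s : Finset ι)
    (f : ι → κ → ℝ≥0∞) {r : ℝ} (hr : 1 ≤ r) :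
    ∑ x ∈ t, (∑ i ∈ s, f i x) ^ r ≤ (∑ i ∈ s, (∑ x ∈ t, f i x ^ r) ^ (1 / r)) ^ r := by
  have hr0 : 0 < r := by linarith
  have key : (∑ x ∈ t, (∑ i ∈ s, f i x) ^ r) ^ (1 / r) ≤
      ∑ i ∈ s, (∑ x ∈ t, f i x ^ r) ^ (1 / r) := by
    classical
    induction s using Finset.induction_on with
    | empty => simp [ENNReal.zero_rpow_of_pos hr0, hr0]
    | insert a s ha ih =>
      simp only [Finset.sum_insert ha]
      refine (ENNReal.Lp_add_le t _ _ hr).trans ?_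
      gcongr
  have h2 := ENNReal.rpow_le_rpow key hr0.le
  rwa [← ENNReal.rpow_mul, one_div, inv_mul_cancel₀ hr0.ne', ENNReal.rpow_one, ← one_div] at h2

lemma sum_rpow_mul_rpow_le {ι : Type*} (s : Finset ι) (f g : ι → ℝ≥0∞) {t : ℝ} (h0 : 0 < t)
    (h1 : t < 1) :
    ∑ i ∈ s, f i ^ (1 - t) * g i ^ t ≤ (∑ i ∈ s, f i) ^ (1 - t) * (∑ i ∈ s, g i) ^ t := by
  have h1' : 0 < 1 - t := by linarith
  have := ENNReal.inner_le_Lp_mul_Lq s (fun i => f i ^ (1 - t)) (fun i => g i ^ t)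
    (p := 1 / (1 - t)) (q := 1 / t) (by
      rw [Real.holderConjugate_iff]
      refine ⟨by rw [lt_div_iff₀ h1']; linarith, by simp⟩)
  simpa [← ENNReal.rpow_mul, h0.ne', h1'.ne'] using this

/-- The one-dimensional decay weight `(1 + |v|)^(-N)`. -/
def bw (N : ℕ) (v : ℝ) : ℝ≥0∞ := ENNReal.ofReal ((1 + |v|) ^ N)⁻¹

@[fun_prop]
lemma measurable_bw (N : ℕ) : Measurable (bw N) := by unfold bw; fun_prop

lemma bw_pos (N : ℕ) (v : ℝ) : 0 < bw N v := ENNReal.ofReal_pos.2 (by positivity)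

lemma bw_ne_top (N : ℕ) (v : ℝ) : bw N v ≠ ∞ := ENNReal.ofReal_ne_top

lemma bw_add (M N : ℕ) (v : ℝ) : bw (M + N) v = bw M v * bw N v := by
  rw [bw, bw, bw, ← ENNReal.ofReal_mul (by positivity), pow_add, mul_inv]

lemma bw_anti {M N : ℕ} (h : M ≤ N) (v : ℝ) : bw N v ≤ bw M v := by
  refine ENNReal.ofReal_le_ofReal (inv_anti₀ (by positivity) (pow_le_pow_right₀ ?_ h))
  linarith [abs_nonneg v]

lemma bw_zero (v : ℝ) : bw 0 v = 1 := by simp [bw]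

lemma bw_le_one (N : ℕ) (v : ℝ) : bw N v ≤ 1 := (bw_anti (Nat.zero_le N) v).trans_eq (bw_zero v)

lemma bw_neg (N : ℕ) (v : ℝ) : bw N (-v) = bw N v := by simp [bw]

lemma bw_le_of_abs_le (N : ℕ) {A v w : ℝ} (hA : 0 < A) (h : 1 + |w| ≤ A * (1 + |v|)) :
    bw N v ≤ ENNReal.ofReal (A ^ N) * bw N w := by
  rw [bw, bw, ← ENNReal.ofReal_mul (by positivity)]
  refine ENNReal.ofReal_le_ofReal ?_
  rw [← div_eq_mul_inv, le_div_iff₀ (by positivity), ← div_eq_inv_mul, div_le_iff₀ (by positivity),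
    ← mul_pow]
  exact pow_le_pow_left₀ (by positivity) h N

lemma one_add_abs_le (x y : ℝ) : 1 + |y| ≤ (1 + |x - y|) * (1 + |x|) := by
  have := abs_sub_abs_le_abs_sub y x
  rw [abs_sub_comm y x] at this
  nlinarith [abs_nonneg x, abs_nonneg (x - y), mul_nonneg (abs_nonneg x) (abs_nonneg (x - y))]

/-- Peetre's inequality. -/
lemma bw_peetre (N : ℕ) (x y : ℝ) : bw N x * bw N (x - y) ≤ bw N y := by
  have := bw_le_of_abs_le N (A := 1 + |x - y|) (by positivity) (one_add_abs_le x y)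
  calc bw N x * bw N (x - y)
      ≤ (ENNReal.ofReal ((1 + |x - y|) ^ N) * bw N y) * bw N (x - y) := by gcongr
    _ = (ENNReal.ofReal ((1 + |x - y|) ^ N) * bw N (x - y)) * bw N y := by ring
    _ = bw N y := by
      rw [bw, ← ENNReal.ofReal_mul (by positivity), mul_inv_cancel₀ (by positivity)]; simp

lemma bw_le_of_abs_sub_le (N : ℕ) {x y : ℝ} (h : |x - y| ≤ 1) :
    bw N x ≤ 2 ^ N * bw N y := by
  have := bw_le_of_abs_le N (A := 2) (v := x) (w := y) (by norm_num)
    ((one_add_abs_le x y).trans (by gcongr; linarith))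
  simpa using this

lemma lintegral_bw_two : ∫⁻ v, bw 2 v ≤ 4 := by
  have h1 : ∀ v, bw 2 v ≤ ENNReal.ofReal ((1 + v ^ 2)⁻¹) := fun v => by
    refine ENNReal.ofReal_le_ofReal (inv_anti₀ (by positivity) ?_)
    nlinarith [abs_nonneg v, sq_abs v]
  calc ∫⁻ v, bw 2 v ≤ ∫⁻ v, ENNReal.ofReal ((1 + v ^ 2)⁻¹) := lintegral_mono h1
    _ = ENNReal.ofReal (∫ v : ℝ, (1 + v ^ 2)⁻¹) :=
      (ofReal_integral_eq_lintegral_ofReal integrable_inv_one_add_sq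
        (Filter.Eventually.of_forall fun v => by positivity)).symm
    _ ≤ ENNReal.ofReal 4 := by
      rw [integral_univ_inv_one_add_sq]; exact ENNReal.ofReal_le_ofReal Real.pi_le_four
    _ = 4 := by simp

lemma lintegral_bw_le {N : ℕ} (hN : 2 ≤ N) : ∫⁻ v, bw N v ≤ 4 :=
  (lintegral_mono fun v => bw_anti hN v).trans lintegral_bw_two

lemma lintegral_comp_mul_add {f : ℝ → ℝ≥0∞} (hf : Measurable f) {a : ℝ} (ha : a ≠ 0) (b : ℝ) :
    ∫⁻ x, f (a * x + b) = ENNReal.ofReal |a⁻¹| * ∫⁻ x, f x := by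
  rw [lintegral_add_right_eq_self (fun x => f (a * x + b)) (-(b / a)) |>.symm]
  have : ∀ x, a * (x + -(b / a)) + b = a * x := fun x => by field_simp; ring
  simp_rw [this]
  rw [← lintegral_map (f := f) (g := fun x => a * x) hf (by fun_prop), Real.map_volume_mul_left ha,
    lintegral_smul_measure, smul_eq_mul]

lemma lintegral_comp_sub_div {f : ℝ → ℝ≥0∞} (hf : Measurable f) {R : ℝ} (hR : 0 < R) (z : ℝ) :
    ∫⁻ x, f ((x - z) / R) = ENNReal.ofReal R * ∫⁻ x, f x := by
  have := lintegral_comp_mul_add hf (inv_ne_zero hR.ne') (-(z / R))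
  rw [inv_inv, abs_of_pos hR] at this
  rw [← this]
  congr 1; ext x; congr 1; field_simp; ring

lemma lintegral_comp_sub_div' {f : ℝ → ℝ≥0∞} (hf : Measurable f) {R : ℝ} (hR : 0 < R) (x : ℝ) :
    ∫⁻ z, f ((x - z) / R) = ENNReal.ofReal R * ∫⁻ x, f x := by
  have := lintegral_comp_mul_add hf (neg_ne_zero.2 (inv_ne_zero hR.ne')) (x / R)
  rw [inv_neg, inv_inv, abs_neg, abs_of_pos hR] at this
  rw [← this]
  congr 1; ext z; congr 1; field_simp; ring

lemma SchwartzMap.exists_enorm_le_bw (f : 𝓢(ℝ, ℂ)) (N : ℕ) :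
    ∃ C : ℝ≥0∞, 1 ≤ C ∧ C ≠ ∞ ∧ ∀ y, ‖f y‖ₑ ≤ C * bw N y := by
  obtain ⟨C, h1, h2⟩ := f.exists_norm_le_inv_pow N
  refine ⟨ENNReal.ofReal C, ?_, ENNReal.ofReal_ne_top, fun y => ?_⟩
  · rwa [ENNReal.one_le_ofReal]
  · rw [bw, ← ENNReal.ofReal_mul (by positivity), ← ofReal_norm]
    exact ENNReal.ofReal_le_ofReal (h2 y)

/-- The extension operator for the parabola, for densities on the whole line. -/
def pext (h : ℝ → ℂ) (x : ℝ × ℝ) : ℂ := ∫ ξ, h ξ * ec (ξ * x.1 + ξ ^ 2 * x.2)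

/-- The part of the density `h` living on `[a, b)`. -/
def pc (h : ℝ → ℂ) (a b : ℝ) : ℝ → ℂ := (Set.Ico a b).indicator h

lemma pc_integrable {h : ℝ → ℂ} (hh : Integrable h) (a b : ℝ) : Integrable (pc h a b) :=
  hh.indicator measurableSet_Ico

lemma pc_apply_ne_zero {h : ℝ → ℂ} {a b ξ : ℝ} (h0 : pc h a b ξ ≠ 0) : a ≤ ξ ∧ ξ < b := by
  by_contra hc
  exact h0 (Set.indicator_of_notMem (show ξ ∉ Set.Ico a b from hc) _)

lemma extOp_eq_pext (a b : ℝ) (g : ℝ → ℂ) : extOp a b g = pext (pc g a b) := by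
  ext x
  rw [extOp, pext, integral_Icc_eq_integral_Ico, ← integral_indicator measurableSet_Ico]
  congr 1; ext ξ
  by_cases hξ : ξ ∈ Set.Ico a b
  · simp [pc, hξ, ec]
  · simp [pc, hξ]

lemma pext_continuous {h : ℝ → ℂ} (hh : Integrable h) : Continuous (pext h) := by
  refine continuous_of_dominated (bound := fun v => ‖h v‖) ?_ ?_ hh.norm ?_
  · exact fun y => (integrable_mul_ec hh (by fun_prop)).aestronglyMeasurable
  · exact fun y => Filter.Eventually.of_forall fun v => by rw [norm_mul, norm_ec, mul_one]
  · exact Filter.Eventually.of_forall fun v => by fun_prop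

lemma pext_enorm_measurable {h : ℝ → ℂ} (hh : Integrable h) : Measurable fun x => ‖pext h x‖ₑ :=
  (pext_continuous hh).measurable.enorm

lemma norm_pext_le {h : ℝ → ℂ} (x : ℝ × ℝ) : ‖pext h x‖ ≤ ∫ ξ, ‖h ξ‖ := by
  refine (norm_integral_le_integral_norm _).trans_eq ?_
  simp_rw [norm_mul, norm_ec, mul_one]

lemma enorm_pext_le {h : ℝ → ℂ} (x : ℝ × ℝ) : ‖pext h x‖ₑ ≤ ∫⁻ ξ, ‖h ξ‖ₑ := by
  refine (enorm_integral_le_lintegral_enorm _).trans_eq ?_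
  simp_rw [enorm_mul, enorm_ec, mul_one]

lemma pext_sum {ι : Type*} (s : Finset ι) {h : ι → ℝ → ℂ} (hh : ∀ i, Integrable (h i))
    (x : ℝ × ℝ) : pext (fun ξ => ∑ i ∈ s, h i ξ) x = ∑ i ∈ s, pext (h i) x := by
  simp only [pext, Finset.sum_mul]
  exact integral_finsetSum s fun i _ => integrable_mul_ec (hh i) (by fun_prop)

lemma pc_sum (h : ℝ → ℂ) (a : ℝ) {t : ℝ} (ht : 0 ≤ t) (N : ℕ) (ξ : ℝ) :
    pc h a (a + N * t) ξ = ∑ l ∈ Finset.range N, pc h (a + l * t) (a + (l + 1) * t) ξ := by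
  induction N with
  | zero => simp [pc]
  | succ N ih =>
    rw [Finset.sum_range_succ, ← ih, pc, pc, pc, ← Set.Ico_union_Ico_eq_Ico (b := a + N * t),
      Set.indicator_union_of_disjoint]
    · push_cast; rfl
    · exact Set.Ico_disjoint_Ico_same
    · have : 0 ≤ (N : ℝ) * t := by positivity
      linarith
    · push_cast; nlinarith

lemma pc_pc {h : ℝ → ℂ} {a b a' b' : ℝ} (h1 : a ≤ a') (h2 : b' ≤ b) :
    pc (pc h a b) a' b' = pc h a' b' := by
  rw [pc, pc, Set.indicator_indicator, Set.inter_eq_left.2 (Set.Ico_subset_Ico h1 h2), pc]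

/-- `w̃_B` as an extended nonnegative function. -/
def wt (c : ℝ × ℝ) (R : ℝ) (x : ℝ × ℝ) : ℝ≥0∞ :=
  bw 100 ((x.1 - c.1) / R) * bw 100 ((x.2 - c.2) / R)

@[fun_prop]
lemma wt_measurable (c : ℝ × ℝ) (R : ℝ) : Measurable (wt c R) := by unfold wt; fun_prop

lemma integrable_conj {h : ℝ → ℂ} (hh : Integrable h) : Integrable fun η => conj (h η) :=
  Complex.conjCLE.toContinuousLinearMap.integrable_comp hh

/-- The square of the window has Fourier transform supported in `(-1, 1)`. -/
lemma integral_window_sq {χ θ : 𝓢(ℝ, ℂ)} (hχ : ∀ w, (1 / 100 : ℝ) < |w| → χ w = 0)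
    (hθ : ∀ w, ∫ y, θ y * ec (-(y * w)) = χ w) (hθ' : ∀ u, θ u = ∫ w, χ w * ec (w * u))
    {w : ℝ} (hw : 1 ≤ |w|) : ∫ u, θ u * conj (θ u) * ec (-(u * w)) = 0 := by
  have h1 : ∀ u, conj (θ u) * ec (-(u * w)) = ∫ η, conj (χ η) * ec (-(u * (η + w))) := fun u => by
    rw [hθ', ← integral_conj, ← integral_mul_const]
    congr 1; ext η
    rw [map_mul, conj_ec, mul_assoc, ← ec_add]; congr 2; ring
  have hint : Integrable fun η => conj (χ η) := by
    exact integrable_conj (χ.integrable (μ := volume))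
  have h2 := integral_mul_multiplier hint (ω := fun η => η + w) (by fun_prop)
    (θ.integrable (μ := volume))
  simp_rw [mul_assoc, h1, ← h2, hθ]
  rw [← integral_zero ℝ ℂ]
  congr 1; ext η
  by_cases hη : (1 / 100 : ℝ) < |η|
  · simp [hχ η hη]
  · rw [hχ (η + w), mul_zero]
    have := abs_sub_abs_le_abs_sub w (-η)
    rw [abs_neg, sub_neg_eq_add, add_comm w] at this
    linarith

lemma integral_window_sq_scaled {χ θ : 𝓢(ℝ, ℂ)} (hχ : ∀ w, (1 / 100 : ℝ) < |w| → χ w = 0)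
    (hθ : ∀ w, ∫ y, θ y * ec (-(y * w)) = χ w) (hθ' : ∀ u, θ u = ∫ w, χ w * ec (w * u))
    {R : ℝ} (hR : 0 < R) (z : ℝ) {w : ℝ} (hw : 1 ≤ |w| * R) :
    ∫ x, θ ((x - z) / R) * conj (θ ((x - z) / R)) * ec (-(x * w)) = 0 := by
  have h1 := integral_window_sq hχ hθ hθ' (w := w * R) (by rwa [abs_mul, abs_of_pos hR])
  have h2 : ∀ x, θ ((x - z) / R) * conj (θ ((x - z) / R)) * ec (-(x * w)) =
      (fun u => θ u * conj (θ u) * ec (-(u * (w * R))) * ec (-(z * w))) ((x - z) / R) := fun x => by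
    simp only
    rw [mul_assoc _ (ec _) (ec _), ← ec_add]; congr 2; field_simp; ring
  simp_rw [h2]
  rw [integral_sub_right_eq_self (fun x => (fun u => θ u * conj (θ u) * ec (-(u * (w * R))) *
    ec (-(z * w))) (x / R)) z, Measure.integral_comp_div
      (fun u => θ u * conj (θ u) * ec (-(u * (w * R))) * ec (-(z * w))), integral_mul_const, h1]
  simp

/-- Two extensions (in one variable) with densities separated by at least `1/R` are orthogonal
with respect to the squared window at scale `R`. -/
lemma integral_window_orthogonal {χ θ : 𝓢(ℝ, ℂ)} (hχ : ∀ w, (1 / 100 : ℝ) < |w| → χ w = 0)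
    (hθ : ∀ w, ∫ y, θ y * ec (-(y * w)) = χ w) (hθ' : ∀ u, θ u = ∫ w, χ w * ec (w * u))
    {R : ℝ} (hR : 0 < R) (z : ℝ) {H H' : ℝ → ℂ} (hH : Integrable H) (hH' : Integrable H')
    (hsep : ∀ ξ ξ', H ξ ≠ 0 → H' ξ' ≠ 0 → 1 ≤ |ξ - ξ'| * R) :
    ∫ x, θ ((x - z) / R) * conj (θ ((x - z) / R)) *
      ((∫ ξ, H ξ * ec (x * ξ)) * conj (∫ ξ, H' ξ * ec (x * ξ))) = 0 := by
  have hcc : Integrable fun η => conj (H' η) := integrable_conj hH'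
  have hint : Integrable (fun v : ℝ × ℝ => H v.1 * conj (H' v.2)) (volume.prod volume) :=
    hH.mul_prod hcc
  have hΘ : Integrable fun x => θ ((x - z) / R) * conj (θ ((x - z) / R)) := by
    have h0 : Integrable fun u => θ u * conj (θ u) := by
      obtain ⟨C, -, hC⟩ := θ.exists_norm_le_inv_pow 0
      refine (θ.integrable (μ := volume)).mul_bdd (c := C) ?_ ?_
      · exact (Complex.continuous_conj.comp θ.continuous).aestronglyMeasurable
      · exact Filter.Eventually.of_forall fun u => by simpa using hC u
    exact (h0.comp_div hR.ne').comp_sub_right z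
  have h1 := integral_mul_multiplier hint (ω := fun v => v.2 - v.1) (by fun_prop) hΘ
  have h2 : ∀ x : ℝ, ∫ v : ℝ × ℝ, H v.1 * conj (H' v.2) * ec (-(x * (v.2 - v.1))) ∂(volume.prod volume)
      = (∫ ξ, H ξ * ec (x * ξ)) * conj (∫ ξ, H' ξ * ec (x * ξ)) := fun x => by
    rw [← integral_conj, ← integral_prod_mul]
    congr 1; ext v
    rw [map_mul, conj_ec, mul_mul_mul_comm, ← ec_add]; congr 2; ring
  simp_rw [h2] at h1
  rw [← h1, ← integral_zero (ℝ × ℝ) ℂ]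
  congr 1; ext v
  by_cases hv1 : H v.1 = 0
  · simp [hv1]
  by_cases hv2 : H' v.2 = 0
  · simp [hv2]
  rw [integral_window_sq_scaled hχ hθ hθ' hR z, mul_zero]
  rw [abs_sub_comm]; exact hsep _ _ hv1 hv2

lemma continuous_integral_mul_ec {H : ℝ → ℂ} (hH : Integrable H) :
    Continuous fun x : ℝ => ∫ ξ, H ξ * ec (x * ξ) := by
  refine continuous_of_dominated (bound := fun v => ‖H v‖) ?_ ?_ hH.norm ?_
  · exact fun y => (integrable_mul_ec hH (by fun_prop)).aestronglyMeasurable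
  · exact fun y => Filter.Eventually.of_forall fun v => by rw [norm_mul, norm_ec, mul_one]
  · exact Filter.Eventually.of_forall fun v => by fun_prop

lemma integrable_window_sq (θ : 𝓢(ℝ, ℂ)) {R : ℝ} (hR : 0 < R) (z : ℝ) :
    Integrable fun x => θ ((x - z) / R) * conj (θ ((x - z) / R)) := by
  have h0 : Integrable fun u => θ u * conj (θ u) := by
    obtain ⟨C, -, hC⟩ := θ.exists_norm_le_inv_pow 0
    refine (θ.integrable (μ := volume)).mul_bdd (c := C) ?_ ?_
    · exact (Complex.continuous_conj.comp θ.continuous).aestronglyMeasurable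
    · exact Filter.Eventually.of_forall fun u => by simpa using hC u
  exact (h0.comp_div hR.ne').comp_sub_right z

lemma integrable_window_mul (θ : 𝓢(ℝ, ℂ)) {R : ℝ} (hR : 0 < R) (z : ℝ) {H H' : ℝ → ℂ}
    (hH : Integrable H) (hH' : Integrable H') :
    Integrable fun x => θ ((x - z) / R) * conj (θ ((x - z) / R)) *
      ((∫ ξ, H ξ * ec (x * ξ)) * conj (∫ ξ, H' ξ * ec (x * ξ))) := by
  have hb : ∀ {H : ℝ → ℂ} (x : ℝ), ‖∫ ξ, H ξ * ec (x * ξ)‖ ≤ ∫ ξ, ‖H ξ‖ := fun x => by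
    refine (norm_integral_le_integral_norm _).trans_eq ?_
    simp_rw [norm_mul, norm_ec, mul_one]
  refine (integrable_window_sq θ hR z).mul_bdd (c := (∫ ξ, ‖H ξ‖) * ∫ ξ, ‖H' ξ‖) ?_ ?_
  · exact ((continuous_integral_mul_ec hH).mul (Complex.continuous_conj.comp
      (continuous_integral_mul_ec hH'))).aestronglyMeasurable
  · refine Filter.Eventually.of_forall fun x => ?_
    rw [norm_mul, RCLike.norm_conj]
    exact mul_le_mul (hb x) (hb x) (norm_nonneg _) (integral_nonneg fun _ => norm_nonneg _)

lemma lintegral_window_eq (θ : 𝓢(ℝ, ℂ)) {R : ℝ} (hR : 0 < R) (z : ℝ) {H : ℝ → ℂ}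
    (hH : Integrable H) :
    ∫⁻ x, ‖∫ ξ, H ξ * ec (x * ξ)‖ₑ ^ 2 * ‖θ ((x - z) / R)‖ₑ ^ 2 =
      ENNReal.ofReal (∫ x, θ ((x - z) / R) * conj (θ ((x - z) / R)) *
        ((∫ ξ, H ξ * ec (x * ξ)) * conj (∫ ξ, H ξ * ec (x * ξ)))).re := by
  have hi := integrable_window_mul θ hR z hH hH
  have h1 : ∀ x, ((‖∫ ξ, H ξ * ec (x * ξ)‖ ^ 2 * ‖θ ((x - z) / R)‖ ^ 2 : ℝ) : ℂ) =
      θ ((x - z) / R) * conj (θ ((x - z) / R)) *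
        ((∫ ξ, H ξ * ec (x * ξ)) * conj (∫ ξ, H ξ * ec (x * ξ))) := fun x => by
    rw [Complex.mul_conj, Complex.mul_conj, Complex.normSq_eq_norm_sq, Complex.normSq_eq_norm_sq]
    push_cast; ring
  simp_rw [← h1] at hi ⊢
  rw [integral_complex_ofReal, Complex.ofReal_re, ofReal_integral_eq_lintegral_ofReal]
  · congr 1; ext x
    rw [ENNReal.ofReal_mul (by positivity), ENNReal.ofReal_pow (norm_nonneg _),
      ENNReal.ofReal_pow (norm_nonneg _), ofReal_norm, ofReal_norm]
  · exact hi.re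
  · exact Filter.Eventually.of_forall fun x => by positivity

lemma lintegral_window_sum_of_separated {χ θ : 𝓢(ℝ, ℂ)}
    (hχ : ∀ w, (1 / 100 : ℝ) < |w| → χ w = 0)
    (hθ : ∀ w, ∫ y, θ y * ec (-(y * w)) = χ w) (hθ' : ∀ u, θ u = ∫ w, χ w * ec (w * u))
    {R : ℝ} (hR : 0 < R) (z : ℝ) (s : Finset ℕ) {H : ℕ → ℝ → ℂ} (hH : ∀ i, Integrable (H i))
    (hsep : ∀ i ∈ s, ∀ j ∈ s, i ≠ j →
      ∀ ξ ξ', H i ξ ≠ 0 → H j ξ' ≠ 0 → 1 ≤ |ξ - ξ'| * R) :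
    ∫⁻ x, ‖∑ i ∈ s, ∫ ξ, H i ξ * ec (x * ξ)‖ₑ ^ 2 * ‖θ ((x - z) / R)‖ₑ ^ 2 =
      ∑ i ∈ s, ∫⁻ x, ‖∫ ξ, H i ξ * ec (x * ξ)‖ₑ ^ 2 * ‖θ ((x - z) / R)‖ₑ ^ 2 := by
  have hsum : ∀ x : ℝ, ∑ i ∈ s, ∫ ξ, H i ξ * ec (x * ξ) = ∫ ξ, (∑ i ∈ s, H i ξ) * ec (x * ξ) :=
    fun x => by
      simp_rw [Finset.sum_mul]
      exact (integral_finsetSum s fun i _ => integrable_mul_ec (hH i) (by fun_prop)).symm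
  simp_rw [hsum]
  rw [lintegral_window_eq θ hR z (integrable_finsetSum s fun i _ => hH i)]
  simp_rw [lintegral_window_eq θ hR z (hH _)]
  rw [← ENNReal.ofReal_sum_of_nonneg]
  · congr 1
    rw [← Complex.re_sum]; congr 1
    simp_rw [← hsum, map_sum, Finset.sum_mul_sum, Finset.mul_sum]
    rw [integral_finsetSum s fun i _ => integrable_finsetSum s fun j _ =>
      integrable_window_mul θ hR z (hH i) (hH j)]
    refine Finset.sum_congr rfl fun i hi => ?_
    rw [integral_finsetSum s fun j _ => integrable_window_mul θ hR z (hH i) (hH j)]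
    refine Finset.sum_eq_single_of_mem i hi fun j hj hij => ?_
    exact integral_window_orthogonal hχ hθ hθ' hR z (hH i) (hH j) (hsep i hi j hj hij.symm)
  · intro i _
    rw [← RCLike.re_eq_complex_re, ← integral_re (integrable_window_mul θ hR z (hH i) (hH i))]
    refine integral_nonneg fun x => ?_
    rw [Complex.mul_conj, Complex.mul_conj, ← Complex.ofReal_mul]
    simp only [RCLike.re_eq_complex_re, Complex.ofReal_re]
    exact mul_nonneg (Complex.normSq_nonneg _) (Complex.normSq_nonneg _)

lemma enorm_add_sq_le (a b : ℂ) : ‖a + b‖ₑ ^ 2 ≤ 2 * (‖a‖ₑ ^ 2 + ‖b‖ₑ ^ 2) := by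
  have : ‖a + b‖ ^ 2 ≤ 2 * (‖a‖ ^ 2 + ‖b‖ ^ 2) := by
    nlinarith [norm_add_le a b, norm_nonneg (a + b), norm_nonneg a, norm_nonneg b,
      sq_nonneg (‖a‖ - ‖b‖)]
  have h2 := ENNReal.ofReal_le_ofReal this
  rwa [ENNReal.ofReal_mul (by norm_num), ENNReal.ofReal_add (by positivity) (by positivity),
    ENNReal.ofReal_pow (norm_nonneg _), ENNReal.ofReal_pow (norm_nonneg _),
    ENNReal.ofReal_pow (norm_nonneg _), ofReal_norm, ofReal_norm, ofReal_norm,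
    ENNReal.ofReal_ofNat] at h2

lemma lintegral_window_sum_le {χ θ : 𝓢(ℝ, ℂ)} (hχ : ∀ w, (1 / 100 : ℝ) < |w| → χ w = 0)
    (hθ : ∀ w, ∫ y, θ y * ec (-(y * w)) = χ w) (hθ' : ∀ u, θ u = ∫ w, χ w * ec (w * u))
    {R : ℝ} (hR : 0 < R) (z : ℝ) (N : ℕ) {H : ℕ → ℝ → ℂ} (hH : ∀ i, Integrable (H i))
    (hsep : ∀ i j, i + 2 ≤ j → ∀ ξ ξ', H i ξ ≠ 0 → H j ξ' ≠ 0 → 1 ≤ |ξ - ξ'| * R) :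
    ∫⁻ x, ‖∑ i ∈ Finset.range N, ∫ ξ, H i ξ * ec (x * ξ)‖ₑ ^ 2 * ‖θ ((x - z) / R)‖ₑ ^ 2 ≤
      2 * ∑ i ∈ Finset.range N,
        ∫⁻ x, ‖∫ ξ, H i ξ * ec (x * ξ)‖ₑ ^ 2 * ‖θ ((x - z) / R)‖ₑ ^ 2 := by
  have hm : Measurable fun x => ‖θ ((x - z) / R)‖ₑ ^ 2 :=
    (θ.continuous.measurable.comp (by fun_prop)).enorm.pow_const 2
  have hmF : ∀ s : Finset ℕ, Measurable fun x : ℝ => ‖∑ i ∈ s, ∫ ξ, H i ξ * ec (x * ξ)‖ₑ ^ 2 :=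
    fun s => ((continuous_finsetSum s fun i _ =>
      continuous_integral_mul_ec (hH i)).measurable).enorm.pow_const 2
  have hm1 : ∀ s : Finset ℕ, Measurable fun x : ℝ =>
      ‖∑ i ∈ s, ∫ ξ, H i ξ * ec (x * ξ)‖ₑ ^ 2 * ‖θ ((x - z) / R)‖ₑ ^ 2 :=
    fun s => (hmF s).mul hm
  have key : ∀ s : Finset ℕ, (∀ i ∈ s, ∀ j ∈ s, i % 2 = j % 2) →
      ∫⁻ x, ‖∑ i ∈ s, ∫ ξ, H i ξ * ec (x * ξ)‖ₑ ^ 2 * ‖θ ((x - z) / R)‖ₑ ^ 2 =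
      ∑ i ∈ s, ∫⁻ x, ‖∫ ξ, H i ξ * ec (x * ξ)‖ₑ ^ 2 * ‖θ ((x - z) / R)‖ₑ ^ 2 := fun s hs => by
    refine lintegral_window_sum_of_separated hχ hθ hθ' hR z s hH fun i hi j hj hij ξ ξ' h1 h2 => ?_
    have := hs i hi j hj
    rcases lt_or_gt_of_ne hij with h | h
    · exact hsep i j (by omega) ξ ξ' h1 h2
    · rw [abs_sub_comm]; exact hsep j i (by omega) ξ' ξ h2 h1
  set s := Finset.range N
  have hs1 := key (s.filter fun i => i % 2 = 0) (by simp +contextual)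
  have hs2 := key (s.filter fun i => ¬ i % 2 = 0) (by
    intro i hi j hj; simp only [Finset.mem_filter] at hi hj; omega)
  calc _ ≤ ∫⁻ x, 2 * (‖∑ i ∈ s with i % 2 = 0, ∫ ξ, H i ξ * ec (x * ξ)‖ₑ ^ 2 *
          ‖θ ((x - z) / R)‖ₑ ^ 2 + ‖∑ i ∈ s with ¬ i % 2 = 0, ∫ ξ, H i ξ * ec (x * ξ)‖ₑ ^ 2 *
          ‖θ ((x - z) / R)‖ₑ ^ 2) := by
        refine lintegral_mono fun x => ?_
        rw [← Finset.sum_filter_add_sum_filter_not s (fun i => i % 2 = 0), ← add_mul, ← mul_assoc]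
        gcongr
        exact enorm_add_sq_le _ _
    _ = _ := by
        rw [lintegral_const_mul' _ _ (by simp), lintegral_add_left (hm1 _), hs1, hs2, Finset.sum_filter_add_sum_filter_not]

/-- Averaging a slowly varying weight against a kernel bounded below near the origin. -/
lemma le_lintegral_average {u K : ℝ → ℝ≥0∞} {R : ℝ} (hR : 0 < R) {A c : ℝ≥0∞} {x : ℝ}
    (hA : A ≠ ∞) (hu : ∀ z, |x - z| ≤ R → u x ≤ A * u z) (hK : ∀ v, |v| ≤ 1 → c ≤ K v) :
    ENNReal.ofReal R * (c * u x) ≤ A * ∫⁻ z, u z * K ((x - z) / R) := by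
  calc ENNReal.ofReal R * (c * u x) ≤ ∫⁻ z in Set.Icc (x - R) (x + R), c * u x := by
        rw [lintegral_const, Measure.restrict_apply_univ, Real.volume_Icc, mul_comm]
        gcongr; linarith
    _ ≤ ∫⁻ z in Set.Icc (x - R) (x + R), A * (u z * K ((x - z) / R)) := by
        refine setLIntegral_mono' measurableSet_Icc fun z hz => ?_
        have hz' : |x - z| ≤ R := abs_le.2 ⟨by linarith [hz.2], by linarith [hz.1]⟩
        calc c * u x ≤ K ((x - z) / R) * (A * u z) :=
              mul_le_mul' (hK _ (by rwa [abs_div, abs_of_pos hR, div_le_one hR])) (hu z hz')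
          _ = _ := by ring
    _ ≤ ∫⁻ z, A * (u z * K ((x - z) / R)) := setLIntegral_le_lintegral _ _
    _ = _ := lintegral_const_mul' _ _ hA

/-- Averaging a slowly varying weight against a rapidly decaying kernel. -/
lemma lintegral_average_le {u K : ℝ → ℝ≥0∞} {R : ℝ} (hR : 0 < R) {N : ℕ} {C : ℝ≥0∞} {x : ℝ}
    (hu : ∀ z, u z * bw N ((x - z) / R) ≤ u x) (hK : ∀ v, K v ≤ C * bw (N + 2) v) :
    ∫⁻ z, u z * K ((x - z) / R) ≤ ENNReal.ofReal R * (4 * C * u x) := by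
  calc ∫⁻ z, u z * K ((x - z) / R) ≤ ∫⁻ z, (C * u x) * bw 2 ((x - z) / R) := by
        refine lintegral_mono fun z => ?_
        calc u z * K ((x - z) / R) ≤ u z * (C * bw (N + 2) ((x - z) / R)) := by gcongr; exact hK _
          _ = C * (u z * bw N ((x - z) / R)) * bw 2 ((x - z) / R) := by rw [bw_add]; ring
          _ ≤ _ := by gcongr; exact hu z
    _ = (C * u x) * (ENNReal.ofReal R * ∫⁻ v, bw 2 v) := by
        rw [lintegral_const_mul _ (by fun_prop), lintegral_comp_sub_div' (by fun_prop) hR]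
    _ ≤ (C * u x) * (ENNReal.ofReal R * 4) := by gcongr; exact lintegral_bw_two
    _ = _ := by ring

lemma lintegral_average_swap {f u K : ℝ → ℝ≥0∞} (hf : Measurable f) (hu : Measurable u)
    (hK : Measurable K) (R : ℝ) :
    ∫⁻ z, u z * ∫⁻ x, f x * K ((x - z) / R) = ∫⁻ x, f x * ∫⁻ z, u z * K ((x - z) / R) := by
  have h1 : ∀ z, Measurable fun x => K ((x - z) / R) := fun z => hK.comp (by fun_prop)
  have h2 : ∀ x, Measurable fun z => K ((x - z) / R) := fun x => hK.comp (by fun_prop)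
  have h3 : Measurable fun q : ℝ × ℝ => K ((q.2 - q.1) / R) := hK.comp (by fun_prop)
  calc _ = ∫⁻ z, ∫⁻ x, u z * (f x * K ((x - z) / R)) := by
        congr 1; ext z; rw [lintegral_const_mul _ (by fun_prop)]
    _ = ∫⁻ x, ∫⁻ z, u z * (f x * K ((x - z) / R)) :=
        lintegral_lintegral_swap ((hu.comp measurable_fst).mul
          ((hf.comp measurable_snd).mul h3)).aemeasurable
    _ = _ := by
        congr 1; ext x; rw [← lintegral_const_mul _ (by fun_prop)]
        congr 1; ext z; ring

lemma wt_le_of_abs_sub_le {R : ℝ} (hR : 0 < R) (c : ℝ × ℝ) {x z : ℝ} (y : ℝ) (h : |x - z| ≤ R) :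
    wt c R (x, y) ≤ 2 ^ 100 * wt c R (z, y) := by
  simp only [wt, ← mul_assoc]
  gcongr
  refine bw_le_of_abs_sub_le 100 ?_
  rw [← sub_div, abs_div, abs_of_pos hR, div_le_one hR]
  simpa using h

lemma wt_mul_bw_le (R : ℝ) (c : ℝ × ℝ) (x z y : ℝ) :
    wt c R (z, y) * bw 100 ((x - z) / R) ≤ wt c R (x, y) := by
  simp only [wt]
  rw [mul_right_comm]
  gcongr
  have := bw_peetre 100 ((z - c.1) / R) ((x - c.1) / R)
  rwa [show (z - c.1) / R - (x - c.1) / R = -((x - z) / R) by ring, bw_neg] at this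

/-- Inequalities localized to windows of width `R` in the first variable imply weighted ones. -/
lemma lintegral_mul_wt_le_of_local {K : ℝ → ℝ≥0∞} (hK : Measurable K) {c₁ B A : ℝ≥0∞}
    (hc₁ : c₁ ≠ ∞) (hB : B ≠ ∞) (hlow : ∀ v, |v| ≤ 1 → c₁ ≤ K v)
    (hup : ∀ v, K v ≤ B * bw (100 + 2) v) {R : ℝ} (hR : 0 < R) {c : ℝ × ℝ} (hA : A ≠ ∞)
    (hA' : ∀ x z y : ℝ, |x - z| ≤ R → wt c R (x, y) ≤ A * wt c R (z, y))
    {F G : ℝ × ℝ → ℝ≥0∞} (hF : Measurable F) (hG : Measurable G)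
    (hloc : ∀ y z, ∫⁻ x, F (x, y) * K ((x - z) / R) ≤ ∫⁻ x, G (x, y) * K ((x - z) / R)) :
    c₁ * ∫⁻ x, F x * wt c R x ≤ A * (4 * B) * ∫⁻ x, G x * wt c R x := by
  have hR' : ENNReal.ofReal R ≠ 0 := (ENNReal.ofReal_pos.2 hR).ne'
  have hw : ∀ y, Measurable fun x => wt c R (x, y) := fun y =>
    (wt_measurable c R).comp measurable_prodMk_right
  have hF' : ∀ y, Measurable fun x => F (x, y) := fun y => hF.comp measurable_prodMk_right
  have hG' : ∀ y, Measurable fun x => G (x, y) := fun y => hG.comp measurable_prodMk_right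
  have hy : ∀ y, ENNReal.ofReal R * c₁ * ∫⁻ x, F (x, y) * wt c R (x, y) ≤
      ENNReal.ofReal R * (A * (4 * B)) * ∫⁻ x, G (x, y) * wt c R (x, y) := fun y => by
    calc _ = ∫⁻ x, F (x, y) * (ENNReal.ofReal R * (c₁ * wt c R (x, y))) := by
          rw [← lintegral_const_mul' _ _ (by finiteness)]
          congr 1; ext x; ring
      _ ≤ ∫⁻ x, F (x, y) * (A * ∫⁻ z, wt c R (z, y) * K ((x - z) / R)) := by
          refine lintegral_mono fun x => mul_le_mul' le_rfl ?_
          exact le_lintegral_average hR hA (u := fun z => wt c R (z, y))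
            (fun z hz => hA' x z y hz) hlow
      _ = A * ∫⁻ z, wt c R (z, y) * ∫⁻ x, F (x, y) * K ((x - z) / R) := by
          rw [lintegral_average_swap (hF' y) (hw y) hK, ← lintegral_const_mul' _ _ hA]
          congr 1; ext x; ring
      _ ≤ A * ∫⁻ z, wt c R (z, y) * ∫⁻ x, G (x, y) * K ((x - z) / R) := by
          exact mul_le_mul' le_rfl (lintegral_mono fun z => mul_le_mul' le_rfl (hloc y z))
      _ = A * ∫⁻ x, G (x, y) * ∫⁻ z, wt c R (z, y) * K ((x - z) / R) := by
          rw [lintegral_average_swap (hG' y) (hw y) hK]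
      _ ≤ A * ∫⁻ x, G (x, y) * (ENNReal.ofReal R * (4 * B * wt c R (x, y))) := by
          refine mul_le_mul' le_rfl (lintegral_mono fun x => mul_le_mul' le_rfl ?_)
          exact lintegral_average_le hR (u := fun z => wt c R (z, y))
            (fun z => wt_mul_bw_le R c x z y) hup
      _ = _ := by
          rw [← lintegral_const_mul' _ _ hA, ← lintegral_const_mul' _ _ (by finiteness)]
          congr 1; ext x; ring
  have hm : ENNReal.ofReal R * (c₁ * ∫⁻ x, F x * wt c R x) ≤
      ENNReal.ofReal R * (A * (4 * B) * ∫⁻ x, G x * wt c R x) := by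
    rw [← mul_assoc, ← mul_assoc, Measure.volume_eq_prod, lintegral_prod_symm' (fun x => F x * wt c R x) (by fun_prop),
      lintegral_prod_symm' (fun x => G x * wt c R x) (by fun_prop),
      ← lintegral_const_mul' _ _ (by finiteness), ← lintegral_const_mul' _ _ (by finiteness)]
    exact lintegral_mono hy
  rwa [ENNReal.mul_le_mul_iff_right hR' ENNReal.ofReal_ne_top] at hm

/-- Local `L²` orthogonality on a square of side `R` for intervals of length `1/R`. -/
lemma exists_local_orthogonality : ∃ C : ℝ≥0∞, C ≠ ∞ ∧ ∀ (R : ℝ), 0 < R → ∀ (a : ℝ) (N : ℕ)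
    (h : ℝ → ℂ), Integrable h → ∀ c : ℝ × ℝ,
    ∫⁻ x, ‖pext (pc h a (a + N * (1 / R))) x‖ₑ ^ 2 * wt c R x ≤
      C * ∑ l ∈ Finset.range N,
        ∫⁻ x, ‖pext (pc h (a + l * (1 / R)) (a + (l + 1) * (1 / R))) x‖ₑ ^ 2 * wt c R x := by
  obtain ⟨χ, θ, c₀, hc₀, hχ, hθ, hθ', hlow⟩ := exists_window
  obtain ⟨B, -, hB, hdec⟩ := θ.exists_enorm_le_bw 51
  obtain ⟨A, hA, hA'⟩ : ∃ A : ℝ≥0∞, A ≠ ∞ ∧ ∀ R, 0 < R → ∀ (c : ℝ × ℝ) (x z y : ℝ),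
      |x - z| ≤ R → wt c R (x, y) ≤ A * wt c R (z, y) :=
    ⟨2 ^ 100, by finiteness, fun R hR c x z y h => wt_le_of_abs_sub_le hR c y h⟩
  have hKm : Measurable fun v => ‖θ v‖ₑ ^ 2 := θ.continuous.measurable.enorm.pow_const 2
  have hc1 : ENNReal.ofReal c₀ ^ 2 ≠ 0 := pow_ne_zero _ (ENNReal.ofReal_pos.2 hc₀).ne'
  have hKlow : ∀ v, |v| ≤ 1 → ENNReal.ofReal c₀ ^ 2 ≤ ‖θ v‖ₑ ^ 2 := fun v hv => by
    refine pow_le_pow_left' ?_ 2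
    rw [← ofReal_norm]; exact ENNReal.ofReal_le_ofReal (hlow v (by linarith))
  have hKup : ∀ v, ‖θ v‖ₑ ^ 2 ≤ B ^ 2 * bw (100 + 2) v := fun v => by
    rw [show 100 + 2 = 51 + 51 by norm_num, bw_add]
    exact (pow_le_pow_left' (hdec v) 2).trans_eq (by ring)
  refine ⟨(ENNReal.ofReal c₀ ^ 2)⁻¹ * (A * (4 * B ^ 2) * 2), by finiteness,
    fun R hR a N h hh c => ?_⟩
  set hl : ℕ → ℝ → ℂ := fun l => pc h (a + l * (1 / R)) (a + (l + 1) * (1 / R))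
  have hli : ∀ l, Integrable (hl l) := fun l => pc_integrable hh _ _
  have hF : ∀ {f : ℝ → ℂ}, Integrable f → Measurable fun x : ℝ × ℝ => ‖pext f x‖ₑ ^ 2 :=
    fun hf => (pext_enorm_measurable hf).pow_const 2
  have hsum : ∀ x, pext (pc h a (a + N * (1 / R))) x = ∑ l ∈ Finset.range N, pext (hl l) x :=
    fun x => by
    rw [← pext_sum _ hli]
    congr 1; ext ξ; exact pc_sum h a (by positivity) N ξ
  have hloc : ∀ y z, ∫⁻ x, ‖pext (pc h a (a + N * (1 / R))) (x, y)‖ₑ ^ 2 * ‖θ ((x - z) / R)‖ₑ ^ 2 ≤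
      ∫⁻ x, (2 * ∑ l ∈ Finset.range N, ‖pext (hl l) (x, y)‖ₑ ^ 2) * ‖θ ((x - z) / R)‖ₑ ^ 2 :=
    fun y z => by
    have h1 : ∀ l x, pext (hl l) (x, y) = ∫ ξ, hl l ξ * ec (ξ ^ 2 * y) * ec (x * ξ) :=
      fun l x => by
      rw [pext]; congr 1; ext ξ
      rw [mul_assoc, ← ec_add]; congr 2; ring
    have h2 := lintegral_window_sum_le hχ hθ hθ' hR z N
      (H := fun l ξ => hl l ξ * ec (ξ ^ 2 * y)) (fun l => integrable_mul_ec (hli l)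
      (by fun_prop)) fun i j hij ξ ξ' hξ hξ' => by
        have h2 := pc_apply_ne_zero (left_ne_zero_of_mul hξ)
        have h3 := pc_apply_ne_zero (left_ne_zero_of_mul hξ')
        have h4 : (i : ℝ) + 2 ≤ j := by exact_mod_cast hij
        have h5 : 1 / R ≤ ξ' - ξ := by
          have h6 : 0 < 1 / R := by positivity
          nlinarith [h2.2, h3.1]
        rw [← div_le_iff₀ hR, abs_sub_comm]
        exact h5.trans (le_abs_self _)
    simp_rw [← h1, ← hsum] at h2
    refine h2.trans_eq ?_
    have h3 : ∀ l, Measurable fun x => ‖pext (hl l) (x, y)‖ₑ ^ 2 := fun l =>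
      (hF (hli l)).comp measurable_prodMk_right
    have h4 : Measurable fun x => ‖θ ((x - z) / R)‖ₑ ^ 2 := hKm.comp (by fun_prop)
    rw [← lintegral_finsetSum _ fun l _ => by fun_prop, ← lintegral_const_mul' _ _ (by simp)]
    simp_rw [mul_assoc, Finset.sum_mul]
  have hmain := lintegral_mul_wt_le_of_local hKm (by finiteness) (by finiteness) hKlow hKup hR hA
    (hA' R hR c) (hF (pc_integrable hh a (a + N * (1 / R))))
    ((Finset.measurable_fun_sum (Finset.range N) fun l _ => hF (hli l)).const_mul 2) hloc
  calc _ = (ENNReal.ofReal c₀ ^ 2)⁻¹ * (ENNReal.ofReal c₀ ^ 2 *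
          ∫⁻ x, ‖pext (pc h a (a + N * (1 / R))) x‖ₑ ^ 2 * wt c R x) := by
        rw [← mul_assoc, ENNReal.inv_mul_cancel hc1 (by finiteness), one_mul]
    _ ≤ _ := by
        refine (mul_le_mul_right hmain _).trans_eq ?_
        simp_rw [mul_assoc, Finset.sum_mul]
        rw [lintegral_const_mul' _ _ (by simp),
          lintegral_finsetSum _ fun l _ => (by
            have := hF (hli l)
            fun_prop)]

lemma sum_bw_two_le {θ : ℝ} (h0 : 0 < θ) (h2 : θ ≤ 2) (A : ℝ) (N : ℕ) :
    ∑ j ∈ Finset.range N, bw 2 (A - θ * j) ≤ 36 * ENNReal.ofReal θ⁻¹ := by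
  have h1 : ∀ j : ℕ, ENNReal.ofReal θ * bw 2 (A - θ * j) ≤
      ∫⁻ s in Set.Ico (θ * (j : ℝ)) (θ * ((j : ℝ) + 1)), 9 * bw 2 (A - s) := fun j => by
    calc ENNReal.ofReal θ * bw 2 (A - θ * j)
        = ∫⁻ s in Set.Ico (θ * (j : ℝ)) (θ * ((j : ℝ) + 1)), bw 2 (A - θ * j) := by
          rw [lintegral_const, Measure.restrict_apply_univ, Real.volume_Ico, mul_comm]
          congr 2; ring
      _ ≤ _ := by
          refine setLIntegral_mono' measurableSet_Ico fun s hs => ?_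
          have h3 : |s - θ * j| ≤ 2 := abs_le.2 ⟨by linarith [hs.1], by nlinarith [hs.2]⟩
          have := bw_le_of_abs_le 2 (A := 3) (v := A - θ * j) (w := A - s) (by norm_num) (by
            have h4 := abs_sub_abs_le_abs_sub (A - s) (A - θ * j)
            rw [show A - s - (A - θ * j) = -(s - θ * j) by ring, abs_neg] at h4
            linarith [abs_nonneg (A - θ * j)])
          norm_num at this ⊢
          exact this
  have h3 : ENNReal.ofReal θ * ∑ j ∈ Finset.range N, bw 2 (A - θ * j) ≤ 36 := by
    rw [Finset.mul_sum]
    calc _ ≤ ∑ j ∈ Finset.range N,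
          ∫⁻ s in Set.Ico (θ * (j : ℝ)) (θ * ((j : ℝ) + 1)), 9 * bw 2 (A - s) :=
          Finset.sum_le_sum fun j _ => h1 j
      _ = ∫⁻ s in ⋃ j ∈ Finset.range N, Set.Ico (θ * (j : ℝ)) (θ * ((j : ℝ) + 1)),
            9 * bw 2 (A - s) := by
          rw [lintegral_biUnion_finset _ fun j _ => measurableSet_Ico]
          intro i _ j _ hij
          refine Set.disjoint_left.2 fun s hi hj => ?_
          rcases lt_or_gt_of_ne hij with h | h
          · have : (i : ℝ) + 1 ≤ j := by exact_mod_cast h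
            nlinarith [hi.2, hj.1]
          · have : (j : ℝ) + 1 ≤ i := by exact_mod_cast h
            nlinarith [hj.2, hi.1]
      _ ≤ ∫⁻ s, 9 * bw 2 (A - s) := setLIntegral_le_lintegral _ _
      _ = 9 * ∫⁻ s, bw 2 s := by
          rw [lintegral_const_mul' _ _ (by simp), lintegral_sub_left_eq_self (bw 2) A]
      _ ≤ 9 * 4 := by gcongr; exact lintegral_bw_two
      _ = 36 := by norm_num
  rw [ENNReal.ofReal_inv_of_pos h0, ← div_eq_mul_inv, ENNReal.le_div_iff_mul_le, mul_comm]
  · exact h3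
  · left; exact (ENNReal.ofReal_pos.2 h0).ne'
  · left; exact ENNReal.ofReal_ne_top

lemma sum_bw_two_nat_le (A : ℝ) (N : ℕ) :
    ∑ j ∈ Finset.range N, bw 2 (A - j) ≤ 36 := by
  simpa using sum_bw_two_le one_pos one_le_two A N

lemma bw_two_mul_le (x y : ℝ) : bw 2 x * bw 2 y ≤ 4 * bw 2 (x - y) * (bw 2 x + bw 2 y) := by
  have key : ∀ x y : ℝ, |y| ≤ |x| → bw 2 x ≤ 4 * bw 2 (x - y) := fun x y h => by
    have := bw_le_of_abs_le 2 (A := 2) (v := x) (w := x - y) (by norm_num) (by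
      linarith [abs_sub x y])
    norm_num at this ⊢; exact this
  rcases le_total |y| |x| with h | h
  · calc _ ≤ 4 * bw 2 (x - y) * bw 2 y := by gcongr; exact key x y h
      _ ≤ _ := by gcongr; exact le_add_self
  · calc _ ≤ bw 2 x * (4 * bw 2 (x - y)) := by
          gcongr; rw [← bw_neg 2 (x - y), neg_sub]; exact key y x h
      _ ≤ _ := by rw [mul_comm]; gcongr; exact le_self_add

/-- Transversal strips: the bilinear Kakeya count. -/
lemma sum_sum_bw_le {L : ℕ} (hL : 0 < L) {K a a' : ℝ} (hK : 1 ≤ K) (h1 : 1 / K ≤ |a - a'|)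
    (h2 : |a - a'| ≤ 1) (τ τ' : ℝ) :
    ∑ i ∈ Finset.range L, ∑ j ∈ Finset.range L,
      (bw 2 (τ - i - 2 * a * j) + ENNReal.ofReal (L ^ 2 : ℝ)⁻¹) *
        (bw 2 (τ' - i - 2 * a' * j) + ENNReal.ofReal (L ^ 2 : ℝ)⁻¹) ≤ 20000 * ENNReal.ofReal K := by
  set ε : ℝ≥0∞ := ENNReal.ofReal (L ^ 2 : ℝ)⁻¹ with hε
  have hL0 : (0 : ℝ) < L := by exact_mod_cast hL
  have hL1 : (1 : ℝ) ≤ L := by exact_mod_cast hL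
  have hεL : (L : ℝ≥0∞) * (L * ε) = 1 := by
    rw [hε, ← ENNReal.ofReal_natCast, ← ENNReal.ofReal_mul hL0.le, ← ENNReal.ofReal_mul hL0.le]
    rw [show (L : ℝ) * (L * (L ^ 2 : ℝ)⁻¹) = 1 by field_simp]; simp
  have hε1 : ε ≤ 1 := by
    rw [hε, ← ENNReal.ofReal_one]
    exact ENNReal.ofReal_le_ofReal (inv_le_one_of_one_le₀ (one_le_pow₀ hL1))
  have hKE : 1 ≤ ENNReal.ofReal K := ENNReal.one_le_ofReal.2 hK
  have hsq : ∀ a τ : ℝ, ∑ i ∈ Finset.range L, ∑ j ∈ Finset.range L,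
      bw 2 (τ - i - 2 * a * j) ≤ L * 36 := fun a τ => by
    rw [Finset.sum_comm]
    calc _ ≤ ∑ j ∈ Finset.range L, (36 : ℝ≥0∞) := Finset.sum_le_sum fun j _ => by
          have := sum_bw_two_nat_le (τ - 2 * a * j) L
          simpa only [sub_right_comm] using this
      _ = _ := by simp
  have hmain : ∑ i ∈ Finset.range L, ∑ j ∈ Finset.range L,
      bw 2 (τ - i - 2 * a * j) * bw 2 (τ' - i - 2 * a' * j) ≤
      10368 * ENNReal.ofReal K := by
    rw [Finset.sum_comm]
    have hj : ∀ j : ℕ, ∑ i ∈ Finset.range L,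
        bw 2 (τ - i - 2 * a * j) * bw 2 (τ' - i - 2 * a' * j) ≤
        288 * bw 2 (τ - τ' - 2 * (a - a') * j) := fun j => by
      calc _ ≤ ∑ i ∈ Finset.range L, 4 * bw 2 (τ - τ' - 2 * (a - a') * j) *
            (bw 2 (τ - i - 2 * a * j) + bw 2 (τ' - i - 2 * a' * j)) := by
            refine Finset.sum_le_sum fun i _ => ?_
            refine (bw_two_mul_le _ _).trans_eq ?_
            congr 3; ring
        _ ≤ 4 * bw 2 (τ - τ' - 2 * (a - a') * j) * (36 + 36) := by
            rw [← Finset.mul_sum, Finset.sum_add_distrib]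
            have := sum_bw_two_nat_le (τ - 2 * a * j) L
            have h' := sum_bw_two_nat_le (τ' - 2 * a' * j) L
            simp only [sub_right_comm] at this h'
            gcongr
        _ = _ := by ring
    have hθ : ∑ j ∈ Finset.range L, bw 2 (τ - τ' - 2 * (a - a') * j) ≤
        36 * ENNReal.ofReal (2 * |a - a'|)⁻¹ := by
      have h0 : 0 < |a - a'| := lt_of_lt_of_le (by positivity) h1
      rcases abs_cases (a - a') with ⟨h, -⟩ | ⟨h, -⟩
      · have := sum_bw_two_le (θ := 2 * |a - a'|) (by positivity) (by linarith) (τ - τ') L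
        rwa [h] at this ⊢
      · have := sum_bw_two_le (θ := 2 * |a - a'|) (by positivity) (by linarith) (-(τ - τ')) L
        refine le_trans (le_of_eq (Finset.sum_congr rfl fun j _ => ?_)) this
        rw [h, ← bw_neg]; congr 1; ring
    have hK' : (2 * |a - a'|)⁻¹ ≤ K := by
      have h3 := inv_anti₀ (by positivity) h1
      rw [one_div, inv_inv] at h3
      have h0 : 0 < |a - a'| := lt_of_lt_of_le (by positivity) h1
      have h4 := inv_nonneg.2 h0.le
      rw [mul_inv]; linarith
    calc _ ≤ ∑ j ∈ Finset.range L, 288 * bw 2 (τ - τ' - 2 * (a - a') * j) :=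
          Finset.sum_le_sum fun j _ => hj j
      _ ≤ 288 * (36 * ENNReal.ofReal K) := by
          rw [← Finset.mul_sum]
          gcongr
          exact hθ.trans (by gcongr)
      _ = _ := by rw [← mul_assoc]; norm_num
  calc _ = ∑ i ∈ Finset.range L, ∑ j ∈ Finset.range L,
        bw 2 (τ - i - 2 * a * j) * bw 2 (τ' - i - 2 * a' * j) +
        ε * ∑ i ∈ Finset.range L, ∑ j ∈ Finset.range L, bw 2 (τ - i - 2 * a * j) +
        ε * ∑ i ∈ Finset.range L, ∑ j ∈ Finset.range L, bw 2 (τ' - i - 2 * a' * j) +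
        (L : ℝ≥0∞) * (L * ε) * ε := by
        have h5 : (L : ℝ≥0∞) * (L * ε) * ε = ∑ i ∈ Finset.range L, ∑ j ∈ Finset.range L, ε * ε := by
          simp; ring
        rw [h5]
        simp_rw [Finset.mul_sum, ← Finset.sum_add_distrib]
        refine Finset.sum_congr rfl fun i _ => Finset.sum_congr rfl fun j _ => by ring
    _ ≤ 10368 * ENNReal.ofReal K + ε * (L * 36) + ε * (L * 36) + 1 * ε := by
        rw [hεL]; gcongr <;> apply hsq
    _ ≤ 10368 * ENNReal.ofReal K + 36 + 36 + 1 := by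
        have h6 : ε * (L * 36) ≤ 36 := by
          calc ε * (L * 36) = 36 * (1 * (L * ε)) := by ring
            _ ≤ 36 * (L * (L * ε)) := by
              gcongr; exact_mod_cast hL
            _ = 36 := by rw [hεL, mul_one]
        gcongr; simpa using hε1
    _ ≤ 10368 * ENNReal.ofReal K + 36 * ENNReal.ofReal K + 36 * ENNReal.ofReal K +
        1 * ENNReal.ofReal K := by
        gcongr <;> exact le_mul_of_one_le_right' hKE
    _ = 10441 * ENNReal.ofReal K := by ring
    _ ≤ _ := by gcongr; norm_num

lemma bw_le_rescale {N : ℕ} (hN : 4 ≤ N) {L : ℝ} (hL : 1 ≤ L) (β : ℝ) :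
    bw N β ≤ 2 ^ N * ((bw 4 β + ENNReal.ofReal (L ^ 3)⁻¹) * bw N (β / L)) := by
  have hL0 : 0 < L := by linarith
  rcases le_or_gt |β| L with h | h
  · have h1 := bw_le_of_abs_sub_le N (x := 0) (y := β / L) (by
      rwa [zero_sub, abs_neg, abs_div, abs_of_pos hL0, div_le_one hL0])
    calc bw N β ≤ bw 4 β * 1 := by rw [mul_one]; exact bw_anti hN β
      _ ≤ bw 4 β * (2 ^ N * bw N (β / L)) := by
        gcongr; refine le_trans ?_ h1; simp [bw]
      _ = 2 ^ N * (bw 4 β * bw N (β / L)) := by ring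
      _ ≤ _ := by gcongr; exact le_self_add
  · calc bw N β ≤ 2 ^ N * (ENNReal.ofReal (L ^ 3)⁻¹ * bw N (β / L)) := by
          rw [bw, bw, ← ENNReal.ofReal_mul (by positivity), ← ENNReal.ofReal_ofNat,
            ← ENNReal.ofReal_pow (by norm_num), ← ENNReal.ofReal_mul (by positivity)]
          refine ENNReal.ofReal_le_ofReal ?_
          rw [← mul_inv, ← div_eq_mul_inv, le_div_iff₀ (by positivity), ← div_eq_inv_mul,
            div_le_iff₀ (by positivity), ← mul_pow]
          calc L ^ 3 * (1 + |β / L|) ^ N ≤ L ^ N * (1 + |β / L|) ^ N := by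
                gcongr
                omega
            _ = (L + |β|) ^ N := by
                rw [← mul_pow, abs_div, abs_of_pos hL0]; congr 1; field_simp
            _ ≤ _ := by gcongr; linarith
      _ ≤ _ := by gcongr; exact le_add_self

/-- Averaging the weight at scale `L` along the direction `(-2a, 1)` up to scale `L²`. -/
lemma lintegral_weight_along_le {N : ℕ} (hN : 4 ≤ N) {k : ℝ → ℝ≥0∞} {B : ℝ≥0∞} (hB : B ≠ ∞)
    (hk : ∀ y, k y ≤ B * bw (2 + (N + N)) y) {L : ℝ} (hL : 1 ≤ L) {a : ℝ} (ha : |a| ≤ 1)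
    {u₁ u₂ v₁ v₂ : ℝ} (h1 : |v₁ - u₁| ≤ L ^ 2) (h2 : |v₂ - u₂| ≤ L ^ 2) :
    ∫⁻ y, k y * (bw N ((v₁ - 2 * a * L ^ 2 * y) / L) * bw N ((v₂ + L ^ 2 * y) / L)) ≤
      16 * B * (2 ^ N) ^ 6 * ENNReal.ofReal L⁻¹ *
        (bw 2 ((v₁ + 2 * a * v₂) / L) + ENNReal.ofReal (L ^ 2)⁻¹) *
        (bw N (u₁ / L ^ 2) * bw N (u₂ / L ^ 2)) := by
  have hL0 : 0 < L := by linarith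
  set A : ℝ≥0∞ := 2 ^ N with hA
  have hAt : A ≠ ∞ := by finiteness
  set ε := ENNReal.ofReal (L ^ 3)⁻¹ with hε
  have hε1 : ε ≤ 1 := by
    rw [hε, ← ENNReal.ofReal_one]
    exact ENNReal.ofReal_le_ofReal (inv_le_one_of_one_le₀ (one_le_pow₀ hL))
  have hshift : ∀ (m : ℝ), |m| ≤ 2 → ∀ u v y : ℝ, |v - u| ≤ L ^ 2 →
      bw N y * bw N ((v + m * L ^ 2 * y) / L / L) ≤ A * (A * bw N (u / L ^ 2)) :=
    fun m hm u v y huv => by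
    have e1 : bw N y ≤ A * bw N (m * y) := by
      have := bw_le_of_abs_le N (A := 2) (v := y) (w := m * y) (by norm_num) (by
        rw [abs_mul]; nlinarith [abs_nonneg y, abs_nonneg m])
      rwa [ENNReal.ofReal_pow (by norm_num), ENNReal.ofReal_ofNat] at this
    have e2 : (v + m * L ^ 2 * y) / L / L - v / L ^ 2 = m * y := by field_simp; ring
    have e3 := bw_peetre N ((v + m * L ^ 2 * y) / L / L) (v / L ^ 2)
    rw [e2] at e3
    have e4 : bw N (v / L ^ 2) ≤ A * bw N (u / L ^ 2) := bw_le_of_abs_sub_le N (by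
      rwa [← sub_div, abs_div, abs_of_pos (show (0 : ℝ) < L ^ 2 by positivity),
        div_le_one (by positivity)])
    calc _ ≤ A * bw N (m * y) * bw N ((v + m * L ^ 2 * y) / L / L) := by gcongr
      _ = A * (bw N ((v + m * L ^ 2 * y) / L / L) * bw N (m * y)) := by ring
      _ ≤ _ := mul_le_mul' le_rfl (e3.trans e4)
  set T := bw 2 ((v₁ + 2 * a * v₂) / L) with hT
  have hcross : ∀ β₁ β₂, (v₁ + 2 * a * v₂) / L = β₁ + 2 * a * β₂ →
      (bw 4 β₁ + ε) * (bw 4 β₂ + ε) ≤ 4 * T * bw 2 β₂ + 3 * ε := fun β₁ β₂ h => by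
    have e1 : bw 4 β₁ * bw 4 β₂ ≤ 4 * T * bw 2 β₂ := by
      have e2 : bw 2 β₁ * bw 2 β₂ ≤ 4 * T := by
        rw [hT, h, bw, bw, bw, ← ENNReal.ofReal_mul (by positivity), ← ENNReal.ofReal_ofNat,
          ← ENNReal.ofReal_mul (by norm_num)]
        refine ENNReal.ofReal_le_ofReal ?_
        rw [← mul_inv, ← div_eq_mul_inv, le_div_iff₀ (by positivity), ← div_eq_inv_mul,
          div_le_iff₀ (by positivity), ← mul_pow, show (4 : ℝ) = 2 ^ 2 by norm_num, ← mul_pow]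
        refine pow_le_pow_left₀ (by positivity) ?_ 2
        have e5 : |β₁ + 2 * a * β₂| ≤ |β₁| + 2 * |β₂| := by
          refine (abs_add_le _ _).trans ?_
          rw [abs_mul, abs_mul, abs_two]; nlinarith [abs_nonneg β₂]
        nlinarith [abs_nonneg β₂, abs_nonneg β₁, mul_nonneg (abs_nonneg β₁) (abs_nonneg β₂)]
      calc bw 4 β₁ * bw 4 β₂ ≤ bw 2 β₁ * (bw 2 β₂ * bw 2 β₂) := by
            rw [← bw_add]; gcongr; exact bw_anti (by norm_num) _
        _ = bw 2 β₁ * bw 2 β₂ * bw 2 β₂ := by ring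
        _ ≤ _ := by gcongr
    calc _ = bw 4 β₁ * bw 4 β₂ + (bw 4 β₁ * ε + bw 4 β₂ * ε + ε * ε) := by ring
      _ ≤ 4 * T * bw 2 β₂ + (1 * ε + 1 * ε + 1 * ε) := by
          gcongr <;> exact bw_le_one _ _
      _ = _ := by ring
  set W := bw N (u₁ / L ^ 2) * bw N (u₂ / L ^ 2) with hW
  have hWt : W ≠ ∞ := ENNReal.mul_ne_top (bw_ne_top _ _) (bw_ne_top _ _)
  have hTt : T ≠ ∞ := bw_ne_top _ _
  have hpt : ∀ y, k y * (bw N ((v₁ - 2 * a * L ^ 2 * y) / L) * bw N ((v₂ + L ^ 2 * y) / L)) ≤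
      B * A ^ 6 * W * (4 * T * bw 2 ((L : ℝ) * y + v₂ / L) + 3 * ε * bw 2 y) := fun y => by
    set β₁ := (v₁ - 2 * a * L ^ 2 * y) / L with hβ₁
    set β₂ := (v₂ + L ^ 2 * y) / L with hβ₂
    have e1 : β₂ = L * y + v₂ / L := by rw [hβ₂]; field_simp; ring
    have e2 : (v₁ + 2 * a * v₂) / L = β₁ + 2 * a * β₂ := by rw [hβ₁, hβ₂]; field_simp; ring
    have e3 : bw N y * bw N (β₁ / L) ≤ A * (A * bw N (u₁ / L ^ 2)) := by
      have := hshift (-(2 * a)) (by rw [abs_neg, abs_mul, abs_two]; linarith) u₁ v₁ y h1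
      rwa [show v₁ + -(2 * a) * L ^ 2 * y = v₁ - 2 * a * L ^ 2 * y by ring] at this
    have e4 : bw N y * bw N (β₂ / L) ≤ A * (A * bw N (u₂ / L ^ 2)) := by
      have := hshift 1 (by norm_num) u₂ v₂ y h2
      rwa [one_mul] at this
    rw [← e1]
    calc _ ≤ B * bw (2 + (N + N)) y * ((A * ((bw 4 β₁ + ε) * bw N (β₁ / L))) *
          (A * ((bw 4 β₂ + ε) * bw N (β₂ / L)))) := by
          gcongr
          · exact hk y
          · exact bw_le_rescale hN hL _
          · exact bw_le_rescale hN hL _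
      _ = B * A ^ 2 * bw 2 y * ((bw 4 β₁ + ε) * (bw 4 β₂ + ε)) *
          ((bw N y * bw N (β₁ / L)) * (bw N y * bw N (β₂ / L))) := by
          rw [bw_add, bw_add]; ring
      _ ≤ B * A ^ 2 * bw 2 y * (4 * T * bw 2 β₂ + 3 * ε) *
          ((A * (A * bw N (u₁ / L ^ 2))) * (A * (A * bw N (u₂ / L ^ 2)))) := by
          gcongr; exact hcross _ _ e2
      _ = B * A ^ 6 * W * (bw 2 y * (4 * T * bw 2 β₂) + 3 * ε * bw 2 y) := by rw [hW]; ring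
      _ ≤ B * A ^ 6 * W * (1 * (4 * T * bw 2 β₂) + 3 * ε * bw 2 y) := by
          gcongr; exact bw_le_one _ _
      _ = _ := by rw [one_mul]
  have hεL : ε = ENNReal.ofReal L⁻¹ * ENNReal.ofReal (L ^ 2)⁻¹ := by
    rw [hε, ← ENNReal.ofReal_mul (by positivity)]; congr 1; field_simp
  calc _ ≤ ∫⁻ y, B * A ^ 6 * W * (4 * T * bw 2 ((L : ℝ) * y + v₂ / L) + 3 * ε * bw 2 y) :=
        lintegral_mono hpt
    _ = B * A ^ 6 * W * (4 * T * (ENNReal.ofReal L⁻¹ * ∫⁻ v, bw 2 v) +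
          3 * ε * ∫⁻ v, bw 2 v) := by
        have hεt : ε ≠ ∞ := ENNReal.ofReal_ne_top
        rw [lintegral_const_mul' _ _ (by finiteness), lintegral_add_left (by fun_prop),
          lintegral_const_mul' _ _ (by finiteness), lintegral_const_mul' _ _ (by finiteness),
          lintegral_comp_mul_add (by fun_prop) hL0.ne', abs_of_pos (by positivity)]
    _ ≤ B * A ^ 6 * W * (4 * T * (ENNReal.ofReal L⁻¹ * 4) + 4 * ε * 4) := by
        gcongr
        · exact lintegral_bw_two
        · norm_num
        · exact lintegral_bw_two
    _ = _ := by rw [hεL]; ring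

/-- An extension operator over an interval of length `1/L` is locally constant at scale `L²` along
the direction normal to the parabola. -/
lemma enorm_pext_rpow_le_along {ρ : 𝓢(ℝ, ℂ)}
    (hρ : ∀ w, |w| ≤ 10 → ∫ y, ρ y * ec (-(y * w)) = 1) {L : ℝ} (hL : 1 ≤ L) {a : ℝ}
    {h : ℝ → ℂ} (hh : Integrable h) (hs : ∀ ξ, h ξ ≠ 0 → a ≤ ξ ∧ ξ ≤ a + 1 / L) {q : ℝ}
    (hq : 1 ≤ q) (x : ℝ × ℝ) :
    ‖pext h x‖ₑ ^ q ≤ (∫⁻ y, ‖ρ y‖ₑ) ^ (q - 1) *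
      ∫⁻ y, ‖ρ y‖ₑ * ‖pext h (x.1 + 2 * a * L ^ 2 * y, x.2 - L ^ 2 * y)‖ₑ ^ q := by
  have hL0 : 0 < L := by linarith
  have key := enorm_integral_multiplier_rpow_le (integrable_mul_ec hh
    (φ := fun ξ => ξ * x.1 + ξ ^ 2 * x.2) (by fun_prop)) (m := fun _ => 1)
    (ω := fun ξ => L ^ 2 * (ξ - a) ^ 2) (by fun_prop) (ρ.integrable (μ := volume))
    (fun ξ hξ => hρ _ ?_) hq
  · simp only [mul_one] at key
    refine key.trans (mul_le_mul' le_rfl (lintegral_mono fun y => mul_le_mul' le_rfl (le_of_eq ?_)))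
    congr 1
    have : pext h (x.1 + 2 * a * L ^ 2 * y, x.2 - L ^ 2 * y) = ec (a ^ 2 * L ^ 2 * y) *
        ∫ ξ, h ξ * ec (ξ * x.1 + ξ ^ 2 * x.2) * ec (-(y * (L ^ 2 * (ξ - a) ^ 2))) := by
      rw [pext, ← integral_const_mul]
      congr 1; ext ξ
      rw [mul_assoc (h ξ), ← ec_add, mul_left_comm, ← ec_add]; congr 2; ring
    rw [this, enorm_mul, enorm_ec, one_mul]
  · obtain ⟨h1, h2⟩ := hs ξ (left_ne_zero_of_mul hξ)
    have h3 : L * (ξ - a) ≤ 1 := by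
      rw [← le_div_iff₀' hL0]; linarith
    have h4 : 0 ≤ L * (ξ - a) := mul_nonneg hL0.le (by linarith)
    rw [← mul_pow, abs_of_nonneg (by positivity)]
    nlinarith

lemma exists_lintegral_rpow_wt_le : ∃ C : ℝ≥0∞, C ≠ ∞ ∧ ∀ L : ℝ, 1 ≤ L → ∀ a : ℝ, |a| ≤ 1 →
    ∀ h : ℝ → ℂ, Integrable h → (∀ ξ, h ξ ≠ 0 → a ≤ ξ ∧ ξ ≤ a + 1 / L) → ∀ q : ℝ, 1 ≤ q → q ≤ 3 →
    ∀ c d : ℝ × ℝ, |d.1 - c.1| ≤ L ^ 2 → |d.2 - c.2| ≤ L ^ 2 →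
    ∫⁻ x, ‖pext h x‖ₑ ^ q * wt c L x ≤ C * ENNReal.ofReal L⁻¹ *
      ∫⁻ x, ‖pext h x‖ₑ ^ q * wt d (L ^ 2) x *
        (bw 2 ((x.1 - c.1 + 2 * a * (x.2 - c.2)) / L) + ENNReal.ofReal (L ^ 2)⁻¹) := by
  obtain ⟨ρ, hρ⟩ := exists_reproducing_kernel
  obtain ⟨N, hN, hNe⟩ : ∃ N : ℕ, 4 ≤ N ∧ N = 100 := ⟨100, by norm_num, rfl⟩
  obtain ⟨B, hB1, hB, hdec⟩ := ρ.exists_enorm_le_bw (2 + (N + N))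
  obtain ⟨k, hk⟩ : ∃ k : ℝ → ℝ≥0∞, ∀ y, k y = ‖ρ y‖ₑ := ⟨fun y => ‖ρ y‖ₑ, fun _ => rfl⟩
  simp_rw [← hk] at hdec
  have hkm : Measurable k := by
    rw [show k = fun y => ‖ρ y‖ₑ from funext hk]; exact ρ.continuous.measurable.enorm
  have hρ1 : ∫⁻ y, k y ≤ 4 * B := by
    calc _ ≤ ∫⁻ y, B * bw 2 y := lintegral_mono fun y =>
          (hdec y).trans (mul_le_mul' le_rfl (bw_anti (by omega) y))
      _ ≤ B * 4 := by
          rw [lintegral_const_mul' _ _ hB]; exact mul_le_mul' le_rfl lintegral_bw_two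
      _ = _ := mul_comm _ _
  have hB4 : 1 ≤ 4 * B := hB1.trans (le_mul_of_one_le_left' (by norm_num))
  refine ⟨(4 * B) ^ 2 * (16 * B * (2 ^ N) ^ 6), by finiteness,
    fun L hL a ha h hh hs q hq hq3 c d h1 h2 => ?_⟩
  have hL0 : 0 < L := by linarith
  set G : ℝ × ℝ → ℝ≥0∞ := fun x => ‖pext h x‖ₑ ^ q with hG
  have hGm : Measurable G := (pext_enorm_measurable hh).pow_const q
  have hp : (∫⁻ y, k y) ^ (q - 1) ≤ (4 * B) ^ 2 := by
    calc _ ≤ (4 * B) ^ (q - 1) := ENNReal.rpow_le_rpow hρ1 (by linarith)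
      _ ≤ (4 * B) ^ (2 : ℝ) := ENNReal.rpow_le_rpow_of_exponent_le hB4 (by linarith)
      _ = _ := by rw [← ENNReal.rpow_natCast]; norm_num
  have hQ : ∀ x : ℝ × ℝ, ∫⁻ y, k y * wt c L (x.1 - 2 * a * L ^ 2 * y, x.2 + L ^ 2 * y) ≤
      16 * B * (2 ^ N) ^ 6 * ENNReal.ofReal L⁻¹ *
        (bw 2 ((x.1 - c.1 + 2 * a * (x.2 - c.2)) / L) + ENNReal.ofReal (L ^ 2)⁻¹) *
        wt d (L ^ 2) x := fun x => by
    have := lintegral_weight_along_le hN hB hdec hL ha (u₁ := x.1 - d.1) (u₂ := x.2 - d.2)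
      (v₁ := x.1 - c.1) (v₂ := x.2 - c.2) (by rwa [sub_sub_sub_cancel_left])
      (by rwa [sub_sub_sub_cancel_left])
    simp only [wt, ← hNe]
    refine le_trans (le_of_eq ?_) this
    congr 1; ext y
    rw [sub_right_comm, add_sub_right_comm]
  have hwm := wt_measurable c L
  calc _ ≤ ∫⁻ x, ((4 * B) ^ 2 * ∫⁻ y, k y *
          G (x.1 + 2 * a * L ^ 2 * y, x.2 - L ^ 2 * y)) * wt c L x := by
        refine lintegral_mono fun x => mul_le_mul' ?_ le_rfl
        have := enorm_pext_rpow_le_along hρ hL hh hs hq x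
        simp_rw [← hk] at this
        exact this.trans (mul_le_mul' hp le_rfl)
    _ = (4 * B) ^ 2 * ∫⁻ x, ∫⁻ y, k y *
          G (x.1 + 2 * a * L ^ 2 * y, x.2 - L ^ 2 * y) * wt c L x := by
        rw [← lintegral_const_mul' _ _ (by finiteness)]
        congr 1; ext x
        rw [mul_assoc, lintegral_mul_const]
        fun_prop
    _ = (4 * B) ^ 2 * ∫⁻ y, ∫⁻ x : ℝ × ℝ, k y *
          G (x.1 + 2 * a * L ^ 2 * y, x.2 - L ^ 2 * y) * wt c L x := by
        rw [lintegral_lintegral_swap]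
        have : Measurable fun z : (ℝ × ℝ) × ℝ =>
          k z.2 * G (z.1.1 + 2 * a * L ^ 2 * z.2, z.1.2 - L ^ 2 * z.2) * wt c L z.1 := by
          fun_prop
        exact this.aemeasurable
    _ = (4 * B) ^ 2 * ∫⁻ y, ∫⁻ x : ℝ × ℝ, k y *
          G x * wt c L (x.1 - 2 * a * L ^ 2 * y, x.2 + L ^ 2 * y) := by
        congr 2; ext y
        rw [← lintegral_add_right_eq_self _ ((-(2 * a * L ^ 2 * y), L ^ 2 * y) : ℝ × ℝ)]
        refine lintegral_congr fun x => ?_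
        have e1 : x + (-(2 * a * L ^ 2 * y), L ^ 2 * y) =
            (x.1 - 2 * a * L ^ 2 * y, x.2 + L ^ 2 * y) := rfl
        rw [e1]
        simp only [sub_add_cancel, add_sub_cancel_right, Prod.mk.eta]
    _ = (4 * B) ^ 2 * ∫⁻ x : ℝ × ℝ, ∫⁻ y, k y *
          G x * wt c L (x.1 - 2 * a * L ^ 2 * y, x.2 + L ^ 2 * y) := by
        rw [lintegral_lintegral_swap]
        have : Measurable fun z : ℝ × (ℝ × ℝ) =>
          k z.1 * G z.2 * wt c L (z.2.1 - 2 * a * L ^ 2 * z.1, z.2.2 + L ^ 2 * z.1) := by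
          fun_prop
        exact this.aemeasurable
    _ ≤ (4 * B) ^ 2 * ∫⁻ x : ℝ × ℝ, 16 * B * (2 ^ N) ^ 6 * ENNReal.ofReal L⁻¹ *
          (G x * wt d (L ^ 2) x *
          (bw 2 ((x.1 - c.1 + 2 * a * (x.2 - c.2)) / L) + ENNReal.ofReal (L ^ 2)⁻¹)) := by
        refine mul_le_mul' le_rfl (lintegral_mono fun x => ?_)
        calc _ = G x * ∫⁻ y, k y * wt c L (x.1 - 2 * a * L ^ 2 * y, x.2 + L ^ 2 * y) := by
              rw [← lintegral_const_mul _ (by fun_prop)]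
              congr 1; ext y; ring
          _ ≤ _ := mul_le_mul' le_rfl (hQ x)
          _ = _ := by ring
    _ = _ := by
        rw [lintegral_const_mul' _ _ (by finiteness)]; ring

/-- The `q`-th power of the normalized norm of `pext h` with respect to `wt c R`. -/
def avgp (q : ℝ) (c : ℝ × ℝ) (R : ℝ) (h : ℝ → ℂ) : ℝ≥0∞ :=
  ENNReal.ofReal (R ^ 2)⁻¹ * ∫⁻ x, ‖pext h x‖ₑ ^ q * wt c R x

lemma lintegral_wt_le (c : ℝ × ℝ) {R : ℝ} (hR : 0 < R) :
    ∫⁻ x, wt c R x ≤ 16 * ENNReal.ofReal (R ^ 2) := by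
  unfold wt
  rw [Measure.volume_eq_prod, lintegral_prod_mul
    (f := fun x : ℝ => bw 100 ((x - c.1) / R)) (g := fun x : ℝ => bw 100 ((x - c.2) / R))
    (by fun_prop) (by fun_prop),
    lintegral_comp_sub_div (f := bw 100) (by fun_prop) hR,
    lintegral_comp_sub_div (f := bw 100) (by fun_prop) hR]
  have := lintegral_bw_le (N := 100) (by norm_num)
  calc _ ≤ ENNReal.ofReal R * 4 * (ENNReal.ofReal R * 4) := by gcongr
    _ = _ := by rw [pow_two, ENNReal.ofReal_mul hR.le]; ring

lemma avgp_two_rpow_le {h : ℝ → ℂ} (hh : Integrable h) {q : ℝ} (h2 : 2 ≤ q) (h6 : q ≤ 6)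
    (c : ℝ × ℝ) {R : ℝ} (hR : 0 < R) :
    avgp 2 c R h ^ (q / 2) ≤ 256 * avgp q c R h := by
  have hm := pext_enorm_measurable hh
  have hw := wt_measurable c R
  have h0 := lintegral_mul_rpow_le (μ := volume)
    (k := fun x => ENNReal.ofReal (R ^ 2)⁻¹ * wt c R x)
    (g := fun x => ‖pext h x‖ₑ ^ (2 : ℝ)) (p := q / 2) (by fun_prop)
    (hm.pow_const 2).aemeasurable (by linarith)
  have e1 : ∫⁻ x, ENNReal.ofReal (R ^ 2)⁻¹ * wt c R x * ‖pext h x‖ₑ ^ (2 : ℝ) = avgp 2 c R h := by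
    rw [avgp, ← lintegral_const_mul' _ _ (by finiteness)]
    congr 1; ext x; ring
  have e2 : ∫⁻ x, ENNReal.ofReal (R ^ 2)⁻¹ * wt c R x * (‖pext h x‖ₑ ^ (2 : ℝ)) ^ (q / 2) =
      avgp q c R h := by
    rw [avgp, ← lintegral_const_mul' _ _ (by finiteness)]
    congr 1; ext x
    rw [← ENNReal.rpow_mul, mul_div_cancel₀ _ (by norm_num)]; ring
  have e3 : ∫⁻ x, ENNReal.ofReal (R ^ 2)⁻¹ * wt c R x ≤ 16 := by
    rw [lintegral_const_mul' _ _ (by finiteness)]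
    refine (mul_le_mul' le_rfl (lintegral_wt_le c hR)).trans_eq ?_
    rw [mul_left_comm, ← ENNReal.ofReal_mul (by positivity), inv_mul_cancel₀ (by positivity),
      ENNReal.ofReal_one, mul_one]
  rw [e1, e2] at h0
  refine h0.trans (mul_le_mul' ?_ le_rfl)
  calc _ ≤ (16 : ℝ≥0∞) ^ (q / 2 - 1) := ENNReal.rpow_le_rpow e3 (by linarith)
    _ ≤ 16 ^ (2 : ℝ) := ENNReal.rpow_le_rpow_of_exponent_le (by norm_num) (by linarith)
    _ = _ := by norm_num

lemma sum_sum_lintegral_lintegral {α β : Type*} [MeasurableSpace α] [MeasurableSpace β]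
    {μ : Measure α} {ν : Measure β} [SFinite ν] {ι κ : Type*} (s : Finset ι) (t : Finset κ)
    {f : ι → κ → α → β → ℝ≥0∞} (hf : ∀ i j, Measurable fun z : α × β => f i j z.1 z.2) :
    ∑ i ∈ s, ∑ j ∈ t, ∫⁻ x, ∫⁻ y, f i j x y ∂ν ∂μ =
      ∫⁻ x, ∫⁻ y, ∑ i ∈ s, ∑ j ∈ t, f i j x y ∂ν ∂μ := by
  have h1 : ∀ i j, Measurable fun x => ∫⁻ y, f i j x y ∂ν := fun i j =>
    (hf i j).lintegral_prod_right'
  have h2 : ∀ i j x, Measurable fun y => f i j x y := fun i j x =>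
    (hf i j).comp measurable_prodMk_left
  simp_rw [fun x => lintegral_finsetSum (μ := ν) s
    (f := fun i y => ∑ j ∈ t, f i j x y) fun i _ => Finset.measurable_sum t fun j _ => h2 i j x,
    fun i x => lintegral_finsetSum (μ := ν) t (f := fun j y => f i j x y) fun j _ => h2 i j x]
  rw [lintegral_finsetSum _ fun i _ => Finset.measurable_sum t fun j _ => h1 i j]
  exact Finset.sum_congr rfl fun i _ => (lintegral_finsetSum _ fun j _ => h1 i j).symm

/-- Ball inflation for a single pair of transverse caps. -/
lemma exists_ball_inflation_pair : ∃ C : ℝ≥0∞, C ≠ ∞ ∧ ∀ L : ℕ, 0 < L → ∀ K : ℝ, 1 ≤ K →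
    ∀ a a' : ℝ, |a| ≤ 1 → |a'| ≤ 1 → 1 / K ≤ |a - a'| → |a - a'| ≤ 1 →
    ∀ h h' : ℝ → ℂ, Integrable h → Integrable h' →
    (∀ ξ, h ξ ≠ 0 → a ≤ ξ ∧ ξ ≤ a + 1 / L) → (∀ ξ, h' ξ ≠ 0 → a' ≤ ξ ∧ ξ ≤ a' + 1 / L) →
    ∀ q : ℝ, 2 ≤ q → q ≤ 3 → ∀ d : ℝ × ℝ,
    ∑ i ∈ Finset.range L, ∑ j ∈ Finset.range L,
      avgp 2 (subCtr d ((L : ℝ) ^ 2) L i j) L h ^ (q / 2) *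
        avgp 2 (subCtr d ((L : ℝ) ^ 2) L i j) L h' ^ (q / 2) ≤
      C * ENNReal.ofReal K * ENNReal.ofReal ((L : ℝ) ^ 2) *
        (avgp q d ((L : ℝ) ^ 2) h * avgp q d ((L : ℝ) ^ 2) h') := by
  obtain ⟨C, hC, H⟩ := exists_lintegral_rpow_wt_le
  refine ⟨65536 * C ^ 2 * 20000, by finiteness, ?_⟩
  intro L hL K hK a a' ha ha' h1 h2 h h' hh hh' hs hs' q hq2 hq3 d
  have hL0 : (0 : ℝ) < L := by exact_mod_cast hL
  have hL1 : (1 : ℝ) ≤ L := by exact_mod_cast hL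
  have hcen : ∀ i, i < L → ∀ x : ℝ, |x - (x - (L : ℝ) ^ 2 / 2 + ((i : ℝ) + 1 / 2) * L)| ≤ (L : ℝ) ^ 2 := by
    intro i hi x
    have hi' : (i : ℝ) + 1 ≤ L := by exact_mod_cast hi
    have hi0 : (0 : ℝ) ≤ i := by positivity
    rw [abs_le]; constructor <;> nlinarith
  have key : ∀ (b : ℝ) (f : ℝ → ℂ), |b| ≤ 1 → Integrable f →
      (∀ ξ, f ξ ≠ 0 → b ≤ ξ ∧ ξ ≤ b + 1 / L) → ∀ i ∈ Finset.range L, ∀ j ∈ Finset.range L,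
      avgp 2 (subCtr d ((L : ℝ) ^ 2) L i j) L f ^ (q / 2) ≤
        256 * (ENNReal.ofReal ((L : ℝ) ^ 2)⁻¹ * (C * ENNReal.ofReal (L : ℝ)⁻¹)) *
        ∫⁻ x, ‖pext f x‖ₑ ^ q * wt d ((L : ℝ) ^ 2) x *
          (bw 2 ((x.1 - (d.1 - (L : ℝ) ^ 2 / 2 + (1 / 2) * L) + 2 * b *
            (x.2 - (d.2 - (L : ℝ) ^ 2 / 2 + (1 / 2) * L))) / L - i - 2 * b * j) +
            ENNReal.ofReal ((L : ℝ) ^ 2)⁻¹) := by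
    intro b f hb hf hsf i hi j hj
    refine (avgp_two_rpow_le hf hq2 (by linarith) _ hL0).trans ?_
    rw [mul_assoc, avgp, mul_assoc (ENNReal.ofReal _)]
    refine mul_le_mul' le_rfl (mul_le_mul' le_rfl ?_)
    refine (H L hL1 b hb f hf hsf q (by linarith) hq3 _ d
      (hcen i (Finset.mem_range.1 hi) d.1) (hcen j (Finset.mem_range.1 hj) d.2)).trans_eq ?_
    congr 2; ext x; congr 3
    simp only [subCtr]; field_simp; ring
  obtain ⟨A, hA⟩ : ∃ A : ℝ≥0∞, A =
    256 * (ENNReal.ofReal ((L : ℝ) ^ 2)⁻¹ * (C * ENNReal.ofReal (L : ℝ)⁻¹)) := ⟨_, rfl⟩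
  obtain ⟨τ, hτ⟩ : ∃ τ : ℝ → ℝ × ℝ → ℝ, ∀ b x, τ b x =
    (x.1 - (d.1 - (L : ℝ) ^ 2 / 2 + (1 / 2) * L) + 2 * b *
            (x.2 - (d.2 - (L : ℝ) ^ 2 / 2 + (1 / 2) * L))) / L := ⟨_, fun _ _ => rfl⟩
  have hτm : ∀ b, Measurable (τ b) := fun b => by
    rw [show τ b = _ from funext (hτ b)]; fun_prop
  obtain ⟨G, hG⟩ : ∃ G : (ℝ → ℂ) → ℝ × ℝ → ℝ≥0∞, ∀ f x, G f x =
    ‖pext f x‖ₑ ^ q * wt d ((L : ℝ) ^ 2) x := ⟨_, fun _ _ => rfl⟩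
  have hGm : ∀ f, Integrable f → Measurable (G f) := fun f hf => by
    have := pext_enorm_measurable hf
    rw [show G f = _ from funext (hG f)]; fun_prop
  simp_rw [← hτ, ← hA, ← hG] at key
  have hg := hGm h hh
  have hg' := hGm h' hh'
  have ht := hτm a
  have ht' := hτm a'
  obtain ⟨ε, hε⟩ : ∃ ε : ℝ≥0∞, ε = ENNReal.ofReal ((L : ℝ) ^ 2)⁻¹ := ⟨_, rfl⟩
  rw [← hε] at key
  calc _ ≤ ∑ i ∈ Finset.range L, ∑ j ∈ Finset.range L,
        A ^ 2 * ∫⁻ x, ∫⁻ x', G h x * G h' x' * ((bw 2 (τ a x - i - 2 * a * j) + ε) *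
          (bw 2 (τ a' x' - i - 2 * a' * j) + ε)) := by
        refine Finset.sum_le_sum fun i hi => Finset.sum_le_sum fun j hj => ?_
        refine (mul_le_mul' (key a h ha hh hs i hi j hj)
          (key a' h' ha' hh' hs' i hi j hj)).trans_eq ?_
        rw [mul_mul_mul_comm, ← pow_two, ← lintegral_mul_const _ (by fun_prop)]
        congr 2; ext x
        rw [← lintegral_const_mul _ (by fun_prop)]
        congr 1; ext x'; ring
    _ = A ^ 2 * ∫⁻ x, ∫⁻ x', G h x * G h' x' * ∑ i ∈ Finset.range L, ∑ j ∈ Finset.range L,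
          ((bw 2 (τ a x - i - 2 * a * j) + ε) *
          (bw 2 (τ a' x' - i - 2 * a' * j) + ε)) := by
        have hm : ∀ i j : ℕ, Measurable fun z : (ℝ × ℝ) × (ℝ × ℝ) => G h z.1 * G h' z.2 *
          ((bw 2 (τ a z.1 - i - 2 * a * j) + ε) * (bw 2 (τ a' z.2 - i - 2 * a' * j) + ε)) := by
          intro i j; fun_prop
        simp_rw [← Finset.mul_sum]
        congr 1
        simp_rw [Finset.mul_sum]
        exact sum_sum_lintegral_lintegral _ _ hm
    _ ≤ A ^ 2 * ∫⁻ x, ∫⁻ x', 20000 * ENNReal.ofReal K * (G h x * G h' x') := by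
        refine mul_le_mul' le_rfl (lintegral_mono fun x => lintegral_mono fun x' => ?_)
        rw [mul_comm (20000 * _)]
        refine mul_le_mul' le_rfl ?_
        rw [hε]
        exact sum_sum_bw_le hL hK h1 h2 _ _
    _ = A ^ 2 * (20000 * ENNReal.ofReal K * ((∫⁻ x, G h x) * ∫⁻ x, G h' x)) := by
        congr 1
        rw [← lintegral_mul_const _ hg, ← lintegral_const_mul' _ _ (by finiteness)]
        refine lintegral_congr fun x => ?_
        rw [lintegral_const_mul' _ _ (by finiteness), lintegral_const_mul _ hg']
    _ = _ := by
        have e : ∀ f, ∫⁻ x, G f x = ENNReal.ofReal ((L : ℝ) ^ 2) ^ 2 * avgp q d ((L : ℝ) ^ 2) f := by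
          intro f
          rw [avgp, ← mul_assoc, ← ENNReal.ofReal_pow (by positivity),
            ← ENNReal.ofReal_mul (by positivity), mul_inv_cancel₀ (by positivity),
            ENNReal.ofReal_one, one_mul]
          exact lintegral_congr fun x => hG f x
        rw [e, e, hA]
        have e2 : ENNReal.ofReal ((L : ℝ) ^ 2) = ENNReal.ofReal L ^ 2 := ENNReal.ofReal_pow hL0.le 2
        have e3 : ENNReal.ofReal ((L : ℝ) ^ 2)⁻¹ = ENNReal.ofReal (L : ℝ)⁻¹ ^ 2 := by
          rw [← inv_pow, ENNReal.ofReal_pow (by positivity)]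
        have e4 : ENNReal.ofReal (L : ℝ)⁻¹ * ENNReal.ofReal L = 1 := by
          rw [← ENNReal.ofReal_mul (by positivity), inv_mul_cancel₀ hL0.ne', ENNReal.ofReal_one]
        rw [e2, e3]
        generalize ENNReal.ofReal (L : ℝ)⁻¹ = u at e4 ⊢
        generalize ENNReal.ofReal (L : ℝ) = v at e4 ⊢
        generalize avgp q d _ h = X
        generalize avgp q d _ h' = Y
        calc _ = (u * v) ^ 6 * (65536 * C ^ 2 * 20000 * ENNReal.ofReal K * v ^ 2 * (X * Y)) := by ring
          _ = _ := by rw [e4]; ring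

/-- The `L^p` norm of a frequency localized solution grows slowly in time. -/
lemma exists_lintegral_pext_time_le : ∃ C : ℝ≥0∞, C ≠ ∞ ∧ ∀ m : ℝ, 0 < m → ∀ ζ₀ : ℝ,
    ∀ u : ℝ → ℂ, Integrable u → (∀ ζ, u ζ ≠ 0 → m * |ζ - ζ₀| ≤ 10) → ∀ p : ℝ, 1 ≤ p → p ≤ 6 →
    ∀ τ t : ℝ, ∫⁻ y, ‖pext u (y, t)‖ₑ ^ p ≤
      C * ENNReal.ofReal ((1 + |t - τ| / m ^ 2) ^ 6) * ∫⁻ y, ‖pext u (y, τ)‖ₑ ^ p := by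
  obtain ⟨C, hC1, H⟩ := exists_chirp_kernel
  refine ⟨ENNReal.ofReal (C ^ 6), by finiteness, fun m hm ζ₀ u hu hs p hp hp6 τ t => ?_⟩
  obtain ⟨κ, hκ, hκ1, hκ2⟩ := H ((t - τ) / m ^ 2)
  have hk : ∫⁻ y, ‖κ y‖ₑ ≤ ENNReal.ofReal (C * (1 + |t - τ| / m ^ 2)) := by
    rw [← ofReal_integral_norm_eq_lintegral_enorm hκ]
    refine ENNReal.ofReal_le_ofReal ?_
    rwa [abs_div, abs_of_pos (show 0 < m ^ 2 by positivity)] at hκ1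
  have hS : 1 ≤ C * (1 + |t - τ| / m ^ 2) := by
    have : 0 ≤ |t - τ| / m ^ 2 := by positivity
    nlinarith
  have hpt : ∀ y, ‖pext u (y, t)‖ₑ ^ p ≤ (∫⁻ v, ‖κ v‖ₑ) ^ (p - 1) *
      ∫⁻ v, ‖κ v‖ₑ * ‖pext u (y + (2 * ζ₀ * (t - τ) - m * v), τ)‖ₑ ^ p := by
    intro y
    have h0 := enorm_integral_multiplier_rpow_le (μ := volume)
      (H := fun ζ => u ζ * ec (ζ * (y + 2 * ζ₀ * (t - τ)) + ζ ^ 2 * τ - ζ₀ ^ 2 * (t - τ)))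
      (m := fun ζ => ec ((t - τ) / m ^ 2 * (m * (ζ - ζ₀)) ^ 2)) (ω := fun ζ => m * (ζ - ζ₀))
      (integrable_mul_ec hu (by fun_prop)) (by fun_prop) hκ
      (fun ζ hζ => hκ2 _ (by
        rw [abs_mul, abs_of_pos hm]; exact hs ζ (left_ne_zero_of_mul hζ))) hp
    have e1 : pext u (y, t) = ∫ ζ, u ζ * ec (ζ * (y + 2 * ζ₀ * (t - τ)) + ζ ^ 2 * τ -
        ζ₀ ^ 2 * (t - τ)) * ec ((t - τ) / m ^ 2 * (m * (ζ - ζ₀)) ^ 2) := by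
      unfold pext
      congr 1; ext ζ
      rw [mul_assoc, ← ec_add]
      congr 2; simp only; field_simp; ring
    have e2 : ∀ v, ‖∫ ζ, u ζ * ec (ζ * (y + 2 * ζ₀ * (t - τ)) + ζ ^ 2 * τ -
        ζ₀ ^ 2 * (t - τ)) * ec (-(v * (m * (ζ - ζ₀))))‖ₑ =
        ‖pext u (y + (2 * ζ₀ * (t - τ) - m * v), τ)‖ₑ := by
      intro v
      have : ∀ ζ, u ζ * ec (ζ * (y + 2 * ζ₀ * (t - τ)) + ζ ^ 2 * τ - ζ₀ ^ 2 * (t - τ)) *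
          ec (-(v * (m * (ζ - ζ₀)))) = ec (v * m * ζ₀ - ζ₀ ^ 2 * (t - τ)) *
          (u ζ * ec (ζ * (y + (2 * ζ₀ * (t - τ) - m * v)) + ζ ^ 2 * τ)) := by
        intro ζ
        rw [mul_left_comm (ec _) (u ζ), mul_assoc (u ζ), ← ec_add, ← ec_add]
        congr 2; ring
      simp_rw [this]
      rw [integral_const_mul, enorm_mul, enorm_ec, one_mul, pext]
    simp_rw [e2] at h0
    rwa [← e1] at h0
  have hm1 := pext_enorm_measurable hu
  have hkm : AEMeasurable (fun v => ‖κ v‖ₑ) := hκ.aestronglyMeasurable.enorm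
  calc _ ≤ ∫⁻ y, (∫⁻ v, ‖κ v‖ₑ) ^ (p - 1) *
      ∫⁻ v, ‖κ v‖ₑ * ‖pext u (y + (2 * ζ₀ * (t - τ) - m * v), τ)‖ₑ ^ p := lintegral_mono hpt
    _ = (∫⁻ v, ‖κ v‖ₑ) ^ (p - 1) * ∫⁻ v, ∫⁻ y, ‖κ v‖ₑ *
        ‖pext u (y + (2 * ζ₀ * (t - τ) - m * v), τ)‖ₑ ^ p := by
      rw [lintegral_const_mul' _ _
        (ENNReal.rpow_ne_top_of_nonneg (by linarith) (hk.trans_lt ENNReal.ofReal_lt_top).ne)]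
      rw [lintegral_lintegral_swap]
      have h1 : Measurable fun z : ℝ × ℝ =>
          ‖pext u (z.1 + (2 * ζ₀ * (t - τ) - m * z.2), τ)‖ₑ ^ p :=
        (hm1.comp (by fun_prop)).pow_const p
      exact (hkm.comp_quasiMeasurePreserving Measure.quasiMeasurePreserving_snd).mul
        h1.aemeasurable
    _ = (∫⁻ v, ‖κ v‖ₑ) ^ (p - 1) * ((∫⁻ v, ‖κ v‖ₑ) * ∫⁻ y, ‖pext u (y, τ)‖ₑ ^ p) := by
      rw [← lintegral_mul_const'' _ hkm]
      congr 1
      refine lintegral_congr fun v => ?_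
      have h1 : Measurable fun y : ℝ => ‖pext u (y + (2 * ζ₀ * (t - τ) - m * v), τ)‖ₑ ^ p :=
        (hm1.comp (by fun_prop)).pow_const p
      rw [lintegral_const_mul _ h1]
      congr 1
      exact lintegral_add_right_eq_self (fun y => ‖pext u (y, τ)‖ₑ ^ p) _
    _ ≤ _ := by
      rw [← mul_assoc]
      refine mul_le_mul' ?_ le_rfl
      rw [← ENNReal.ofReal_mul (by positivity), ← mul_pow]
      calc _ ≤ ENNReal.ofReal (C * (1 + |t - τ| / m ^ 2)) ^ (p - 1) *
            ENNReal.ofReal (C * (1 + |t - τ| / m ^ 2)) ^ (1 : ℝ) := by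
            refine mul_le_mul' (ENNReal.rpow_le_rpow hk (by linarith)) ?_
            rwa [ENNReal.rpow_one]
        _ = ENNReal.ofReal (C * (1 + |t - τ| / m ^ 2)) ^ p := by
            rw [← ENNReal.rpow_add_of_nonneg _ _ (by linarith) (by norm_num)]; congr 1; ring
        _ ≤ ENNReal.ofReal (C * (1 + |t - τ| / m ^ 2)) ^ (6 : ℝ) := by
            refine ENNReal.rpow_le_rpow_of_exponent_le ?_ hp6
            rwa [← ENNReal.ofReal_one, ENNReal.ofReal_le_ofReal_iff (by linarith)]
        _ = _ := by
            rw [ENNReal.ofReal_pow (by linarith), ← ENNReal.rpow_natCast]; norm_num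

/-- The density whose extension at time `τ` is the extension of `h`, cut off by the window
`θ ((x - z) / R)`, where `χ` is the Fourier transform of `θ`. -/
def loc (χ : 𝓢(ℝ, ℂ)) (R z τ : ℝ) (h : ℝ → ℂ) (ζ : ℝ) : ℂ :=
  ∫ ξ, R * χ (R * (ζ - ξ)) * ec (-((ζ - ξ) * z)) * h ξ * ec ((ξ ^ 2 - ζ ^ 2) * τ)

lemma loc_integrand_integrable (χ : 𝓢(ℝ, ℂ)) {R : ℝ} (hR : 0 < R) (z : ℝ) {h : ℝ → ℂ}
    (hh : Integrable h) : Integrable (fun v : ℝ × ℝ =>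
      R * χ (R * (v.1 - v.2)) * ec (-((v.1 - v.2) * z)) * h v.2) := by
  have h1 : Integrable fun η : ℝ => R * χ (R * η) * ec (-(η * z)) :=
    integrable_mul_ec (((χ.integrable).comp_mul_left' hR.ne').const_mul _)
      (φ := fun η : ℝ => -(η * z)) (by fun_prop)
  have h2 := (h1.mul_prod hh)
  have := (measurePreserving_sub_prod (μ := (volume : Measure ℝ)) (ν := volume)).integrable_comp
    (g := fun v : ℝ × ℝ => (R * χ (R * v.1) * ec (-(v.1 * z))) * h v.2) h2.aestronglyMeasurable
  exact this.2 h2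

lemma loc_integrable (χ : 𝓢(ℝ, ℂ)) {R : ℝ} (hR : 0 < R) (z τ : ℝ) {h : ℝ → ℂ}
    (hh : Integrable h) : Integrable (loc χ R z τ h) :=
  (integrable_mul_ec (loc_integrand_integrable χ hR z hh)
    (φ := fun v : ℝ × ℝ => (v.2 ^ 2 - v.1 ^ 2) * τ) (by fun_prop)).integral_prod_left

lemma pext_loc (χ : 𝓢(ℝ, ℂ)) {R : ℝ} (hR : 0 < R) (z τ : ℝ) {h : ℝ → ℂ} (hh : Integrable h)
    (x : ℝ × ℝ) : pext (loc χ R z τ h) x =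
      ∫ v : ℝ × ℝ, R * χ (R * (v.1 - v.2)) * ec (-((v.1 - v.2) * z)) * h v.2 *
        ec ((v.2 ^ 2 - v.1 ^ 2) * τ + (v.1 * x.1 + v.1 ^ 2 * x.2)) := by
  rw [Measure.volume_eq_prod, integral_prod]
  · unfold pext loc
    congr 1; ext ζ
    rw [← integral_mul_const]
    congr 1; ext ξ
    rw [mul_assoc _ (ec _) (ec _), ← ec_add]
  · exact integrable_mul_ec (loc_integrand_integrable χ hR z hh)
      (φ := fun v : ℝ × ℝ => (v.2 ^ 2 - v.1 ^ 2) * τ + (v.1 * x.1 + v.1 ^ 2 * x.2)) (by fun_prop)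

lemma pext_loc_self {χ θ : 𝓢(ℝ, ℂ)} (hθ' : ∀ u, θ u = ∫ w, χ w * ec (w * u)) {R : ℝ}
    (hR : 0 < R) (z τ : ℝ) {h : ℝ → ℂ} (hh : Integrable h) (y : ℝ) :
    pext (loc χ R z τ h) (y, τ) = θ ((y - z) / R) * pext h (y, τ) := by
  rw [pext_loc χ hR z τ hh, Measure.volume_eq_prod, integral_prod_symm]
  · unfold pext
    rw [← integral_const_mul]
    congr 1; ext ξ
    have h1 : θ ((y - z) / R) = ∫ ζ, R * χ (R * (ζ - ξ)) * ec ((ζ - ξ) * (y - z)) := by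
      rw [hθ', integral_sub_right_eq_self (μ := volume)
        (fun η : ℝ => R * χ (R * η) * ec (η * (y - z))) ξ]
      have := Measure.integral_comp_mul_left (fun w => χ w * ec (w * ((y - z) / R))) R
      rw [abs_of_pos (inv_pos.2 hR), eq_inv_smul_iff₀ hR.ne'] at this
      rw [← this, ← integral_smul]
      congr 1; ext η
      rw [Complex.real_smul, mul_assoc (R : ℂ)]
      congr 3; field_simp
    rw [h1, ← integral_mul_const]
    congr 1; ext ζ
    have h2 : ec ((ζ - ξ) * (y - z)) * ec (ξ * y + ξ ^ 2 * τ) =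
        ec (-((ζ - ξ) * z)) * ec ((ξ ^ 2 - ζ ^ 2) * τ + (ζ * y + ζ ^ 2 * τ)) := by
      rw [← ec_add, ← ec_add]; congr 1; ring
    linear_combination (-(R * χ (R * (ζ - ξ)) * h ξ)) * h2
  · exact integrable_mul_ec (loc_integrand_integrable χ hR z hh)
      (φ := fun v : ℝ × ℝ => (v.2 ^ 2 - v.1 ^ 2) * τ + (v.1 * y + v.1 ^ 2 * τ)) (by fun_prop)

lemma loc_eq_zero {χ : 𝓢(ℝ, ℂ)} (hχ : ∀ w, (1 / 100 : ℝ) < |w| → χ w = 0) {R : ℝ} (hR : 0 < R)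
    (z τ : ℝ) {h : ℝ → ℂ} {ζ : ℝ} (hs : ∀ ξ, h ξ ≠ 0 → 1 / (100 * R) < |ζ - ξ|) :
    loc χ R z τ h ζ = 0 := by
  unfold loc
  refine integral_eq_zero_of_ae (.of_forall fun ξ => ?_)
  by_cases h0 : h ξ = 0
  · simp [h0]
  · have := hs ξ h0
    rw [div_lt_iff₀ (by positivity)] at this
    show R * χ (R * (ζ - ξ)) * ec (-((ζ - ξ) * z)) * h ξ * ec ((ξ ^ 2 - ζ ^ 2) * τ) = 0
    rw [hχ (R * (ζ - ξ)) (by rw [abs_mul, abs_of_pos hR]; linarith)]; simp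

lemma enorm_loc_le {χ θ : 𝓢(ℝ, ℂ)} (hθ : ∀ w, ∫ y, θ y * ec (-(y * w)) = χ w) {R : ℝ}
    (hR : 0 < R) (z τ : ℝ) {h : ℝ → ℂ} (hh : Integrable h) (ζ : ℝ) :
    ‖loc χ R z τ h ζ‖ₑ ≤ ∫⁻ y, ‖θ ((y - z) / R)‖ₑ * ‖pext h (y, τ)‖ₑ := by
  have hθi : Integrable fun y => θ ((y - z) / R) :=
    ((θ.integrable.comp_div hR.ne').comp_sub_right z)
  have h1 : ∀ ξ, R * χ (R * (ζ - ξ)) * ec (-((ζ - ξ) * z)) =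
      ∫ y, θ ((y - z) / R) * ec (-(y * (ζ - ξ))) := by
    intro ξ
    have hz := integral_sub_right_eq_self (μ := volume)
      (fun y : ℝ => θ (y / R) * ec (-((y + z) * (ζ - ξ)))) z
    simp only [sub_add_cancel] at hz
    rw [hz, ← hθ]
    have := Measure.integral_comp_div (fun w => θ w * ec (-((R * w + z) * (ζ - ξ)))) R
    rw [abs_of_pos hR, Complex.real_smul] at this
    have e : ∀ y, θ (y / R) * ec (-((y + z) * (ζ - ξ))) =
      θ (y / R) * ec (-((R * (y / R) + z) * (ζ - ξ))) := fun y => by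
        rw [mul_div_cancel₀ _ hR.ne']
    simp_rw [e]
    rw [this, mul_assoc, ← integral_mul_const]
    congr 2; ext y
    rw [mul_assoc, ← ec_add]; ring_nf
  have e : loc χ R z τ h ζ = ec (-(ζ ^ 2 * τ)) *
      ∫ y, θ ((y - z) / R) * ec (-(y * ζ)) * pext h (y, τ) := by
    unfold loc
    have h2 : Integrable fun v : ℝ × ℝ => θ ((v.2 - z) / R) * h v.1 *
        ec (-(v.2 * (ζ - v.1)) + (v.1 ^ 2 - ζ ^ 2) * τ) := by
      refine integrable_mul_ec ?_ (by fun_prop)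
      have := hh.mul_prod hθi
      simp_rw [mul_comm (h _)] at this
      exact this
    have h3 : ∀ ξ, R * χ (R * (ζ - ξ)) * ec (-((ζ - ξ) * z)) * h ξ * ec ((ξ ^ 2 - ζ ^ 2) * τ) =
        ∫ y, θ ((y - z) / R) * h ξ * ec (-(y * (ζ - ξ)) + (ξ ^ 2 - ζ ^ 2) * τ) := by
      intro ξ
      rw [h1, mul_assoc, ← integral_mul_const]
      congr 1; ext y
      rw [ec_add]; ring
    simp_rw [h3]
    rw [integral_integral_swap h2, ← integral_const_mul]
    congr 1; ext y
    unfold pext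
    rw [← integral_const_mul, ← integral_const_mul]
    congr 1; ext ξ
    rw [show -(y * (ζ - ξ)) + (ξ ^ 2 - ζ ^ 2) * τ =
      -(ζ ^ 2 * τ) + -(y * ζ) + (ξ * y + ξ ^ 2 * τ) by ring, ec_add, ec_add]
    ring
  rw [e, enorm_mul, enorm_ec, one_mul]
  refine (enorm_integral_le_lintegral_enorm _).trans_eq (lintegral_congr fun y => ?_)
  rw [enorm_mul, enorm_mul, enorm_ec, mul_one]

lemma enorm_window_mul_pext_rpow_le {χ θ ρ : 𝓢(ℝ, ℂ)}
    (hρ : ∀ w, |w| ≤ 10 → ∫ y, ρ y * ec (-(y * w)) = 1)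
    (hχ : ∀ w, (1 / 100 : ℝ) < |w| → χ w = 0)
    (hθ' : ∀ u, θ u = ∫ w, χ w * ec (w * u)) {R : ℝ}
    (hR : 1 ≤ R) (z : ℝ) {h : ℝ → ℂ} (hh : Integrable h) (hs : ∀ ξ, h ξ ≠ 0 → 0 ≤ ξ ∧ ξ ≤ 1)
    {p : ℝ} (hp : 1 ≤ p) (x : ℝ × ℝ) :
    (‖θ ((x.1 - z) / R)‖ₑ * ‖pext h x‖ₑ) ^ p ≤ (∫⁻ s, ‖ρ s‖ₑ) ^ (p - 1) *
      ∫⁻ s, ‖ρ s‖ₑ * ‖pext (loc χ R z (x.2 - R * s) h) x‖ₑ ^ p := by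
  have hR0 : 0 < R := by linarith
  have h0 := enorm_integral_multiplier_rpow_le (μ := (volume : Measure (ℝ × ℝ)))
    (H := fun v : ℝ × ℝ => R * χ (R * (v.1 - v.2)) * ec (-((v.1 - v.2) * z)) * h v.2 *
      ec (v.1 * x.1 + v.2 ^ 2 * x.2)) (m := fun _ => 1)
    (ω := fun v : ℝ × ℝ => R * (v.2 ^ 2 - v.1 ^ 2)) (ρ := ρ)
    (integrable_mul_ec (loc_integrand_integrable χ hR0 z hh) (by fun_prop)) (by fun_prop)
    ρ.integrable (fun v hv => hρ _ (by
      have h1 : h v.2 ≠ 0 := fun h => hv (by simp [h])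
      have h2 : |R * (v.1 - v.2)| ≤ 1 / 100 := by
        by_contra hc
        exact hv (by rw [hχ _ (not_le.1 hc)]; simp)
      have h3 := hs _ h1
      have h4 : |v.2 + v.1| ≤ 3 := by
        have : |v.1 - v.2| ≤ 1 / 100 := by
          rw [abs_mul, abs_of_pos hR0] at h2
          have := abs_nonneg (v.1 - v.2)
          nlinarith
        rw [abs_le] at this ⊢
        constructor <;> linarith
      rw [show R * (v.2 ^ 2 - v.1 ^ 2) = -(R * (v.1 - v.2)) * (v.2 + v.1) by ring, abs_mul, abs_neg]
      nlinarith [abs_nonneg (R * (v.1 - v.2)), abs_nonneg (v.2 + v.1)])) hp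
  have e1 : ∫ v : ℝ × ℝ, R * χ (R * (v.1 - v.2)) * ec (-((v.1 - v.2) * z)) * h v.2 *
      ec (v.1 * x.1 + v.2 ^ 2 * x.2) * 1 = θ ((x.1 - z) / R) * pext h x := by
    rw [← Prod.mk.eta (p := x), ← pext_loc_self hθ' hR0 z x.2 hh, pext_loc χ hR0 z _ hh]
    congr 1; ext v
    rw [mul_one]
    congr 2; simp only; ring
  have e2 : ∀ s : ℝ, ∫ v : ℝ × ℝ, R * χ (R * (v.1 - v.2)) * ec (-((v.1 - v.2) * z)) * h v.2 *
      ec (v.1 * x.1 + v.2 ^ 2 * x.2) * ec (-(s * (R * (v.2 ^ 2 - v.1 ^ 2)))) =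
      pext (loc χ R z (x.2 - R * s) h) x := by
    intro s
    rw [pext_loc χ hR0 z _ hh]
    congr 1; ext v
    rw [mul_assoc _ (ec _) (ec _), ← ec_add]
    congr 2; ring
  simp_rw [e2] at h0
  rwa [e1, enorm_mul] at h0

lemma loc_sum (χ : 𝓢(ℝ, ℂ)) {R : ℝ} (hR : 0 < R) (z τ : ℝ) {ι : Type*} (s : Finset ι)
    {h : ι → ℝ → ℂ} (hh : ∀ i, Integrable (h i)) (ζ : ℝ) :
    loc χ R z τ (fun ξ => ∑ i ∈ s, h i ξ) ζ = ∑ i ∈ s, loc χ R z τ (h i) ζ := by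
  unfold loc
  rw [← integral_finsetSum]
  · congr 1; ext ξ
    rw [Finset.mul_sum, Finset.sum_mul]
  · intro i _
    obtain ⟨B, -, hB⟩ := χ.exists_norm_le_inv_pow 0
    refine integrable_mul_ec ?_ (φ := fun ξ => (ξ ^ 2 - ζ ^ 2) * τ) (by fun_prop)
    refine (hh i).bdd_mul (c := R * B) ?_ (.of_forall fun ξ => ?_)
    · exact (by fun_prop : Continuous fun ξ => R * χ (R * (ζ - ξ)) * ec (-((ζ - ξ) * z))).aestronglyMeasurable
    · rw [norm_mul, norm_mul, norm_ec, mul_one, Complex.norm_real, Real.norm_of_nonneg hR.le]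
      have := hB (R * (ζ - ξ))
      simp only [pow_zero, inv_one, mul_one] at this
      gcongr

lemma ofReal_wtB (c : ℝ × ℝ) {R : ℝ} (hR : 0 < R) (x : ℝ × ℝ) :
    ENNReal.ofReal (wtB c R x) = wt c R x := by
  have e : ∀ t : ℝ, (1 + |t| / R) ^ (-100 : ℤ) = ((1 + |t / R|) ^ 100)⁻¹ := by
    intro t
    rw [abs_div, abs_of_pos hR, zpow_neg]; rfl
  rw [wtB, wt, ENNReal.ofReal_mul (by positivity), e, e]; rfl

lemma wB_eq (c : ℝ × ℝ) (R : ℝ) (x : ℝ × ℝ) :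
    wB c R x = ((1 + Real.sqrt ((x.1 - c.1) ^ 2 + (x.2 - c.2) ^ 2) / R) ^ 100)⁻¹ := by
  rw [wB, zpow_neg]; rfl

lemma wB_nonneg (c : ℝ × ℝ) {R : ℝ} (hR : 0 < R) (x : ℝ × ℝ) : 0 ≤ wB c R x := by
  rw [wB_eq]; positivity

lemma ofReal_wB_le (c : ℝ × ℝ) {R : ℝ} (hR : 0 < R) (x : ℝ × ℝ) :
    ENNReal.ofReal (wB c R x) ≤ bw 50 ((x.1 - c.1) / R) * bw 50 ((x.2 - c.2) / R) := by
  rw [wB_eq, bw, bw, ← ENNReal.ofReal_mul (by positivity), ← mul_inv, ← mul_pow]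
  refine ENNReal.ofReal_le_ofReal (inv_anti₀ (by positivity) ?_)
  rw [abs_div, abs_div, abs_of_pos hR, show (100 : ℕ) = 2 * 50 by rfl, pow_mul]
  refine pow_le_pow_left₀ (by positivity) ?_ 50
  have h1 := Real.abs_le_sqrt (show (x.1 - c.1) ^ 2 ≤ (x.1 - c.1) ^ 2 + (x.2 - c.2) ^ 2 by
    nlinarith [sq_nonneg (x.2 - c.2)])
  have h2 := Real.abs_le_sqrt (show (x.2 - c.2) ^ 2 ≤ (x.1 - c.1) ^ 2 + (x.2 - c.2) ^ 2 by
    nlinarith [sq_nonneg (x.1 - c.1)])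
  rw [pow_two]
  gcongr

lemma wt_le_ofReal_wB (c : ℝ × ℝ) {R : ℝ} (hR : 0 < R) (x : ℝ × ℝ) :
    wt c R x ≤ ENNReal.ofReal (wB c R x) := by
  rw [wB_eq, wt, bw, bw, ← ENNReal.ofReal_mul (by positivity), ← mul_inv, ← mul_pow]
  refine ENNReal.ofReal_le_ofReal (inv_anti₀ (by positivity) ?_)
  refine pow_le_pow_left₀ (by positivity) ?_ 100
  have h1 : Real.sqrt ((x.1 - c.1) ^ 2 + (x.2 - c.2) ^ 2) ≤ |x.1 - c.1| + |x.2 - c.2| := by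
    rw [Real.sqrt_le_left (by positivity)]
    nlinarith [sq_abs (x.1 - c.1), sq_abs (x.2 - c.2),
      mul_nonneg (abs_nonneg (x.1 - c.1)) (abs_nonneg (x.2 - c.2))]
  have h2 := div_le_div_of_nonneg_right h1 hR.le
  rw [abs_div, abs_div, abs_of_pos hR]
  rw [add_div] at h2
  have : 0 ≤ |x.1 - c.1| / R * (|x.2 - c.2| / R) := by positivity
  nlinarith

@[fun_prop]
lemma measurable_wB (c : ℝ × ℝ) (R : ℝ) : Measurable (wB c R) := by
  rw [show wB c R = _ from funext (wB_eq c R)]; fun_prop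

lemma lintegral_bw_mul_bw_le {N : ℕ} (hN : 2 ≤ N) (c : ℝ × ℝ) {R : ℝ} (hR : 0 < R) :
    ∫⁻ x : ℝ × ℝ, bw N ((x.1 - c.1) / R) * bw N ((x.2 - c.2) / R) ≤
      16 * ENNReal.ofReal R ^ 2 := by
  rw [Measure.volume_eq_prod, lintegral_prod_mul
    (f := fun x : ℝ => bw N ((x - c.1) / R)) (g := fun x : ℝ => bw N ((x - c.2) / R))
    (by fun_prop) (by fun_prop),
    lintegral_comp_sub_div (f := bw N) (by fun_prop) hR,
    lintegral_comp_sub_div (f := bw N) (by fun_prop) hR]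
  have := lintegral_bw_le hN
  calc _ ≤ ENNReal.ofReal R * 4 * (ENNReal.ofReal R * 4) := by gcongr
    _ = _ := by ring

lemma integrable_of_lintegral_ofReal_ne_top {α : Type*} [MeasurableSpace α] {μ : Measure α}
    {w : α → ℝ} (hw : Measurable w) (h0 : ∀ x, 0 ≤ w x) (h : ∫⁻ x, ENNReal.ofReal (w x) ∂μ ≠ ∞) :
    Integrable w μ := by
  refine ⟨hw.aestronglyMeasurable, ?_⟩
  rw [hasFiniteIntegral_iff_ofReal (.of_forall h0)]
  exact h.lt_top

lemma integrable_wB (c : ℝ × ℝ) {R : ℝ} (hR : 0 < R) : Integrable (wB c R) := by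
  refine integrable_of_lintegral_ofReal_ne_top (by fun_prop) (wB_nonneg c hR) ?_
  refine ((lintegral_mono (ofReal_wB_le c hR)).trans
    (lintegral_bw_mul_bw_le (by norm_num) c hR)).trans_lt (by finiteness) |>.ne

lemma wtB_nonneg (c : ℝ × ℝ) {R : ℝ} (hR : 0 < R) (x : ℝ × ℝ) : 0 ≤ wtB c R x := by
  unfold wtB; positivity

@[fun_prop]
lemma measurable_wtB (c : ℝ × ℝ) (R : ℝ) : Measurable (wtB c R) := by
  have : wtB c R = fun x => ((1 + |x.1 - c.1| / R) ^ 100)⁻¹ * ((1 + |x.2 - c.2| / R) ^ 100)⁻¹ := by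
    ext x; rw [wtB, zpow_neg, zpow_neg]; rfl
  rw [this]; fun_prop

lemma integrable_wtB (c : ℝ × ℝ) {R : ℝ} (hR : 0 < R) : Integrable (wtB c R) := by
  refine integrable_of_lintegral_ofReal_ne_top (by fun_prop) (wtB_nonneg c hR) ?_
  simp_rw [ofReal_wtB c hR]
  exact (lintegral_wt_le c hR).trans_lt (by finiteness) |>.ne

lemma integrable_pext_rpow_mul {h : ℝ → ℂ} (hh : Integrable h) {μ : Measure (ℝ × ℝ)}
    {w : ℝ × ℝ → ℝ} (hw : Integrable w μ) {p : ℝ} (hp : 0 < p) :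
    Integrable (fun x => ‖pext h x‖ ^ p * w x) μ := by
  refine hw.bdd_mul (c := (∫ ξ, ‖h ξ‖) ^ p) ?_ (.of_forall fun x => ?_)
  · have := (pext_continuous hh).measurable
    exact (this.norm.pow_const p).aestronglyMeasurable
  · rw [Real.norm_of_nonneg (by positivity)]
    exact Real.rpow_le_rpow (norm_nonneg _) (norm_pext_le x) hp.le

lemma ofReal_integral_pext {h : ℝ → ℂ} (hh : Integrable h) {μ : Measure (ℝ × ℝ)}
    {w : ℝ × ℝ → ℝ} (hw : Integrable w μ) (h0 : ∀ x, 0 ≤ w x) {p : ℝ} (hp : 0 < p) :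
    ENNReal.ofReal (∫ x, ‖pext h x‖ ^ p * w x ∂μ) =
      ∫⁻ x, ‖pext h x‖ₑ ^ p * ENNReal.ofReal (w x) ∂μ := by
  rw [ofReal_integral_eq_lintegral_ofReal (integrable_pext_rpow_mul hh hw hp)
    (.of_forall fun x => mul_nonneg (by positivity) (h0 x))]
  refine lintegral_congr fun x => ?_
  rw [ENNReal.ofReal_mul (by positivity), ← ENNReal.ofReal_rpow_of_nonneg (norm_nonneg _) hp.le,
    ofReal_norm]

lemma ofReal_wLp {h : ℝ → ℂ} (hh : Integrable h) (c : ℝ × ℝ) {R : ℝ} (hR : 0 < R) {p : ℝ}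
    (hp : 0 < p) : ENNReal.ofReal (wLp p (wB c R) (pext h)) =
      (∫⁻ x, ‖pext h x‖ₑ ^ p * ENNReal.ofReal (wB c R x)) ^ (1 / p) := by
  rw [wLp, ← ENNReal.ofReal_rpow_of_nonneg, ofReal_integral_pext hh (integrable_wB c hR)
    (wB_nonneg c hR) hp]
  · exact integral_nonneg fun x => mul_nonneg (by positivity) (wB_nonneg c hR x)
  · positivity

lemma volume_sqr (c : ℝ × ℝ) (R : ℝ) : volume (sqr c R) = ENNReal.ofReal R ^ 2 := by
  rw [sqr, Measure.volume_eq_prod, Measure.prod_prod, Real.volume_Icc, Real.volume_Icc, pow_two]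
  congr 2 <;> ring

lemma measurableSet_sqr (c : ℝ × ℝ) (R : ℝ) : MeasurableSet (sqr c R) :=
  measurableSet_Icc.prod measurableSet_Icc

lemma ofReal_sqLp {h : ℝ → ℂ} (hh : Integrable h) (c : ℝ × ℝ) (R : ℝ) {p : ℝ}
    (hp : 0 < p) : ENNReal.ofReal (sqLp p c R (pext h)) =
      (∫⁻ x in sqr c R, ‖pext h x‖ₑ ^ p) ^ (1 / p) := by
  rw [sqLp, ← ENNReal.ofReal_rpow_of_nonneg (integral_nonneg fun x => by positivity)
    (by positivity)]
  have : IsFiniteMeasure (volume.restrict (sqr c R)) :=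
    ⟨by rw [Measure.restrict_apply_univ, volume_sqr c R]; finiteness⟩
  have := ofReal_integral_pext hh (μ := volume.restrict (sqr c R)) (w := fun _ => 1)
    (integrable_const _) (fun _ => zero_le_one) hp
  simp only [mul_one, ENNReal.ofReal_one] at this
  rw [this]

lemma sq_rpow_one_div {p : ℝ} (a : ℝ≥0∞) : (a ^ (1 / p)) ^ 2 = a ^ (2 / p) := by
  rw [← ENNReal.rpow_natCast, ← ENNReal.rpow_mul]; congr 1; push_cast; ring

lemma decIneq_iff {p : ℝ} (hp : 0 < p) {n : ℕ} (hn : 0 < n) {D : ℝ} (hD : 0 ≤ D) :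
    DecIneq p n D ↔ ∀ g : ℝ → ℂ, IntegrableOn g (Set.Icc 0 1) → ∀ c : ℝ × ℝ,
      ∫⁻ x in sqr c ((n : ℝ) ^ 2), ‖pext (pc g 0 1) x‖ₑ ^ p ≤ ENNReal.ofReal D ^ p *
        (∑ l ∈ Finset.range n, (∫⁻ x, ‖pext (pc g ((l : ℝ) / n) (((l : ℝ) + 1) / n)) x‖ₑ ^ p *
          ENNReal.ofReal (wB c ((n : ℝ) ^ 2) x)) ^ (2 / p)) ^ (p / 2) := by
  have hn0 : (0 : ℝ) < n := by exact_mod_cast hn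
  refine forall_congr' fun g => forall_congr' fun hg => forall_congr' fun c => ?_
  have hpc : ∀ a b : ℝ, 0 ≤ a → b ≤ 1 → Integrable (pc g a b) := fun a b ha hb =>
    (integrable_indicator_iff measurableSet_Ico).2
      (hg.mono_set (Set.Ico_subset_Icc_self.trans (Set.Icc_subset_Icc ha hb)))
  have hl : ∀ l ∈ Finset.range n, Integrable (pc g ((l : ℝ) / n) (((l : ℝ) + 1) / n)) := by
    intro l hl
    refine hpc _ _ (by positivity) ?_
    rw [div_le_one hn0]; exact_mod_cast Finset.mem_range.1 hl
  have hS : 0 ≤ ∑ l ∈ Finset.range n, wLp p (wB c ((n : ℝ) ^ 2))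
      (pext (pc g ((l : ℝ) / n) (((l : ℝ) + 1) / n))) ^ 2 :=
    Finset.sum_nonneg fun _ _ => sq_nonneg _
  simp_rw [extOp_eq_pext]
  rw [← ENNReal.ofReal_le_ofReal_iff (by positivity), ENNReal.ofReal_mul hD,
    ofReal_sqLp (hpc 0 1 le_rfl le_rfl) c _ hp,
    ← ENNReal.ofReal_rpow_of_nonneg hS (by norm_num),
    ENNReal.ofReal_sum_of_nonneg fun _ _ => sq_nonneg _]
  have e : ∀ l ∈ Finset.range n, ENNReal.ofReal (wLp p (wB c ((n : ℝ) ^ 2))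
      (pext (pc g ((l : ℝ) / n) (((l : ℝ) + 1) / n))) ^ 2) =
      (∫⁻ x, ‖pext (pc g ((l : ℝ) / n) (((l : ℝ) + 1) / n)) x‖ₑ ^ p *
          ENNReal.ofReal (wB c ((n : ℝ) ^ 2) x)) ^ (2 / p) := by
    intro l hl'
    rw [ENNReal.ofReal_pow, ofReal_wLp (hl l hl') c (by positivity) hp, sq_rpow_one_div]
    exact Real.rpow_nonneg (integral_nonneg fun x =>
      mul_nonneg (by positivity) (wB_nonneg c (by positivity) x)) _
  rw [Finset.sum_congr rfl e, one_div, ENNReal.rpow_inv_le_iff hp,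
    ENNReal.mul_rpow_of_nonneg _ _ hp.le, ← ENNReal.rpow_mul, one_div_mul_eq_div]

lemma enorm_pext_le_of_support {r : ℝ → ℂ} {M : ℝ≥0∞} (hr : ∀ ζ, ‖r ζ‖ₑ ≤ M) {a b ε : ℝ}
    (hs : ∀ ζ, r ζ ≠ 0 → |ζ - a| ≤ ε ∨ |ζ - b| ≤ ε) (x : ℝ × ℝ) :
    ‖pext r x‖ₑ ≤ 4 * (ENNReal.ofReal ε * M) := by
  have h1 : ∀ ζ, ‖r ζ‖ₑ ≤ (Set.Icc (a - ε) (a + ε)).indicator (fun _ => M) ζ +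
      (Set.Icc (b - ε) (b + ε)).indicator (fun _ => M) ζ := by
    intro ζ
    by_cases h0 : r ζ = 0
    · simp [h0]
    rcases hs ζ h0 with h | h
    · rw [Set.indicator_of_mem (by rw [abs_le] at h; constructor <;> linarith)]
      exact (hr ζ).trans le_self_add
    · rw [add_comm, Set.indicator_of_mem (by rw [abs_le] at h; constructor <;> linarith)]
      exact (hr ζ).trans le_self_add
  refine (enorm_pext_le x).trans ((lintegral_mono h1).trans ?_)
  rw [lintegral_add_left (measurable_const.indicator measurableSet_Icc),
    lintegral_indicator_const measurableSet_Icc, lintegral_indicator_const measurableSet_Icc,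
    Real.volume_Icc, Real.volume_Icc, show a + ε - (a - ε) = 2 * ε by ring,
    show b + ε - (b - ε) = 2 * ε by ring, ENNReal.ofReal_mul (by norm_num), ENNReal.ofReal_ofNat]
  exact le_of_eq (by ring)

/-- Pieces `u l` living on the `ε`-neighbourhood of `[l / m, (l + 1) / m]`, bounded by `s l`. -/
structure NearPieces (m : ℕ) (ε : ℝ) (u : ℕ → ℝ → ℂ) (s : ℕ → ℝ≥0∞) : Prop where
  pos : 0 < m
  eps_pos : 0 < ε
  eps_le : ε * m ≤ 1 / 100
  supp : ∀ l ζ, u l ζ ≠ 0 → (l : ℝ) / m - ε ≤ ζ ∧ ζ ≤ ((l : ℝ) + 1) / m + ε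
  bound : ∀ l ζ, ‖u l ζ‖ₑ ≤ s l

/-- The neighbours of the `l`-th interval. -/
def nbr (m l : ℕ) : Finset ℕ := {l' ∈ Finset.range m | l' ≤ l + 1 ∧ l ≤ l' + 1}

lemma card_nbr_le (m l : ℕ) : (nbr m l).card ≤ 3 := by
  refine (Finset.card_le_card (t := Finset.Icc (l - 1) (l + 1)) fun i hi => ?_).trans ?_
  · simp only [nbr, Finset.mem_filter, Finset.mem_range, Finset.mem_Icc] at hi ⊢; omega
  · simp; omega

lemma sum_sum_nbr_le (m : ℕ) (f : ℕ → ℝ≥0∞) :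
    ∑ l ∈ Finset.range m, ∑ i ∈ nbr m l, f i ≤ 3 * ∑ i ∈ Finset.range m, f i := by
  rw [Finset.sum_comm' (t' := Finset.range m) (s' := fun i => nbr m i)
    (by intro x y; simp only [nbr, Finset.mem_filter, Finset.mem_range]; omega), Finset.mul_sum]
  refine Finset.sum_le_sum fun i _ => ?_
  rw [Finset.sum_const, nsmul_eq_mul]
  gcongr
  exact_mod_cast card_nbr_le m i

namespace NearPieces

variable {m : ℕ} {ε : ℝ} {u : ℕ → ℝ → ℂ} {s : ℕ → ℝ≥0∞}

lemma enorm_sum_piece_le (t : Finset ℕ) {S : ℝ≥0∞} (hu : NearPieces m ε u s) (hS : ∀ l ∈ t, s l ≤ S)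
    (ht : t.card ≤ 3) (ζ : ℝ) : ‖∑ l ∈ t, u l ζ‖ₑ ≤ 3 * S := by
  refine (enorm_sum_le _ _).trans ((Finset.sum_le_sum fun l hl =>
    (hu.bound l ζ).trans (hS l hl)).trans ?_)
  rw [Finset.sum_const, nsmul_eq_mul]
  gcongr
  exact_mod_cast ht

lemma eps_lt (hu : NearPieces m ε u s) : ε < 1 / m := by
  have hm : (0 : ℝ) < m := by exact_mod_cast hu.pos
  rw [lt_div_iff₀ hm]
  linarith [hu.eps_le]

lemma lt_of_div_lt (hu : NearPieces m ε u s) {a b : ℕ}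
    (h : (a : ℝ) / m < ((b : ℝ) + 1) / m + ε) : a < b + 2 := by
  have hm : (0 : ℝ) < m := by exact_mod_cast hu.pos
  have h1 := hu.eps_lt
  have : (a : ℝ) / m < ((b : ℝ) + 2) / m := by
    rw [show ((b : ℝ) + 2) / m = ((b : ℝ) + 1) / m + 1 / m by ring]; linarith
  rw [div_lt_div_iff_of_pos_right hm] at this
  exact_mod_cast this

lemma exists_enorm_pext_pc_sub_le (hu : NearPieces m ε u s) {l : ℕ} (hl : l < m) :
    ∃ l' ∈ nbr m l, ∀ x, ‖pext (fun ζ => pc (fun ζ => ∑ i ∈ Finset.range m, u i ζ)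
      ((l : ℝ) / m) (((l : ℝ) + 1) / m) ζ - u l ζ) x‖ₑ ≤ 12 * (ENNReal.ofReal ε * s l') := by
  have hm : (0 : ℝ) < m := by exact_mod_cast hu.pos
  have hlm : l ∈ nbr m l := by simp [nbr, hl]
  obtain ⟨l', hl', hmax⟩ := Finset.exists_max_image (nbr m l) s ⟨l, hlm⟩
  refine ⟨l', hl', fun x => ?_⟩
  have key : ∀ ζ, (l : ℝ) / m ≤ ζ → ζ < ((l : ℝ) + 1) / m → ∀ i ∈ Finset.range m, i ≠ l →
      u i ζ ≠ 0 → i ∈ nbr m l ∧ (|ζ - l / m| ≤ ε ∨ |ζ - (l + 1) / m| ≤ ε) := by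
    intro ζ h1 h2 i hi hil h0
    obtain ⟨h3, h4⟩ := hu.supp i ζ h0
    have h5 : i < l + 2 := hu.lt_of_div_lt (by linarith)
    have h6 : l < i + 2 := by
      by_contra hc
      have hm' := hu.eps_lt
      have : ((i : ℝ) + 2) / m ≤ (l : ℝ) / m := by
        gcongr; exact_mod_cast not_lt.1 hc
      rw [show ((i : ℝ) + 2) / m = ((i : ℝ) + 1) / m + 1 / m by ring] at this
      linarith
    refine ⟨by simp only [nbr, Finset.mem_filter]; exact ⟨hi, by omega, by omega⟩, ?_⟩
    rcases lt_or_gt_of_ne hil with h | h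
    · left
      have : ((i : ℝ) + 1) / m ≤ (l : ℝ) / m := by
        gcongr; exact_mod_cast h
      rw [abs_le]; constructor <;> linarith [hu.eps_pos]
    · right
      have : ((l : ℝ) + 1) / m ≤ (i : ℝ) / m := by
        gcongr; exact_mod_cast h
      rw [abs_le]; constructor <;> linarith [hu.eps_pos]
  have h12 : (12 : ℝ≥0∞) * (ENNReal.ofReal ε * s l') = 4 * (ENNReal.ofReal ε * (3 * s l')) := by
    ring
  rw [h12]
  refine enorm_pext_le_of_support (a := l / m) (b := (l + 1) / m) (fun ζ => ?_) (fun ζ => ?_) x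
  · by_cases hζ : ζ ∈ Set.Ico ((l : ℝ) / m) (((l : ℝ) + 1) / m)
    · rw [pc, Set.indicator_of_mem hζ, ← Finset.sum_erase_eq_sub (Finset.mem_range.2 hl),
        ← Finset.sum_subset (s₁ := (nbr m l).erase l)]
      · refine hu.enorm_sum_piece_le _ (fun i hi => hmax i (Finset.mem_of_mem_erase hi)) ?_ ζ
        exact (Finset.card_le_card (Finset.erase_subset _ _)).trans (card_nbr_le m l)
      · exact Finset.erase_subset_erase _ (Finset.filter_subset _ _)
      · intro i hi hi'
        by_contra h0
        rw [Finset.mem_erase] at hi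
        exact hi' (Finset.mem_erase.2 ⟨hi.1, (key ζ hζ.1 hζ.2 i hi.2 hi.1 h0).1⟩)
    · rw [pc, Set.indicator_of_notMem hζ, zero_sub, enorm_neg]
      have := hu.enorm_sum_piece_le {l} (fun i hi => by
        rw [Finset.mem_singleton] at hi; subst hi; exact hmax i hlm) (by simp) ζ
      simpa using this
  · intro h0
    by_cases hζ : ζ ∈ Set.Ico ((l : ℝ) / m) (((l : ℝ) + 1) / m)
    · rw [pc, Set.indicator_of_mem hζ, ← Finset.sum_erase_eq_sub (Finset.mem_range.2 hl)] at h0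
      obtain ⟨i, hi, hi0⟩ := Finset.exists_ne_zero_of_sum_ne_zero h0
      rw [Finset.mem_erase] at hi
      exact (key ζ hζ.1 hζ.2 i hi.2 hi.1 hi0).2
    · rw [pc, Set.indicator_of_notMem hζ, zero_sub, neg_ne_zero] at h0
      obtain ⟨h3, h4⟩ := hu.supp l ζ h0
      rw [Set.mem_Ico, not_and_or, not_le, not_lt] at hζ
      rcases hζ with h | h
      · left; rw [abs_le]; constructor <;> linarith [hu.eps_pos]
      · right; rw [abs_le]; constructor <;> linarith [hu.eps_pos]

lemma exists_enorm_pext_sub_pc_le (hu : NearPieces m ε u s) :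
    ∃ l' ∈ Finset.range m, ∀ x, ‖pext (fun ζ => (∑ i ∈ Finset.range m, u i ζ) -
      pc (fun ζ => ∑ i ∈ Finset.range m, u i ζ) 0 1 ζ) x‖ₑ ≤ 12 * (ENNReal.ofReal ε * s l') := by
  have hm : (0 : ℝ) < m := by exact_mod_cast hu.pos
  obtain ⟨l', hl', hmax⟩ := Finset.exists_max_image (Finset.range m) s ⟨0, by simp [hu.pos]⟩
  refine ⟨l', hl', fun x => ?_⟩
  have key1 : ∀ ζ, ζ < 0 → ∀ i ∈ Finset.range m, u i ζ ≠ 0 → i = 0 ∧ |ζ - 0| ≤ ε := by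
    intro ζ h1 i hi h0
    obtain ⟨h3, h4⟩ := hu.supp i ζ h0
    have h5 : (0 : ℝ) ≤ (i : ℝ) / m := by positivity
    refine ⟨?_, by rw [abs_le]; constructor <;> linarith [hu.eps_pos]⟩
    by_contra hc
    have : (1 : ℝ) / m ≤ (i : ℝ) / m := by
      gcongr; exact_mod_cast Nat.one_le_iff_ne_zero.2 hc
    linarith [hu.eps_lt]
  have key2 : ∀ ζ, 1 ≤ ζ → ∀ i ∈ Finset.range m, u i ζ ≠ 0 → i = m - 1 ∧ |ζ - 1| ≤ ε := by
    intro ζ h1 i hi h0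
    obtain ⟨h3, h4⟩ := hu.supp i ζ h0
    have him := Finset.mem_range.1 hi
    have h5 : ((i : ℝ) + 1) / m ≤ 1 := by
      rw [div_le_one hm]; exact_mod_cast him
    refine ⟨?_, by rw [abs_le]; constructor <;> linarith [hu.eps_pos]⟩
    by_contra hc
    have : ((i : ℝ) + 2) / m ≤ 1 := by
      rw [div_le_one hm]
      have : i + 2 ≤ m := by omega
      exact_mod_cast this
    rw [show ((i : ℝ) + 2) / m = ((i : ℝ) + 1) / m + 1 / m by ring] at this
    linarith [hu.eps_lt]
  have h12 : (12 : ℝ≥0∞) * (ENNReal.ofReal ε * s l') = 4 * (ENNReal.ofReal ε * (3 * s l')) := by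
    ring
  rw [h12]
  have hone : ∀ ζ, ∀ j ∈ Finset.range m, (∀ i ∈ Finset.range m, u i ζ ≠ 0 → i = j) →
      ‖∑ i ∈ Finset.range m, u i ζ‖ₑ ≤ 3 * s l' := by
    intro ζ j hj h
    rw [Finset.sum_eq_single_of_mem j hj (fun i hi hij => by
      by_contra h0; exact hij (h i hi h0))]
    have := hu.enorm_sum_piece_le {j} (fun i hi => by
      rw [Finset.mem_singleton] at hi; subst hi; exact hmax i hj) (by simp) ζ
    simpa using this
  have hmp := hu.pos
  refine enorm_pext_le_of_support (a := 0) (b := 1) (fun ζ => ?_) (fun ζ => ?_) x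
  · by_cases hζ : ζ ∈ Set.Ico (0 : ℝ) 1
    · rw [pc, Set.indicator_of_mem hζ, sub_self]; simp
    · rw [pc, Set.indicator_of_notMem hζ, sub_zero]
      rw [Set.mem_Ico, not_and_or, not_le, not_lt] at hζ
      rcases hζ with h | h
      · exact hone ζ 0 (by simp [hmp]) fun i hi h0 => (key1 ζ h i hi h0).1
      · exact hone ζ (m - 1) (by simp; omega) fun i hi h0 => (key2 ζ h i hi h0).1
  · intro h0
    by_cases hζ : ζ ∈ Set.Ico (0 : ℝ) 1
    · rw [pc, Set.indicator_of_mem hζ, sub_self] at h0; simp at h0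
    · rw [pc, Set.indicator_of_notMem hζ, sub_zero] at h0
      obtain ⟨i, hi, hi0⟩ := Finset.exists_ne_zero_of_sum_ne_zero h0
      rw [Set.mem_Ico, not_and_or, not_le, not_lt] at hζ
      rcases hζ with h | h
      · exact .inl (key1 ζ h i hi hi0).2
      · exact .inr (key2 ζ h i hi hi0).2

end NearPieces

lemma mul_lintegral_rpow_mul_sq_le {α : Type*} [MeasurableSpace α] {μ : Measure α}
    {k f : α → ℝ≥0∞} (hk : AEMeasurable k μ) (hf : AEMeasurable f μ) {p : ℝ} (hp : 1 ≤ p)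
    (hp6 : p ≤ 6) {e ρ A : ℝ≥0∞} (he : e * ρ ≤ 1) (hρ0 : ρ ≠ 0) (hρ : ρ ≠ ∞) (hA : 1 ≤ A)
    (hkA : ∫⁻ x, k x ∂μ ≤ ρ * A) :
    (e * ∫⁻ x, k x * f x ∂μ) ^ p * ρ ^ 2 ≤ A ^ 5 * (ρ * ∫⁻ x, k x * f x ^ p ∂μ) := by
  have hp0 : 0 ≤ p := by linarith
  have h1 : A ^ (p - 1) ≤ A ^ 5 := by
    rw [← ENNReal.rpow_natCast]
    exact ENNReal.rpow_le_rpow_of_exponent_le hA (by push_cast; linarith)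
  have h2 : ρ ^ 2 * ρ ^ (p - 1) = ρ ^ p * ρ := by
    rw [← ENNReal.rpow_natCast, ← ENNReal.rpow_add _ _ hρ0 hρ]
    nth_rw 3 [← ENNReal.rpow_one ρ]
    rw [← ENNReal.rpow_add _ _ hρ0 hρ]
    congr 1; push_cast; ring
  calc _ = e ^ p * ρ ^ 2 * (∫⁻ x, k x * f x ∂μ) ^ p := by
        rw [ENNReal.mul_rpow_of_nonneg _ _ hp0]; ring
    _ ≤ e ^ p * ρ ^ 2 * ((∫⁻ x, k x ∂μ) ^ (p - 1) * ∫⁻ x, k x * f x ^ p ∂μ) :=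
        mul_le_mul' le_rfl (lintegral_mul_rpow_le hk hf hp)
    _ ≤ e ^ p * ρ ^ 2 * ((ρ ^ (p - 1) * A ^ (p - 1)) * ∫⁻ x, k x * f x ^ p ∂μ) := by
        gcongr
        rw [← ENNReal.mul_rpow_of_nonneg _ _ (by linarith)]
        exact ENNReal.rpow_le_rpow hkA (by linarith)
    _ = (e * ρ) ^ p * A ^ (p - 1) * (ρ * ∫⁻ x, k x * f x ^ p ∂μ) := by
        rw [ENNReal.mul_rpow_of_nonneg _ _ hp0]
        rw [show ∀ I B : ℝ≥0∞, e ^ p * ρ ^ 2 * (ρ ^ (p - 1) * B * I) =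
          e ^ p * B * I * (ρ ^ 2 * ρ ^ (p - 1)) from fun I B => by ring, h2]
        ring
    _ ≤ 1 * A ^ 5 * (ρ * ∫⁻ x, k x * f x ^ p ∂μ) := by
        gcongr
        exact ENNReal.rpow_le_one he hp0
    _ = _ := by rw [one_mul]

lemma enorm_add_rpow_le {p : ℝ} (hp : 1 ≤ p) (hp6 : p ≤ 6) (a b : ℂ) :
    ‖a + b‖ₑ ^ p ≤ 32 * (‖a‖ₑ ^ p + ‖b‖ₑ ^ p) := by
  refine (ENNReal.rpow_le_rpow (enorm_add_le a b) (by linarith)).trans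
    ((ENNReal.rpow_add_le_mul_rpow_add_rpow _ _ hp).trans ?_)
  gcongr
  calc (2 : ℝ≥0∞) ^ (p - 1) ≤ 2 ^ (5 : ℝ) :=
        ENNReal.rpow_le_rpow_of_exponent_le (by norm_num) (by linarith)
    _ = 32 := by
        rw [show (5 : ℝ) = (5 : ℕ) by norm_num, ENNReal.rpow_natCast]; norm_num

lemma twelve_rpow_le {p : ℝ} (hp6 : p ≤ 6) : (12 : ℝ≥0∞) ^ p ≤ 12 ^ 6 := by
  rw [← ENNReal.rpow_natCast]
  exact ENNReal.rpow_le_rpow_of_exponent_le (by norm_num) (by push_cast; linarith)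

lemma pext_add {f g : ℝ → ℂ} (hf : Integrable f) (hg : Integrable g) (x : ℝ × ℝ) :
    pext (fun ζ => f ζ + g ζ) x = pext f x + pext g x := by
  unfold pext
  rw [← integral_add (integrable_mul_ec hf (by fun_prop)) (integrable_mul_ec hg (by fun_prop))]
  congr 1; ext ζ; ring

/-- A frequency localized solution in a space-time weight is controlled by a single time slice. -/
lemma exists_lintegral_pext_mul_wB_le : ∃ C : ℝ≥0∞, C ≠ ∞ ∧ ∀ m : ℝ, 0 < m → ∀ ζ₀ : ℝ,
    ∀ u : ℝ → ℂ, Integrable u → (∀ ζ, u ζ ≠ 0 → m * |ζ - ζ₀| ≤ 10) → ∀ p : ℝ, 1 ≤ p → p ≤ 6 →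
    ∀ (z : ℝ × ℝ) (τ : ℝ), ∫⁻ x, ‖pext u x‖ₑ ^ p * ENNReal.ofReal (wB z (m ^ 2) x) ≤
      C * ENNReal.ofReal ((1 + |z.2 - τ| / m ^ 2) ^ 6) * ENNReal.ofReal (m ^ 2) *
        ∫⁻ y, ‖pext u (y, τ)‖ₑ ^ p := by
  obtain ⟨C, hC, H⟩ := exists_lintegral_pext_time_le
  refine ⟨C * 4, by finiteness, fun m hm ζ₀ u hu hs p hp hp6 z τ => ?_⟩
  have hR : 0 < m ^ 2 := by positivity
  obtain ⟨R, hRe⟩ : ∃ R, R = m ^ 2 := ⟨_, rfl⟩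
  rw [← hRe] at hR ⊢
  have hm1 := (pext_enorm_measurable hu).pow_const p
  have hbw : ∀ t : ℝ, bw 50 ((t - z.2) / R) * ENNReal.ofReal ((1 + |t - τ| / R) ^ 6) ≤
      ENNReal.ofReal ((1 + |z.2 - τ| / R) ^ 6) * bw 2 ((t - z.2) / R) := by
    intro t
    have h1 : (1 + |t - τ| / R) ^ 6 ≤ (1 + |z.2 - τ| / R) ^ 6 * (1 + |(t - z.2) / R|) ^ 6 := by
      rw [← mul_pow, abs_div, abs_of_pos hR]
      refine pow_le_pow_left₀ (by positivity) ?_ 6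
      have := abs_sub_le t z.2 τ
      have h2 : |t - τ| / R ≤ |t - z.2| / R + |z.2 - τ| / R := by
        rw [← add_div]; gcongr
      have h3 : 0 ≤ |t - z.2| / R * (|z.2 - τ| / R) := by positivity
      nlinarith
    rw [bw, bw, ← ENNReal.ofReal_mul (by positivity), ← ENNReal.ofReal_mul (by positivity)]
    refine ENNReal.ofReal_le_ofReal ?_
    set v := 1 + |(t - z.2) / R| with hv
    have hv1 : 1 ≤ v := by rw [hv]; linarith [abs_nonneg ((t - z.2) / R)]
    have h4 : (v ^ 50)⁻¹ ≤ (v ^ 8)⁻¹ :=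
      inv_anti₀ (by positivity) (pow_le_pow_right₀ hv1 (by norm_num))
    calc _ ≤ (v ^ 8)⁻¹ * ((1 + |z.2 - τ| / R) ^ 6 * v ^ 6) := by gcongr
      _ = _ := by field_simp
  calc ∫⁻ x, ‖pext u x‖ₑ ^ p * ENNReal.ofReal (wB z R x)
      ≤ ∫⁻ x : ℝ × ℝ, ‖pext u (x.1, x.2)‖ₑ ^ p * bw 50 ((x.2 - z.2) / R) := by
        refine lintegral_mono fun x => mul_le_mul' le_rfl ((ofReal_wB_le z hR x).trans ?_)
        exact (mul_le_mul' (bw_le_one _ _) le_rfl).trans_eq (one_mul _)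
    _ = ∫⁻ t, ∫⁻ y, ‖pext u (y, t)‖ₑ ^ p * bw 50 ((t - z.2) / R) := by
        rw [Measure.volume_eq_prod, lintegral_prod_symm']
        have := measurable_bw 50
        exact hm1.mul (by fun_prop)
    _ = ∫⁻ t, bw 50 ((t - z.2) / R) * ∫⁻ y, ‖pext u (y, t)‖ₑ ^ p := by
        refine lintegral_congr fun t => ?_
        rw [lintegral_mul_const' _ _ (bw_ne_top _ _), mul_comm]
    _ ≤ ∫⁻ t, C * ENNReal.ofReal ((1 + |z.2 - τ| / R) ^ 6) * (∫⁻ y, ‖pext u (y, τ)‖ₑ ^ p) *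
          bw 2 ((t - z.2) / R) := by
        refine lintegral_mono fun t => ?_
        calc _ ≤ bw 50 ((t - z.2) / R) * (C * ENNReal.ofReal ((1 + |t - τ| / R) ^ 6) *
              ∫⁻ y, ‖pext u (y, τ)‖ₑ ^ p) := by
              gcongr
              rw [hRe]
              exact H m hm ζ₀ u hu hs p hp hp6 τ t
          _ = C * (bw 50 ((t - z.2) / R) * ENNReal.ofReal ((1 + |t - τ| / R) ^ 6)) *
              ∫⁻ y, ‖pext u (y, τ)‖ₑ ^ p := by ring
          _ ≤ C * (ENNReal.ofReal ((1 + |z.2 - τ| / R) ^ 6) * bw 2 ((t - z.2) / R)) *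
              ∫⁻ y, ‖pext u (y, τ)‖ₑ ^ p := 
              mul_le_mul' (mul_le_mul' le_rfl (hbw t)) le_rfl
          _ = _ := by ring
    _ = C * ENNReal.ofReal ((1 + |z.2 - τ| / R) ^ 6) * (∫⁻ y, ‖pext u (y, τ)‖ₑ ^ p) *
          (ENNReal.ofReal R * ∫⁻ v, bw 2 v) := by
        rw [lintegral_const_mul, lintegral_comp_sub_div (measurable_bw 2) hR]
        have := measurable_bw 2
        fun_prop
    _ ≤ C * ENNReal.ofReal ((1 + |z.2 - τ| / R) ^ 6) * (∫⁻ y, ‖pext u (y, τ)‖ₑ ^ p) *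
          (ENNReal.ofReal R * 4) := by gcongr; exact lintegral_bw_two
    _ = _ := by ring

lemma pc_eq_sum {h : ℝ → ℂ} (hs : ∀ ξ, h ξ ≠ 0 → 0 ≤ ξ ∧ ξ < 1) {m : ℕ} (hm : 0 < m) (ξ : ℝ) :
    h ξ = ∑ l ∈ Finset.range m, pc h ((l : ℝ) / m) (((l : ℝ) + 1) / m) ξ := by
  have hm0 : (0 : ℝ) < m := by exact_mod_cast hm
  have h1 := pc_sum h 0 (t := 1 / m) (by positivity) m ξ
  have h2 : (0 : ℝ) + m * (1 / m) = 1 := by field_simp; ring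
  rw [h2] at h1
  have h3 : pc h 0 1 ξ = h ξ := by
    by_cases h0 : h ξ = 0
    · rw [pc, Set.indicator_apply]; simp [h0]
    · exact Set.indicator_of_mem (show ξ ∈ Set.Ico (0 : ℝ) 1 from hs ξ h0) _
  rw [← h3, h1]
  refine Finset.sum_congr rfl fun l _ => ?_
  congr 1 <;> ring

lemma nearPieces_loc {χ θ : 𝓢(ℝ, ℂ)} (hχ : ∀ w, (1 / 100 : ℝ) < |w| → χ w = 0)
    (hθ : ∀ w, ∫ y, θ y * ec (-(y * w)) = χ w) {m : ℕ} (hm : 0 < m) {h : ℝ → ℂ}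
    (hh : Integrable h) (z τ : ℝ) :
    NearPieces m (1 / (100 * (m : ℝ) ^ 2))
      (fun l => loc χ ((m : ℝ) ^ 2) z τ (pc h ((l : ℝ) / m) (((l : ℝ) + 1) / m)))
      (fun l => ∫⁻ y, ‖θ ((y - z) / (m : ℝ) ^ 2)‖ₑ *
        ‖pext (pc h ((l : ℝ) / m) (((l : ℝ) + 1) / m)) (y, τ)‖ₑ) := by
  have hm0 : (0 : ℝ) < m := by exact_mod_cast hm
  have hm1 : (1 : ℝ) ≤ m := by exact_mod_cast hm
  refine ⟨hm, by positivity, ?_, fun l ζ h0 => ?_, fun l ζ =>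
    enorm_loc_le hθ (by positivity) z τ (pc_integrable hh _ _) ζ⟩
  · rw [div_mul_eq_mul_div, div_le_div_iff₀ (by positivity) (by norm_num)]
    nlinarith
  · by_contra hc
    refine h0 (loc_eq_zero hχ (by positivity) z τ fun ξ hξ => ?_)
    have := pc_apply_ne_zero hξ
    by_contra h1
    rw [not_lt, abs_le] at h1
    exact hc ⟨by linarith, by linarith⟩

lemma rpow_three_le {p : ℝ} (hp6 : p ≤ 6) : (3 : ℝ≥0∞) ^ (p / 2) ≤ 27 := by
  calc (3 : ℝ≥0∞) ^ (p / 2) ≤ 3 ^ (3 : ℝ) :=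
        ENNReal.rpow_le_rpow_of_exponent_le (by norm_num) (by linarith)
    _ = 27 := by
        rw [show (3 : ℝ) = (3 : ℕ) by norm_num, ENNReal.rpow_natCast]; norm_num

/-- `ℓ^{2/p}` sums of quantities dominated by a neighbouring term. -/
lemma sum_rpow_nbr_le {m : ℕ} {p : ℝ} (hp : 0 < p) (hp6 : p ≤ 6) {T Y : ℕ → ℝ≥0∞} {B : ℝ≥0∞}
    (h : ∀ l < m, ∃ l' ∈ nbr m l, T l ≤ B * Y l') :
    (∑ l ∈ Finset.range m, T l ^ (2 / p)) ^ (p / 2) ≤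
      27 * B * (∑ l ∈ Finset.range m, Y l ^ (2 / p)) ^ (p / 2) := by
  have hp2 : 0 ≤ 2 / p := by positivity
  have h1 : ∑ l ∈ Finset.range m, T l ^ (2 / p) ≤
      3 * (B ^ (2 / p) * ∑ l ∈ Finset.range m, Y l ^ (2 / p)) := by
    calc _ ≤ ∑ l ∈ Finset.range m, ∑ i ∈ nbr m l, B ^ (2 / p) * Y i ^ (2 / p) := by
          refine Finset.sum_le_sum fun l hl => ?_
          obtain ⟨l', hl', hT⟩ := h l (Finset.mem_range.1 hl)
          refine (ENNReal.rpow_le_rpow hT hp2).trans ?_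
          rw [ENNReal.mul_rpow_of_nonneg _ _ hp2]
          exact Finset.single_le_sum (f := fun i => B ^ (2 / p) * Y i ^ (2 / p))
            (fun _ _ => zero_le) hl'
      _ ≤ _ := by
          rw [Finset.mul_sum]
          exact sum_sum_nbr_le m _
  refine (ENNReal.rpow_le_rpow h1 (by positivity)).trans ?_
  rw [ENNReal.mul_rpow_of_nonneg _ _ (by positivity), ENNReal.mul_rpow_of_nonneg _ _ (by positivity),
    ← ENNReal.rpow_mul, show 2 / p * (p / 2) = 1 by field_simp, ENNReal.rpow_one, mul_assoc]
  gcongr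
  exact rpow_three_le hp6

lemma le_sum_rpow {m l : ℕ} (hl : l ∈ Finset.range m) {p : ℝ} (hp : 0 < p) (Y : ℕ → ℝ≥0∞) :
    Y l ≤ (∑ l ∈ Finset.range m, Y l ^ (2 / p)) ^ (p / 2) := by
  calc Y l = (Y l ^ (2 / p)) ^ (p / 2) := by
        rw [← ENNReal.rpow_mul, show 2 / p * (p / 2) = 1 by field_simp, ENNReal.rpow_one]
    _ ≤ _ := by
        refine ENNReal.rpow_le_rpow ?_ (by positivity)
        exact Finset.single_le_sum (f := fun l => Y l ^ (2 / p)) (fun _ _ => zero_le) hl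

/-- Decoupling for a spatially windowed time slice evolved over a square. -/
lemma exists_window_decoupling {χ θ : 𝓢(ℝ, ℂ)} (hχ : ∀ w, (1 / 100 : ℝ) < |w| → χ w = 0)
    (hθ : ∀ w, ∫ y, θ y * ec (-(y * w)) = χ w) (hθ' : ∀ u, θ u = ∫ w, χ w * ec (w * u)) :
    ∃ C : ℝ≥0∞, C ≠ ∞ ∧ ∀ p : ℝ, 2 ≤ p → p ≤ 6 → ∀ m : ℕ, 0 < m → ∀ D : ℝ, 0 ≤ D →
    DecIneq p m D → ∀ h : ℝ → ℂ, Integrable h → (∀ ξ, h ξ ≠ 0 → 0 ≤ ξ ∧ ξ < 1) →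
    ∀ (z : ℝ × ℝ) (τ : ℝ),
    ∫⁻ x in sqr z ((m : ℝ) ^ 2), ‖pext (loc χ ((m : ℝ) ^ 2) z.1 τ h) x‖ₑ ^ p ≤
      C * (1 + ENNReal.ofReal D ^ p) * ENNReal.ofReal ((1 + |z.2 - τ| / (m : ℝ) ^ 2) ^ 6) *
      ENNReal.ofReal ((m : ℝ) ^ 2) *
      (∑ l ∈ Finset.range m, (∫⁻ y, ‖θ ((y - z.1) / (m : ℝ) ^ 2)‖ₑ *
        ‖pext (pc h ((l : ℝ) / m) (((l : ℝ) + 1) / m)) (y, τ)‖ₑ ^ p) ^ (2 / p)) ^ (p / 2) := by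
  obtain ⟨C₁, hC₁, H⟩ := exists_lintegral_pext_mul_wB_le
  obtain ⟨B, hB1, hBt, hB⟩ := θ.exists_enorm_le_bw 2
  obtain ⟨A, hA1, hAt, hA⟩ : ∃ A : ℝ≥0∞, 1 ≤ A ∧ A ≠ ∞ ∧ ∫⁻ v, ‖θ v‖ₑ ≤ A := by
    refine ⟨B * 4, ?_, by finiteness, ?_⟩
    · exact hB1.trans (le_mul_of_one_le_right zero_le (by norm_num))
    · calc _ ≤ ∫⁻ v, B * bw 2 v := lintegral_mono hB
        _ = B * ∫⁻ v, bw 2 v := lintegral_const_mul' _ _ hBt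
        _ ≤ _ := by gcongr; exact lintegral_bw_two
  have hBθ : ∀ v, ‖θ v‖ₑ ≤ B := fun v =>
    (hB v).trans ((mul_le_mul' le_rfl (bw_le_one _ _)).trans_eq (mul_one _))
  obtain ⟨K, hK⟩ : ∃ K : ℝ≥0∞, K = 12 ^ 6 * A ^ 5 := ⟨_, rfl⟩
  have hKt : K ≠ ∞ := by rw [hK]; finiteness
  refine ⟨32 * (27 * (32 * (C₁ * B ^ 5 + 16 * K)) + K), by finiteness, ?_⟩
  intro p hp hp6 m hm D hD hDec h hh hs z τ
  have hp0 : 0 < p := by linarith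
  have hp1 : 1 ≤ p := by linarith
  have hm0 : (0 : ℝ) < m := by exact_mod_cast hm
  have hm1 : (1 : ℝ) ≤ m := by exact_mod_cast hm
  obtain ⟨R, hRe⟩ : ∃ R, R = (m : ℝ) ^ 2 := ⟨_, rfl⟩
  have hR : 0 < R := by rw [hRe]; positivity
  obtain ⟨hl, hhl⟩ : ∃ hl : ℕ → ℝ → ℂ, ∀ l, hl l = pc h ((l : ℝ) / m) (((l : ℝ) + 1) / m) :=
    ⟨_, fun _ => rfl⟩
  have hhli : ∀ l, Integrable (hl l) := fun l => by rw [hhl]; exact pc_integrable hh _ _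
  have NP := nearPieces_loc hχ hθ hm hh z.1 τ
  simp_rw [← hhl, ← hRe] at NP ⊢
  obtain ⟨Y, hY⟩ : ∃ Y : ℕ → ℝ≥0∞, ∀ l, Y l = ∫⁻ y, ‖θ ((y - z.1) / R)‖ₑ *
    ‖pext (hl l) (y, τ)‖ₑ ^ p := ⟨_, fun _ => rfl⟩
  obtain ⟨P, hP⟩ : ∃ P : ℝ≥0∞, P = ENNReal.ofReal ((1 + |z.2 - τ| / R) ^ 6) := ⟨_, rfl⟩
  have hP1 : 1 ≤ P := by
    rw [hP, ENNReal.one_le_ofReal]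
    exact one_le_pow₀ (by have : 0 ≤ |z.2 - τ| / R := by positivity
                          linarith)
  obtain ⟨ρ, hρ⟩ : ∃ ρ : ℝ≥0∞, ρ = ENNReal.ofReal R := ⟨_, rfl⟩
  have hρ0 : ρ ≠ 0 := by rw [hρ]; simpa using hR
  have hρt : ρ ≠ ∞ := by rw [hρ]; finiteness
  simp_rw [← hY, ← hP, ← hρ]
  obtain ⟨e, he⟩ : ∃ e : ℝ≥0∞, e = ENNReal.ofReal (1 / (100 * R)) := ⟨_, rfl⟩
  have heρ : e * ρ ≤ 1 := by
    rw [he, hρ, ← ENNReal.ofReal_mul (by positivity), ENNReal.ofReal_le_one]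
    rw [div_mul_eq_mul_div, div_le_one (by positivity)]; linarith
  have hθm : Measurable fun y => ‖θ ((y - z.1) / R)‖ₑ :=
    (θ.continuous.comp (by fun_prop : Continuous fun y : ℝ => (y - z.1) / R)).measurable.enorm
  have hpm : ∀ l, Measurable fun y => ‖pext (hl l) (y, τ)‖ₑ := fun l =>
    (pext_enorm_measurable (hhli l)).comp (by fun_prop : Measurable fun y : ℝ => (y, τ))
  have hsmall : ∀ l, (12 * (e * ∫⁻ y, ‖θ ((y - z.1) / R)‖ₑ * ‖pext (hl l) (y, τ)‖ₑ)) ^ p * ρ ^ 2 ≤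
      K * (ρ * Y l) := by
    intro l
    have h1 := mul_lintegral_rpow_mul_sq_le (μ := volume) hθm.aemeasurable (hpm l).aemeasurable
      hp1 hp6 heρ hρ0 hρt hA1 (by
        rw [lintegral_comp_sub_div (f := fun v => ‖θ v‖ₑ) θ.continuous.measurable.enorm hR, ← hρ]
        gcongr)
    rw [← hY] at h1
    rw [ENNReal.mul_rpow_of_nonneg _ _ hp0.le, mul_assoc, hK, mul_assoc]
    exact mul_le_mul' (twelve_rpow_le hp6) h1
  obtain ⟨u, hu⟩ : ∃ u : ℕ → ℝ → ℂ, ∀ l, u l = loc χ R z.1 τ (hl l) := ⟨_, fun _ => rfl⟩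
  have hui : ∀ l, Integrable (u l) := fun l => by
    rw [hu]; exact loc_integrable χ hR _ _ (hhli l)
  obtain ⟨g, hg⟩ : ∃ g, g = loc χ R z.1 τ h := ⟨_, rfl⟩
  have hgi : Integrable g := by rw [hg]; exact loc_integrable χ hR _ _ hh
  have hgu : g = fun ζ => ∑ i ∈ Finset.range m, u i ζ := by
    ext ζ
    rw [hg]
    simp_rw [hu]
    rw [← loc_sum χ hR _ _ _ hhli]
    congr 1; ext ξ
    simp_rw [hhl]
    exact pc_eq_sum hs hm ξ
  simp_rw [← hu, ← hg] at NP ⊢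
  -- The pieces of the localized density.
  have hT : ∀ l < m, ∃ l' ∈ nbr m l,
      ∫⁻ x, ‖pext (pc g ((l : ℝ) / m) (((l : ℝ) + 1) / m)) x‖ₑ ^ p * ENNReal.ofReal (wB z R x) ≤
        (32 * (C₁ * B ^ 5 + 16 * K) * P * ρ) * Y l' := by
    intro l hlm
    obtain ⟨l₁, hl₁, hleak⟩ := NP.exists_enorm_pext_pc_sub_le hlm
    rw [← hgu, ← he] at hleak
    have hV : ∫⁻ x, ‖pext (u l) x‖ₑ ^ p * ENNReal.ofReal (wB z R x) ≤
        C₁ * B ^ 5 * P * ρ * Y l := by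
      have h1 := H m hm0 (l / m) (u l) (hui l) (fun ζ h0 => by
        obtain ⟨h2, h3⟩ := NP.supp l ζ h0
        have h4 := NP.eps_le
        rw [mul_comm] at h4
        have h5 : (m : ℝ) * (ζ - l / m) ≤ m * (1 / m + 1 / (100 * R)) := by
          gcongr
          rw [show ((l : ℝ) + 1) / m = l / m + 1 / m by ring] at h3; linarith
        have h6 : (m : ℝ) * -(1 / (100 * R)) ≤ m * (ζ - l / m) := by
          gcongr; linarith
        rw [mul_add, mul_one_div_cancel hm0.ne'] at h5
        rw [← abs_of_pos hm0, ← abs_mul, abs_of_pos hm0, abs_le]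
        constructor <;> linarith) p hp1 hp6 z τ
      rw [← hRe, ← hP, ← hρ] at h1
      refine h1.trans ?_
      have h2 : ∫⁻ y, ‖pext (u l) (y, τ)‖ₑ ^ p ≤ B ^ 5 * Y l := by
        rw [hY, ← lintegral_const_mul' _ _ (by finiteness)]
        refine lintegral_mono fun y => ?_
        rw [hu, pext_loc_self hθ' hR _ _ (hhli l), enorm_mul,
          ENNReal.mul_rpow_of_nonneg _ _ hp0.le, ← mul_assoc]
        gcongr
        calc ‖θ ((y - z.1) / R)‖ₑ ^ p
            = ‖θ ((y - z.1) / R)‖ₑ ^ ((p - 1) + 1) := by rw [sub_add_cancel]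
          _ = ‖θ ((y - z.1) / R)‖ₑ ^ (p - 1) * ‖θ ((y - z.1) / R)‖ₑ := by
              rw [ENNReal.rpow_add_of_nonneg _ _ (by linarith) (by norm_num), ENNReal.rpow_one]
          _ ≤ B ^ (p - 1) * ‖θ ((y - z.1) / R)‖ₑ := by
              exact mul_le_mul' (ENNReal.rpow_le_rpow (hBθ _) (by linarith)) le_rfl
          _ ≤ _ := by
              gcongr
              rw [← ENNReal.rpow_natCast]
              exact ENNReal.rpow_le_rpow_of_exponent_le hB1 (by push_cast; linarith)
      calc _ ≤ C₁ * P * ρ * (B ^ 5 * Y l) := by gcongr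
        _ = _ := by ring
    have hlm' : l ∈ nbr m l := by simp [nbr, hlm]
    obtain ⟨l', hl', h1, h2⟩ : ∃ l' ∈ nbr m l, Y l ≤ Y l' ∧ Y l₁ ≤ Y l' := by
      rcases le_total (Y l) (Y l₁) with h | h
      · exact ⟨l₁, hl₁, h, le_rfl⟩
      · exact ⟨l, hlm', le_rfl, h⟩
    refine ⟨l', hl', ?_⟩
    have hpt : ∀ x, ‖pext (pc g ((l : ℝ) / m) (((l : ℝ) + 1) / m)) x‖ₑ ^ p ≤
        32 * (‖pext (u l) x‖ₑ ^ p +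
          (12 * (e * ∫⁻ y, ‖θ ((y - z.1) / R)‖ₑ * ‖pext (hl l₁) (y, τ)‖ₑ)) ^ p) := by
      intro x
      have h3 := pext_add (hui l) ((pc_integrable hgi _ _).sub (hui l)) x
        (g := fun ζ => pc g ((l : ℝ) / m) (((l : ℝ) + 1) / m) ζ - u l ζ)
      simp only [add_sub_cancel] at h3
      rw [show pext (pc g ((l : ℝ) / m) (((l : ℝ) + 1) / m)) x = _ from h3]
      refine (enorm_add_rpow_le hp1 hp6 _ _).trans ?_
      gcongr
      exact hleak x
    have hwm : Measurable fun x => ENNReal.ofReal (wB z R x) := (measurable_wB z R).ennreal_ofReal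
    obtain ⟨N, hN⟩ : ∃ N, N = (12 * (e * ∫⁻ y, ‖θ ((y - z.1) / R)‖ₑ *
      ‖pext (hl l₁) (y, τ)‖ₑ)) ^ p := ⟨_, rfl⟩
    have hNs := hsmall l₁
    rw [← hN] at hNs
    rw [← hN] at hpt
    have hw16 : ∫⁻ x, ENNReal.ofReal (wB z R x) ≤ 16 * ρ ^ 2 := by
      rw [hρ]
      exact (lintegral_mono (ofReal_wB_le z hR)).trans (lintegral_bw_mul_bw_le (by norm_num) z hR)
    calc _ ≤ ∫⁻ x, (32 * (‖pext (u l) x‖ₑ ^ p * ENNReal.ofReal (wB z R x)) +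
          32 * N * ENNReal.ofReal (wB z R x)) := by
          refine lintegral_mono fun x => ?_
          refine (mul_le_mul' (hpt x) le_rfl).trans_eq ?_
          ring
      _ = 32 * (∫⁻ x, ‖pext (u l) x‖ₑ ^ p * ENNReal.ofReal (wB z R x)) +
          32 * N * ∫⁻ x, ENNReal.ofReal (wB z R x) := by
          have h3 : Measurable fun x => ‖pext (u l) x‖ₑ ^ p * ENNReal.ofReal (wB z R x) :=
            ((pext_enorm_measurable (hui l)).pow_const p).mul hwm
          rw [lintegral_add_left (h3.const_mul 32), lintegral_const_mul _ h3,
            lintegral_const_mul _ hwm]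
      _ ≤ 32 * (C₁ * B ^ 5 * P * ρ * Y l) + 32 * N * (16 * ρ ^ 2) := by gcongr
      _ = 32 * (C₁ * B ^ 5 * P * ρ * Y l) + 32 * 16 * (N * ρ ^ 2) := by ring
      _ ≤ 32 * (C₁ * B ^ 5 * P * ρ * Y l') + 32 * 16 * (K * (ρ * Y l')) := by
          have h3 : N * ρ ^ 2 ≤ K * (ρ * Y l') := hNs.trans (by gcongr)
          exact add_le_add (by gcongr) (mul_le_mul' le_rfl h3)
      _ ≤ 32 * (C₁ * B ^ 5 * P * ρ * Y l') + 32 * 16 * (K * (ρ * Y l')) * P :=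
          add_le_add le_rfl (le_mul_of_one_le_right zero_le hP1)
      _ = _ := by ring
  have hZ := sum_rpow_nbr_le hp0 hp6 hT
  obtain ⟨Z, hZe⟩ : ∃ Z, Z = (∑ l ∈ Finset.range m, Y l ^ (2 / p)) ^ (p / 2) := ⟨_, rfl⟩
  rw [← hZe] at hZ ⊢
  obtain ⟨l₀, hl₀, hout⟩ := NP.exists_enorm_pext_sub_pc_le
  rw [← he] at hout
  have hNs := hsmall l₀
  have hpt : ∀ x, ‖pext g x‖ₑ ^ p ≤ 32 * (‖pext (pc g 0 1) x‖ₑ ^ p +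
      (12 * (e * ∫⁻ y, ‖θ ((y - z.1) / R)‖ₑ * ‖pext (hl l₀) (y, τ)‖ₑ)) ^ p) := by
    intro x
    have h3 := pext_add (pc_integrable hgi 0 1) (hgi.sub (pc_integrable hgi 0 1)) x
      (g := fun ζ => g ζ - pc g 0 1 ζ)
    simp only [add_sub_cancel] at h3
    rw [show pext g x = _ from h3]
    refine (enorm_add_rpow_le hp1 hp6 _ _).trans ?_
    gcongr
    have := hout x
    rw [← hgu] at this
    refine le_trans (le_of_eq ?_) this
    congr 2; ext ζ; rw [← congrFun hgu ζ]
  obtain ⟨N, hN⟩ : ∃ N, N = (12 * (e * ∫⁻ y, ‖θ ((y - z.1) / R)‖ₑ *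
      ‖pext (hl l₀) (y, τ)‖ₑ)) ^ p := ⟨_, rfl⟩
  rw [← hN] at hNs hpt
  have hD1 := (decIneq_iff hp0 hm hD).1 hDec g hgi.integrableOn z
  rw [← hRe] at hD1
  have hYZ : Y l₀ ≤ Z := by rw [hZe]; exact le_sum_rpow hl₀ hp0 Y
  calc _ ≤ ∫⁻ x in sqr z R, 32 * (‖pext (pc g 0 1) x‖ₑ ^ p + N) := lintegral_mono hpt
    _ = 32 * (∫⁻ x in sqr z R, ‖pext (pc g 0 1) x‖ₑ ^ p) + 32 * (N * ρ ^ 2) := by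
        rw [lintegral_const_mul' _ _ (by finiteness), lintegral_add_right _ measurable_const,
          setLIntegral_const, volume_sqr z, ← hρ]
        ring
    _ ≤ 32 * (ENNReal.ofReal D ^ p * (27 * (32 * (C₁ * B ^ 5 + 16 * K) * P * ρ) * Z)) +
        32 * (K * (ρ * Z)) := by
        have h3 : N * ρ ^ 2 ≤ K * (ρ * Z) := hNs.trans (by gcongr)
        exact add_le_add (mul_le_mul' le_rfl (hD1.trans (by gcongr))) (mul_le_mul' le_rfl h3)
    _ ≤ 32 * ((1 + ENNReal.ofReal D ^ p) * (27 * (32 * (C₁ * B ^ 5 + 16 * K) * P * ρ) * Z)) +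
        32 * (K * (ρ * Z)) * (P * (1 + ENNReal.ofReal D ^ p)) := by
        refine add_le_add (by gcongr; exact le_add_self)
          (le_mul_of_one_le_right zero_le (one_le_mul hP1 le_self_add))
    _ = _ := by ring

lemma sum_rpow_le_const_mul {ι : Type*} (s : Finset ι) {p : ℝ} (hp : 0 < p) {T Y : ι → ℝ≥0∞}
    {B : ℝ≥0∞} (h : ∀ l ∈ s, T l ≤ B * Y l) :
    (∑ l ∈ s, T l ^ (2 / p)) ^ (p / 2) ≤ B * (∑ l ∈ s, Y l ^ (2 / p)) ^ (p / 2) := by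
  have hp2 : 0 ≤ 2 / p := by positivity
  have h1 : ∑ l ∈ s, T l ^ (2 / p) ≤ B ^ (2 / p) * ∑ l ∈ s, Y l ^ (2 / p) := by
    rw [Finset.mul_sum]
    refine Finset.sum_le_sum fun l hl => ?_
    rw [← ENNReal.mul_rpow_of_nonneg _ _ hp2]
    exact ENNReal.rpow_le_rpow (h l hl) hp2
  refine (ENNReal.rpow_le_rpow h1 (by positivity)).trans_eq ?_
  rw [ENNReal.mul_rpow_of_nonneg _ _ (by positivity), ← ENNReal.rpow_mul,
    show 2 / p * (p / 2) = 1 by field_simp, ENNReal.rpow_one]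

/-- Minkowski's inequality in the form used to superpose decoupling inequalities. -/
lemma lintegral_mul_sum_rpow_le {α ι : Type*} [MeasurableSpace α] {μ : Measure α} (s : Finset ι)
    {w : α → ℝ≥0∞} {Y : ι → α → ℝ≥0∞} (hw : Measurable w) (hY : ∀ i, Measurable (Y i)) {p : ℝ}
    (hp : 2 ≤ p) :
    ∫⁻ x, w x * (∑ i ∈ s, Y i x ^ (2 / p)) ^ (p / 2) ∂μ ≤
      (∑ i ∈ s, (∫⁻ x, w x * Y i x ∂μ) ^ (2 / p)) ^ (p / 2) := by
  have hp0 : 0 < p := by linarith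
  have hp2 : 0 ≤ 2 / p := by positivity
  have h0 := lintegral_sum_rpow_le (μ := μ) s (f := fun i x => (w x * Y i x) ^ (2 / p))
    (fun i => ((hw.mul (hY i)).pow_const _).aemeasurable) (r := p / 2) (by linarith)
  have h1 : ∀ a : ℝ≥0∞, (a ^ (2 / p)) ^ (p / 2) = a := fun a => by
    rw [← ENNReal.rpow_mul, show 2 / p * (p / 2) = 1 by field_simp, ENNReal.rpow_one]
  simp_rw [h1, one_div_div] at h0
  refine le_trans (le_of_eq (lintegral_congr fun x => ?_)) h0
  simp_rw [ENNReal.mul_rpow_of_nonneg _ _ hp2]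
  rw [← Finset.mul_sum, ENNReal.mul_rpow_of_nonneg _ _ (by positivity), h1]

lemma continuous_pext_loc (χ : 𝓢(ℝ, ℂ)) {R : ℝ} (hR : 0 < R) (z : ℝ) {h : ℝ → ℂ}
    (hh : Integrable h) : Continuous fun w : ℝ × ℝ × ℝ => pext (loc χ R z w.1 h) w.2 := by
  have h0 := loc_integrand_integrable χ hR z hh
  simp_rw [fun w : ℝ × ℝ × ℝ => pext_loc χ hR z w.1 hh w.2]
  refine continuous_of_dominated (bound := fun v : ℝ × ℝ =>
    ‖R * χ (R * (v.1 - v.2)) * ec (-((v.1 - v.2) * z)) * h v.2‖) ?_ ?_ h0.norm ?_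
  · exact fun y => (integrable_mul_ec h0 (by fun_prop)).aestronglyMeasurable
  · exact fun y => Filter.Eventually.of_forall fun v => by rw [norm_mul, norm_ec, mul_one]
  · exact Filter.Eventually.of_forall fun v =>
      continuous_const.mul (continuous_ec.comp (by fun_prop))

/-- Decoupling over a square of side `m ^ 2` with a rapidly decaying weight on the right. -/
lemma exists_decoupling_fast_weight : ∃ C : ℝ≥0∞, C ≠ ∞ ∧ ∀ p : ℝ, 2 ≤ p → p ≤ 6 → ∀ m : ℕ,
    0 < m → ∀ D : ℝ, 0 ≤ D → DecIneq p m D → ∀ h : ℝ → ℂ, Integrable h →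
    (∀ ξ, h ξ ≠ 0 → 0 ≤ ξ ∧ ξ < 1) → ∀ z : ℝ × ℝ,
    ∫⁻ x in sqr z ((m : ℝ) ^ 2), ‖pext h x‖ₑ ^ p ≤ C * (1 + ENNReal.ofReal D ^ p) *
      (∑ l ∈ Finset.range m, (∫⁻ x, (bw 102 ((x.1 - z.1) / (m : ℝ) ^ 2) *
        bw 102 ((x.2 - z.2) / (m : ℝ) ^ 2)) *
        ‖pext (pc h ((l : ℝ) / m) (((l : ℝ) + 1) / m)) x‖ₑ ^ p) ^ (2 / p)) ^ (p / 2) := by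
  obtain ⟨χ, θ, c₀, hc₀, hχ, hθ, hθ', hlow⟩ := exists_window
  obtain ⟨ψ, hψ⟩ := exists_reproducing_kernel
  obtain ⟨C, hC, H⟩ := exists_window_decoupling hχ hθ hθ'
  obtain ⟨N, hN2, hNe⟩ : ∃ N : ℕ, 2 ≤ N ∧ N = 102 := ⟨102, by norm_num, rfl⟩
  obtain ⟨B, hB1, hBt, hB⟩ := θ.exists_enorm_le_bw N
  obtain ⟨A, hA1, hAt, hA⟩ := ψ.exists_enorm_le_bw (N + 6)
  obtain ⟨κ, hκ⟩ : ∃ κ, κ = ENNReal.ofReal c₀ := ⟨_, rfl⟩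
  have hκ0 : κ ≠ 0 := by rw [hκ]; simpa using hc₀
  have hκt : κ ≠ ∞ := by rw [hκ]; finiteness
  obtain ⟨M, hM1, hMt, hM⟩ : ∃ M : ℝ≥0∞, 1 ≤ M ∧ M ≠ ∞ ∧ κ⁻¹ ≤ M :=
    ⟨max 1 κ⁻¹, le_max_left _ _, by simp [hκ0], le_max_right _ _⟩
  obtain ⟨E, hE⟩ : ∃ E : ℝ≥0∞, E = M ^ 6 * (A * 4) ^ 5 * (A * 2 ^ (N + 6)) := ⟨_, rfl⟩
  have hEt : E ≠ ∞ := by rw [hE]; finiteness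
  refine ⟨E * C * B, by finiteness, ?_⟩
  intro p hp hp6 m hm D hD hDec h hh hs z
  rw [← hNe]
  have hp0 : 0 < p := by linarith
  have hp1 : 1 ≤ p := by linarith
  have hm1 : (1 : ℝ) ≤ m := by exact_mod_cast hm
  have H1 := H p hp hp6 m hm D hD hDec h hh hs z
  obtain ⟨R, hRe⟩ : ∃ R, R = (m : ℝ) ^ 2 := ⟨_, rfl⟩
  have hR1 : 1 ≤ R := by rw [hRe]; exact one_le_pow₀ hm1
  have hR : 0 < R := by linarith
  rw [← hRe] at H1 ⊢
  obtain ⟨hl, hhl⟩ : ∃ hl : ℕ → ℝ → ℂ, ∀ l, hl l = pc h ((l : ℝ) / m) (((l : ℝ) + 1) / m) :=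
    ⟨_, fun _ => rfl⟩
  have hhli : ∀ l, Integrable (hl l) := fun l => by rw [hhl]; exact pc_integrable hh _ _
  simp_rw [← hhl] at H1 ⊢
  obtain ⟨G, hG, hGm⟩ : ∃ G : ℝ × ℝ × ℝ → ℝ≥0∞, (∀ w, G w =
      ‖pext (loc χ R z.1 w.1 h) w.2‖ₑ ^ p) ∧ Measurable G :=
    ⟨_, fun _ => rfl, (continuous_pext_loc χ hR z.1 hh).measurable.enorm.pow_const p⟩
  obtain ⟨Y, hY, hYm⟩ : ∃ Y : ℕ → ℝ → ℝ≥0∞, (∀ l τ, Y l τ = ∫⁻ y, ‖θ ((y - z.1) / R)‖ₑ *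
      ‖pext (hl l) (y, τ)‖ₑ ^ p) ∧ ∀ l, Measurable (Y l) := by
    refine ⟨_, fun _ _ => rfl, fun l => ?_⟩
    have h1 : Measurable fun w : ℝ × ℝ => ‖θ ((w.2 - z.1) / R)‖ₑ * ‖pext (hl l) (w.2, w.1)‖ₑ ^ p := by
      refine ((θ.continuous.comp (by fun_prop :
        Continuous fun w : ℝ × ℝ => (w.2 - z.1) / R)).measurable.enorm).mul ?_
      exact ((pext_enorm_measurable (hhli l)).comp
        (by fun_prop : Measurable fun w : ℝ × ℝ => (w.2, w.1))).pow_const p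
    exact h1.lintegral_prod_right'
  simp_rw [← hY] at H1
  have hbN := measurable_bw N
  have hbN6 := measurable_bw (N + 6)
  have hψ4 : ∫⁻ s, ‖ψ s‖ₑ ≤ A * 4 := by
    calc _ ≤ ∫⁻ s, A * bw (N + 6) s := lintegral_mono hA
      _ = A * ∫⁻ s, bw (N + 6) s := lintegral_const_mul' _ _ hAt
      _ ≤ _ := by gcongr; exact lintegral_bw_le (by omega)
  have hpt : ∀ x ∈ sqr z R, ‖pext h x‖ₑ ^ p ≤ E * ENNReal.ofReal R⁻¹ *
      ∫⁻ τ, bw (N + 6) ((z.2 - τ) / R) * G (τ, x) := by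
    intro x hx
    simp only [sqr, Set.mem_prod, Set.mem_Icc] at hx
    have hx1 : |(x.1 - z.1) / R| ≤ 2 := by
      rw [abs_div, abs_of_pos hR, div_le_iff₀ hR, abs_le]; constructor <;> linarith
    have h1 : ‖pext h x‖ₑ ≤ M * (‖θ ((x.1 - z.1) / R)‖ₑ * ‖pext h x‖ₑ) := by
      have h2 : κ ≤ ‖θ ((x.1 - z.1) / R)‖ₑ := by
        rw [hκ, ← ofReal_norm]; exact ENNReal.ofReal_le_ofReal (hlow _ hx1)
      calc ‖pext h x‖ₑ = κ⁻¹ * κ * ‖pext h x‖ₑ := by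
            rw [ENNReal.inv_mul_cancel hκ0 hκt, one_mul]
        _ ≤ M * ‖θ ((x.1 - z.1) / R)‖ₑ * ‖pext h x‖ₑ := by gcongr
        _ = _ := by ring
    have h3 := enorm_window_mul_pext_rpow_le hψ hχ hθ' hR1 z.1 hh
      (fun ξ hξ => ⟨(hs ξ hξ).1, (hs ξ hξ).2.le⟩) hp1 x
    have h4 : ∫⁻ s, ‖ψ s‖ₑ * ‖pext (loc χ R z.1 (x.2 - R * s) h) x‖ₑ ^ p ≤
        A * 2 ^ (N + 6) * (ENNReal.ofReal R⁻¹ *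
          ∫⁻ τ, bw (N + 6) ((z.2 - τ) / R) * G (τ, x)) := by
      have h5 : Measurable fun τ => bw (N + 6) ((z.2 - τ) / R) * G (τ, x) :=
        (hbN6.comp (by fun_prop)).mul (hGm.comp (by fun_prop : Measurable fun τ : ℝ => (τ, x)))
      have h6 := lintegral_comp_mul_add h5 (neg_ne_zero.2 hR.ne') x.2
      rw [inv_neg, abs_neg, abs_of_pos (inv_pos.2 hR)] at h6
      rw [← h6, ← lintegral_const_mul' _ _ (by finiteness)]
      refine lintegral_mono fun s => ?_
      rw [← hG (x.2 - R * s, x), show -R * s + x.2 = x.2 - R * s by ring, ← mul_assoc]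
      refine mul_le_mul' ((hA s).trans ?_) le_rfl
      rw [mul_assoc]
      refine mul_le_mul' le_rfl (bw_le_of_abs_sub_le _ ?_)
      rw [show s - (z.2 - (x.2 - R * s)) / R = (x.2 - z.2) / R by field_simp; ring,
        abs_div, abs_of_pos hR, div_le_one hR, abs_le]
      constructor <;> linarith
    calc ‖pext h x‖ₑ ^ p ≤ (M * (‖θ ((x.1 - z.1) / R)‖ₑ * ‖pext h x‖ₑ)) ^ p :=
          ENNReal.rpow_le_rpow h1 hp0.le
      _ = M ^ p * (‖θ ((x.1 - z.1) / R)‖ₑ * ‖pext h x‖ₑ) ^ p :=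
          ENNReal.mul_rpow_of_nonneg _ _ hp0.le
      _ ≤ M ^ 6 * ((A * 4) ^ 5 * (A * 2 ^ (N + 6) * (ENNReal.ofReal R⁻¹ *
          ∫⁻ τ, bw (N + 6) ((z.2 - τ) / R) * G (τ, x)))) := by
          refine mul_le_mul' ?_ (h3.trans (mul_le_mul' ?_ h4))
          · rw [← ENNReal.rpow_natCast]
            exact ENNReal.rpow_le_rpow_of_exponent_le hM1 (by push_cast; linarith)
          · refine (ENNReal.rpow_le_rpow hψ4 (by linarith)).trans ?_
            rw [← ENNReal.rpow_natCast]
            exact ENNReal.rpow_le_rpow_of_exponent_le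
              (one_le_mul hA1 (by norm_num)) (by push_cast; linarith)
      _ = _ := by rw [hE]; ring
  have hGm' : Measurable fun w : (ℝ × ℝ) × ℝ => bw (N + 6) ((z.2 - w.2) / R) * G (w.2, w.1) :=
    (hbN6.comp (by fun_prop)).mul
      (hGm.comp (by fun_prop : Measurable fun w : (ℝ × ℝ) × ℝ => (w.2, w.1)))
  have hbw6 : ∀ τ : ℝ, bw (N + 6) ((z.2 - τ) / R) * ENNReal.ofReal ((1 + |z.2 - τ| / R) ^ 6) =
      bw N ((z.2 - τ) / R) := by
    intro τ
    have h0 : (0 : ℝ) ≤ |z.2 - τ| / R := by positivity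
    rw [bw_add, mul_assoc, bw, bw, ← ENNReal.ofReal_mul (by positivity), abs_div, abs_of_pos hR,
      inv_mul_cancel₀ (by positivity), ENNReal.ofReal_one, mul_one]
  have hfin : ∀ l ∈ Finset.range m, ∫⁻ τ, bw N ((z.2 - τ) / R) * Y l τ ≤
      B * ∫⁻ x, (bw N ((x.1 - z.1) / R) * bw N ((x.2 - z.2) / R)) * ‖pext (hl l) x‖ₑ ^ p := by
    intro l _
    have hm2 := (pext_enorm_measurable (hhli l)).pow_const p
    have h1 : Measurable fun x : ℝ × ℝ => (bw N ((x.1 - z.1) / R) * bw N ((x.2 - z.2) / R)) *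
        ‖pext (hl l) x‖ₑ ^ p := by
      exact (by fun_prop : Measurable fun x : ℝ × ℝ =>
        bw N ((x.1 - z.1) / R) * bw N ((x.2 - z.2) / R)).mul hm2
    rw [Measure.volume_eq_prod, lintegral_prod_symm' _ h1, ← lintegral_const_mul' _ _ hBt]
    refine lintegral_mono fun τ => ?_
    rw [hY, ← lintegral_const_mul' _ _ hBt, ← lintegral_const_mul' _ _ (bw_ne_top _ _)]
    refine lintegral_mono fun y => ?_
    calc _ ≤ bw N ((z.2 - τ) / R) * ((B * bw N ((y - z.1) / R)) * ‖pext (hl l) (y, τ)‖ₑ ^ p) :=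
          mul_le_mul' le_rfl (mul_le_mul' (hB _) le_rfl)
      _ = _ := by
          rw [show (z.2 - τ) / R = -((τ - z.2) / R) by ring, bw_neg]
          ring
  calc ∫⁻ x in sqr z R, ‖pext h x‖ₑ ^ p
      ≤ ∫⁻ x in sqr z R, E * ENNReal.ofReal R⁻¹ *
        ∫⁻ τ, bw (N + 6) ((z.2 - τ) / R) * G (τ, x) :=
        setLIntegral_mono' (measurableSet_sqr z R) hpt
    _ = E * ENNReal.ofReal R⁻¹ * ∫⁻ τ, bw (N + 6) ((z.2 - τ) / R) *
        ∫⁻ x in sqr z R, G (τ, x) := by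
        rw [lintegral_const_mul' _ _ (by finiteness), lintegral_lintegral_swap hGm'.aemeasurable]
        congr 1
        refine lintegral_congr fun τ => ?_
        rw [lintegral_const_mul' _ _ (bw_ne_top _ _)]
    _ ≤ E * ENNReal.ofReal R⁻¹ * ∫⁻ τ, C * (1 + ENNReal.ofReal D ^ p) * ENNReal.ofReal R *
        (bw N ((z.2 - τ) / R) * (∑ l ∈ Finset.range m, Y l τ ^ (2 / p)) ^ (p / 2)) := by
        refine mul_le_mul' le_rfl (lintegral_mono fun τ => ?_)
        have h1 := H1 τ
        simp_rw [hG]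
        refine (mul_le_mul' le_rfl h1).trans_eq ?_
        rw [← hbw6 τ]; ring
    _ = E * C * (1 + ENNReal.ofReal D ^ p) * (ENNReal.ofReal R⁻¹ * ENNReal.ofReal R) *
        ∫⁻ τ, bw N ((z.2 - τ) / R) * (∑ l ∈ Finset.range m, Y l τ ^ (2 / p)) ^ (p / 2) := by
        rw [lintegral_const_mul' _ _ (by finiteness)]; ring
    _ = E * C * (1 + ENNReal.ofReal D ^ p) *
        ∫⁻ τ, bw N ((z.2 - τ) / R) * (∑ l ∈ Finset.range m, Y l τ ^ (2 / p)) ^ (p / 2) := by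
        rw [← ENNReal.ofReal_mul (by positivity), inv_mul_cancel₀ hR.ne', ENNReal.ofReal_one,
          mul_one]
    _ ≤ E * C * (1 + ENNReal.ofReal D ^ p) * (B * (∑ l ∈ Finset.range m, (∫⁻ x,
        (bw N ((x.1 - z.1) / R) * bw N ((x.2 - z.2) / R)) *
          ‖pext (hl l) x‖ₑ ^ p) ^ (2 / p)) ^ (p / 2)) := by
        refine mul_le_mul' le_rfl ((lintegral_mul_sum_rpow_le _ (by fun_prop) hYm hp).trans ?_)
        exact sum_rpow_le_const_mul _ hp0 hfin
    _ = _ := by ring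

/-- Decoupling in weighted spaces, for every weight which is essentially constant at scale
`m ^ 2`. -/
lemma exists_decoupling_slow_weight : ∃ C : ℝ≥0∞, C ≠ ∞ ∧ ∀ p : ℝ, 2 ≤ p → p ≤ 6 → ∀ m : ℕ,
    0 < m → ∀ D : ℝ, 0 ≤ D → DecIneq p m D → ∀ h : ℝ → ℂ, Integrable h →
    (∀ ξ, h ξ ≠ 0 → 0 ≤ ξ ∧ ξ < 1) → ∀ (w : ℝ × ℝ → ℝ≥0∞), Measurable w → ∀ A : ℝ≥0∞, A ≠ ∞ →
    (∀ x z : ℝ × ℝ, w z * (bw 100 ((x.1 - z.1) / (m : ℝ) ^ 2) *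
      bw 100 ((x.2 - z.2) / (m : ℝ) ^ 2)) ≤ A * w x) →
    ∫⁻ x, w x * ‖pext h x‖ₑ ^ p ≤ C * A ^ 2 * (1 + ENNReal.ofReal D ^ p) *
      (∑ l ∈ Finset.range m, (∫⁻ x, w x *
        ‖pext (pc h ((l : ℝ) / m) (((l : ℝ) + 1) / m)) x‖ₑ ^ p) ^ (2 / p)) ^ (p / 2) := by
  obtain ⟨C, hC, H⟩ := exists_decoupling_fast_weight
  obtain ⟨N, hNe⟩ : ∃ N : ℕ, N = 100 := ⟨100, rfl⟩
  rw [show (102 : ℕ) = 100 + 2 by rfl] at H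
  rw [← hNe] at H ⊢
  refine ⟨4 ^ N * C * 16, by finiteness, ?_⟩
  intro p hp hp6 m hm D hD hDec h hh hs w hw A hA hPee
  have hp0 : 0 < p := by linarith
  have hm1 : (1 : ℝ) ≤ m := by exact_mod_cast hm
  have H1 := H p hp hp6 m hm D hD hDec h hh hs
  obtain ⟨R, hRe⟩ : ∃ R, R = (m : ℝ) ^ 2 := ⟨_, rfl⟩
  have hR : 0 < R := by rw [hRe]; positivity
  rw [← hRe] at H1 hPee
  obtain ⟨F, hF, hFm⟩ : ∃ F : ℝ × ℝ → ℝ≥0∞, (∀ x, F x = ‖pext h x‖ₑ ^ p) ∧ Measurable F :=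
    ⟨_, fun _ => rfl, (pext_enorm_measurable hh).pow_const p⟩
  obtain ⟨G, hG, hGm⟩ : ∃ G : ℕ → ℝ × ℝ → ℝ≥0∞, (∀ l x, G l x =
      ‖pext (pc h ((l : ℝ) / m) (((l : ℝ) + 1) / m)) x‖ₑ ^ p) ∧ ∀ l, Measurable (G l) :=
    ⟨_, fun _ _ => rfl, fun l => (pext_enorm_measurable (pc_integrable hh _ _)).pow_const p⟩
  simp_rw [← hF, ← hG] at H1 ⊢
  obtain ⟨W, hW, hWm⟩ : ∃ W : (ℝ × ℝ) × ℝ × ℝ → ℝ≥0∞, (∀ z x, W (z, x) =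
      bw (N + 2) ((x.1 - z.1) / R) * bw (N + 2) ((x.2 - z.2) / R)) ∧ Measurable W := by
    refine ⟨fun q => bw (N + 2) ((q.2.1 - q.1.1) / R) * bw (N + 2) ((q.2.2 - q.1.2) / R),
      fun _ _ => rfl, ?_⟩
    have := measurable_bw (N + 2)
    fun_prop
  simp_rw [← hW] at H1
  obtain ⟨ρ, hρ⟩ : ∃ ρ : ℝ≥0∞, ρ = ENNReal.ofReal R := ⟨_, rfl⟩
  have hρ0 : ρ ≠ 0 := by rw [hρ]; simpa using hR
  have hρt : ρ ≠ ∞ := by rw [hρ]; finiteness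
  have hmem : ∀ x z : ℝ × ℝ, x ∈ sqr z R ↔ z ∈ sqr x R := by
    intro x z
    simp only [sqr, Set.mem_prod, Set.mem_Icc]
    constructor <;> rintro ⟨⟨h1, h2⟩, h3, h4⟩ <;> exact ⟨⟨by linarith, by linarith⟩, by linarith,
      by linarith⟩
  have hlow : ∀ x, ρ ^ 2 * w x ≤ 4 ^ N * A * ∫⁻ z in sqr x R, w z := by
    intro x
    rw [hρ, ← volume_sqr x, mul_comm, ← setLIntegral_const,
      ← lintegral_const_mul' _ _ (by finiteness)]
    refine setLIntegral_mono' (measurableSet_sqr x R) fun z hz => ?_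
    simp only [sqr, Set.mem_prod, Set.mem_Icc] at hz
    have h2 : ∀ v : ℝ, |v| ≤ 1 → 1 ≤ 2 ^ N * bw N v := fun v hv => by
      have := bw_le_of_abs_sub_le N (x := 0) (y := v) (by rwa [zero_sub, abs_neg])
      rwa [bw, abs_zero, add_zero, one_pow, inv_one, ENNReal.ofReal_one] at this
    have h3 := h2 ((z.1 - x.1) / R) (by
      rw [abs_div, abs_of_pos hR, div_le_one hR, abs_le]; constructor <;> linarith)
    have h4 := h2 ((z.2 - x.2) / R) (by
      rw [abs_div, abs_of_pos hR, div_le_one hR, abs_le]; constructor <;> linarith)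
    calc w x ≤ w x * ((2 ^ N * bw N ((z.1 - x.1) / R)) * (2 ^ N * bw N ((z.2 - x.2) / R))) :=
          le_mul_of_one_le_right zero_le (one_le_mul h3 h4)
      _ = 4 ^ N * (w x * (bw N ((z.1 - x.1) / R) * bw N ((z.2 - x.2) / R))) := by
          rw [show (4 : ℝ≥0∞) ^ N = 2 ^ N * 2 ^ N by rw [← mul_pow]; norm_num]; ring
      _ ≤ 4 ^ N * (A * w z) := mul_le_mul' le_rfl (hPee z x)
      _ = _ := by ring
  have hWup : ∀ x, ∫⁻ z, w z * W (z, x) ≤ A * 16 * ρ ^ 2 * w x := by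
    intro x
    calc _ ≤ ∫⁻ z : ℝ × ℝ, A * w x * (bw 2 ((z.1 - x.1) / R) * bw 2 ((z.2 - x.2) / R)) := by
          refine lintegral_mono fun z => ?_
          rw [hW, bw_add, bw_add]
          have e : ∀ a b : ℝ, bw 2 ((b - a) / R) = bw 2 ((a - b) / R) := fun a b => by
            rw [← bw_neg]; congr 1; ring
          rw [e x.1 z.1, e x.2 z.2]
          calc _ = w z * (bw N ((x.1 - z.1) / R) * bw N ((x.2 - z.2) / R)) *
                (bw 2 ((x.1 - z.1) / R) * bw 2 ((x.2 - z.2) / R)) := by ring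
            _ ≤ _ := mul_le_mul' (hPee x z) le_rfl
      _ = A * w x * ∫⁻ z : ℝ × ℝ, (bw 2 ((z.1 - x.1) / R) * bw 2 ((z.2 - x.2) / R)) := by
          have := measurable_bw 2
          rw [lintegral_const_mul _ (by fun_prop)]
      _ ≤ A * w x * (16 * ρ ^ 2) := by
          rw [hρ]; gcongr; exact lintegral_bw_mul_bw_le le_rfl x hR
      _ = _ := by ring
  have hind : Measurable fun q : (ℝ × ℝ) × ℝ × ℝ => (sqr q.2 R).indicator w q.1 := by
    have hS : MeasurableSet {q : (ℝ × ℝ) × ℝ × ℝ | q.1 ∈ sqr q.2 R} := by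
      simp only [sqr, Set.mem_prod, Set.mem_Icc]
      have h1 : MeasurableSet {q : (ℝ × ℝ) × ℝ × ℝ | q.2.1 - R / 2 ≤ q.1.1} :=
        measurableSet_le (by fun_prop) (by fun_prop)
      have h2 : MeasurableSet {q : (ℝ × ℝ) × ℝ × ℝ | q.1.1 ≤ q.2.1 + R / 2} :=
        measurableSet_le (by fun_prop) (by fun_prop)
      have h3 : MeasurableSet {q : (ℝ × ℝ) × ℝ × ℝ | q.2.2 - R / 2 ≤ q.1.2} :=
        measurableSet_le (by fun_prop) (by fun_prop)
      have h4 : MeasurableSet {q : (ℝ × ℝ) × ℝ × ℝ | q.1.2 ≤ q.2.2 + R / 2} :=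
        measurableSet_le (by fun_prop) (by fun_prop)
      exact (h1.inter h2).inter (h3.inter h4)
    exact (hw.comp measurable_fst).indicator hS
  have hYm : ∀ l, Measurable fun z => ∫⁻ x, W (z, x) * G l x := fun l =>
    (hWm.mul ((hGm l).comp measurable_snd)).lintegral_prod_right'
  have key : ρ ^ 2 * ∫⁻ x, w x * F x ≤ 4 ^ N * A * (C * (1 + ENNReal.ofReal D ^ p) *
      (A * 16 * ρ ^ 2 * (∑ l ∈ Finset.range m, (∫⁻ x, w x * G l x) ^ (2 / p)) ^ (p / 2))) := by
    calc ρ ^ 2 * ∫⁻ x, w x * F x = ∫⁻ x, ρ ^ 2 * w x * F x := by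
          rw [← lintegral_const_mul' _ _ (by finiteness)]
          refine lintegral_congr fun x => ?_
          ring
      _ ≤ ∫⁻ x, 4 ^ N * A * ∫⁻ z, (sqr x R).indicator w z * F x := by
          refine lintegral_mono fun x => (mul_le_mul' (hlow x) le_rfl).trans_eq ?_
          rw [lintegral_mul_const _ (hw.indicator (measurableSet_sqr x R)),
            lintegral_indicator (measurableSet_sqr x R), mul_assoc]
      _ = 4 ^ N * A * ∫⁻ z, ∫⁻ x, (sqr x R).indicator w z * F x := by
          rw [lintegral_const_mul' _ _ (by finiteness), lintegral_lintegral_swap]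
          have : Measurable fun q : (ℝ × ℝ) × ℝ × ℝ => (sqr q.1 R).indicator w q.2 * F q.1 :=
            (hind.comp measurable_swap).mul (hFm.comp measurable_fst)
          exact this.aemeasurable
      _ = 4 ^ N * A * ∫⁻ z, w z * ∫⁻ x in sqr z R, F x := by
          congr 1
          refine lintegral_congr fun z => ?_
          rw [← lintegral_indicator (measurableSet_sqr z R), ← lintegral_const_mul _
            (hFm.indicator (measurableSet_sqr z R))]
          refine lintegral_congr fun x => ?_
          by_cases hx : x ∈ sqr z R
          · rw [Set.indicator_of_mem hx, Set.indicator_of_mem ((hmem x z).1 hx)]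
          · rw [Set.indicator_of_notMem hx,
              Set.indicator_of_notMem (fun h' => hx ((hmem x z).2 h'))]; simp
      _ ≤ 4 ^ N * A * ∫⁻ z, C * (1 + ENNReal.ofReal D ^ p) * (w z *
          (∑ l ∈ Finset.range m, (∫⁻ x, W (z, x) * G l x) ^ (2 / p)) ^ (p / 2)) := by
          refine mul_le_mul' le_rfl (lintegral_mono fun z => ?_)
          refine (mul_le_mul' le_rfl (H1 z)).trans_eq ?_
          ring
      _ ≤ 4 ^ N * A * (C * (1 + ENNReal.ofReal D ^ p) *
          (∑ l ∈ Finset.range m, (∫⁻ z, w z * ∫⁻ x, W (z, x) * G l x) ^ (2 / p)) ^ (p / 2)) := by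
          refine mul_le_mul' le_rfl ?_
          rw [lintegral_const_mul' _ _ (by finiteness)]
          exact mul_le_mul' le_rfl (lintegral_mul_sum_rpow_le _ hw hYm hp)
      _ ≤ _ := by
          refine mul_le_mul' le_rfl (mul_le_mul' le_rfl (sum_rpow_le_const_mul _ hp0 fun l _ => ?_))
          calc ∫⁻ z, w z * ∫⁻ x, W (z, x) * G l x
              = ∫⁻ z, ∫⁻ x, w z * W (z, x) * G l x := by
                refine lintegral_congr fun z => ?_
                have : Measurable fun x => W (z, x) * G l x :=
                  (hWm.comp measurable_prodMk_left).mul (hGm l)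
                rw [← lintegral_const_mul _ this]
                simp_rw [mul_assoc]
            _ = ∫⁻ x, ∫⁻ z, w z * W (z, x) * G l x := by
                refine lintegral_lintegral_swap ?_
                have : Measurable fun q : (ℝ × ℝ) × ℝ × ℝ => w q.1 * W (q.1, q.2) * G l q.2 :=
                  ((hw.comp measurable_fst).mul hWm).mul ((hGm l).comp measurable_snd)
                exact this.aemeasurable
            _ ≤ ∫⁻ x, A * 16 * ρ ^ 2 * (w x * G l x) := by
                refine lintegral_mono fun x => ?_
                have : Measurable fun z => w z * W (z, x) :=
                  hw.mul (hWm.comp measurable_prodMk_right)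
                rw [lintegral_mul_const _ this, ← mul_assoc]
                exact mul_le_mul' (hWup x) le_rfl
            _ = _ := lintegral_const_mul' _ _ (by finiteness)
  have hρ2 : ρ ^ 2 ≠ 0 := by positivity
  have hρ2t : ρ ^ 2 ≠ ∞ := by finiteness
  rw [← ENNReal.mul_le_mul_iff_right hρ2 hρ2t]
  refine key.trans_eq ?_
  ring

/-- The density `h` on `[a, a + 1 / s)` rescaled to the unit interval. -/
def unitize (h : ℝ → ℂ) (a s : ℝ) (t : ℝ) : ℂ := (s⁻¹ : ℝ) * h (a + s⁻¹ * t)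

lemma unitize_integrable {h : ℝ → ℂ} (hh : Integrable h) (a : ℝ) {s : ℝ} (hs : 0 < s) :
    Integrable (unitize h a s) :=
  ((hh.comp_add_left a).comp_mul_left' (inv_ne_zero hs.ne')).const_mul _

lemma pext_unitize (h : ℝ → ℂ) (a : ℝ) {s : ℝ} (hs : 0 < s) (x : ℝ × ℝ) :
    pext h x = ec (a * x.1 + a ^ 2 * x.2) *
      pext (unitize h a s) ((x.1 - (-(2 * a * x.2))) / s, x.2 / s ^ 2) := by
  have e1 : pext h x = (s⁻¹ : ℝ) * ∫ t, h (a + s⁻¹ * t) *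
      ec ((a + s⁻¹ * t) * x.1 + (a + s⁻¹ * t) ^ 2 * x.2) := by
    rw [Measure.integral_comp_mul_left (fun t => h (a + t) * ec ((a + t) * x.1 + (a + t) ^ 2 * x.2)),
      integral_add_left_eq_self (fun t => h t * ec (t * x.1 + t ^ 2 * x.2)), inv_inv, abs_of_pos hs,
      Complex.real_smul, ← mul_assoc, ← Complex.ofReal_mul, inv_mul_cancel₀ hs.ne',
      Complex.ofReal_one, one_mul, pext]
  rw [e1, pext, ← integral_const_mul, ← integral_const_mul]
  congr 1
  ext t
  rw [show (a + s⁻¹ * t) * x.1 + (a + s⁻¹ * t) ^ 2 * x.2 = (a * x.1 + a ^ 2 * x.2) +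
    (t * ((x.1 - (-(2 * a * x.2))) / s) + t ^ 2 * (x.2 / s ^ 2)) by field_simp; ring, ec_add, unitize]
  ring

lemma enorm_pext_unitize (h : ℝ → ℂ) (a : ℝ) {s : ℝ} (hs : 0 < s) (x : ℝ × ℝ) :
    ‖pext (unitize h a s) ((x.1 - (-(2 * a * x.2))) / s, x.2 / s ^ 2)‖ₑ = ‖pext h x‖ₑ := by
  rw [pext_unitize h a hs x, enorm_mul, enorm_ec, one_mul]

lemma pc_unitize (h : ℝ → ℂ) (a : ℝ) {s : ℝ} (hs : 0 < s) (u v : ℝ) :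
    pc (unitize h a s) u v = unitize (pc h (a + s⁻¹ * u) (a + s⁻¹ * v)) a s := by
  ext t
  have hi : 0 < s⁻¹ := inv_pos.2 hs
  by_cases ht : t ∈ Set.Ico u v
  · rw [unitize, pc, pc, Set.indicator_of_mem ht, Set.indicator_of_mem, unitize]
    exact ⟨by have := mul_le_mul_of_nonneg_left ht.1 hi.le; linarith,
      by have := mul_lt_mul_of_pos_left ht.2 hi; linarith⟩
  · rw [unitize, pc, pc, Set.indicator_of_notMem ht, Set.indicator_of_notMem, mul_zero]
    rintro ⟨h1, h2⟩
    exact ht ⟨le_of_mul_le_mul_left (by linarith) hi, lt_of_mul_lt_mul_left (by linarith) hi.le⟩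

lemma lintegral_shear {K : ℝ × ℝ → ℝ≥0∞} (hK : Measurable K) (a : ℝ) {s : ℝ} (hs : 0 < s) :
    ∫⁻ x : ℝ × ℝ, K ((x.1 - (-(2 * a * x.2))) / s, x.2 / s ^ 2) =
      ENNReal.ofReal (s ^ 3) * ∫⁻ y, K y := by
  have h1 : Measurable fun x : ℝ × ℝ => K ((x.1 - (-(2 * a * x.2))) / s, x.2 / s ^ 2) := by
    fun_prop
  rw [Measure.volume_eq_prod, lintegral_prod_symm' _ h1, lintegral_prod_symm' _ hK]
  have h2 : ∀ y : ℝ, ∫⁻ x : ℝ, K ((x - (-(2 * a * y))) / s, y / s ^ 2) =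
      ENNReal.ofReal s * ∫⁻ x : ℝ, K (x, y / s ^ 2) := fun y =>
    lintegral_comp_sub_div (f := fun v => K (v, y / s ^ 2)) (by fun_prop) hs _
  have h3 : Measurable fun y : ℝ => ∫⁻ x : ℝ, K (x, y) := hK.lintegral_prod_left'
  have h4 := lintegral_comp_sub_div h3 (by positivity : 0 < s ^ 2) 0
  simp only [sub_zero] at h4
  simp_rw [h2]
  rw [lintegral_const_mul' _ _ (by finiteness), h4, ← mul_assoc,
    ← ENNReal.ofReal_mul hs.le, ← pow_succ']

lemma sqrt_add_sq_le (a b c d : ℝ) :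
    √((a + b) ^ 2 + (c + d) ^ 2) ≤ √(a ^ 2 + c ^ 2) + |b| + |d| := by
  have hS := Real.sqrt_nonneg (a ^ 2 + c ^ 2)
  have h0 := Real.sq_sqrt (show 0 ≤ a ^ 2 + c ^ 2 by positivity)
  have ha : |a| ≤ √(a ^ 2 + c ^ 2) := Real.abs_le_sqrt (by nlinarith [sq_nonneg c])
  have hc : |c| ≤ √(a ^ 2 + c ^ 2) := Real.abs_le_sqrt (by nlinarith [sq_nonneg a])
  refine Real.sqrt_le_iff.2 ⟨by positivity, ?_⟩
  have h1 : a * b ≤ √(a ^ 2 + c ^ 2) * |b| := (le_abs_self _).trans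
    ((abs_mul a b).trans_le (mul_le_mul_of_nonneg_right ha (abs_nonneg b)))
  have h2 : c * d ≤ √(a ^ 2 + c ^ 2) * |d| := (le_abs_self _).trans
    ((abs_mul c d).trans_le (mul_le_mul_of_nonneg_right hc (abs_nonneg d)))
  nlinarith [sq_abs b, sq_abs d, mul_nonneg (abs_nonneg b) (abs_nonneg d)]

lemma exists_ofReal_wB_mul_bw_le : ∃ A : ℝ≥0∞, A ≠ ∞ ∧ ∀ (c : ℝ × ℝ) {R : ℝ}, 0 < R →
    ∀ (x y : ℝ × ℝ) (u v : ℝ), |y.1 - x.1| ≤ R * (|u| + 2 * |v|) → |y.2 - x.2| ≤ R * |v| →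
    ENNReal.ofReal (wB c R x) * (bw 100 u * bw 100 v) ≤ A * ENNReal.ofReal (wB c R y) := by
  obtain ⟨N, hN⟩ : ∃ N : ℕ, N = 100 := ⟨_, rfl⟩
  refine ⟨ENNReal.ofReal (3 ^ N), by finiteness, fun c R hR x y u v hu hv => ?_⟩
  rw [wB_eq, wB_eq, ← hN, bw, bw, ← ENNReal.ofReal_mul (by positivity),
    ← ENNReal.ofReal_mul (by positivity), ← ENNReal.ofReal_mul (by positivity), ← mul_inv,
    ← mul_pow, ← mul_inv, ← mul_pow]
  refine ENNReal.ofReal_le_ofReal ?_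
  rw [← div_eq_mul_inv, le_div_iff₀ (by positivity), ← div_eq_inv_mul, div_le_iff₀ (by positivity),
    ← mul_pow]
  refine pow_le_pow_left₀ (by positivity) ?_ N
  have h1 := sqrt_add_sq_le (x.1 - c.1) (y.1 - x.1) (x.2 - c.2) (y.2 - x.2)
  rw [show x.1 - c.1 + (y.1 - x.1) = y.1 - c.1 by ring,
    show x.2 - c.2 + (y.2 - x.2) = y.2 - c.2 by ring] at h1
  set S := √((x.1 - c.1) ^ 2 + (x.2 - c.2) ^ 2)
  set S' := √((y.1 - c.1) ^ 2 + (y.2 - c.2) ^ 2)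
  have hS : 0 ≤ S / R := by positivity
  have h2 : S' / R ≤ S / R + |u| + 3 * |v| := by
    rw [div_le_iff₀ hR]
    have : S / R * R = S := div_mul_cancel₀ _ hR.ne'
    nlinarith
  have := abs_nonneg u
  have := abs_nonneg v
  nlinarith [mul_nonneg (abs_nonneg u) (abs_nonneg v), mul_nonneg hS (abs_nonneg u),
    mul_nonneg hS (abs_nonneg v), mul_nonneg hS (mul_nonneg (abs_nonneg u) (abs_nonneg v))]

/-- Decoupling on an interval of length `1 / s` by parabolic rescaling, for general weights. -/
lemma exists_rescaled_decoupling_of_weight : ∃ C : ℝ≥0∞, C ≠ ∞ ∧ ∀ p : ℝ, 2 ≤ p → p ≤ 6 →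
    ∀ m : ℕ, 0 < m → ∀ σ : ℝ, 1 ≤ σ → ∀ D : ℝ, 0 ≤ D → DecIneq p m D → ∀ a : ℝ, |a| ≤ 1 →
    ∀ h : ℝ → ℂ, Integrable h → (∀ ξ, h ξ ≠ 0 → a ≤ ξ ∧ ξ < a + 1 / σ) →
    ∀ u : ℝ × ℝ → ℝ≥0∞, Measurable u → ∀ A : ℝ≥0∞, A ≠ ∞ →
    (∀ x y : ℝ × ℝ, ∀ v w : ℝ, |y.1 - x.1| ≤ (m * σ) ^ 2 * (|v| + 2 * |w|) →
      |y.2 - x.2| ≤ (m * σ) ^ 2 * |w| → u x * (bw 100 v * bw 100 w) ≤ A * u y) →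
    ∫⁻ x, u x * ‖pext h x‖ₑ ^ p ≤ C * A ^ 2 * (1 + ENNReal.ofReal D ^ p) *
      (∑ l ∈ Finset.range m, (∫⁻ x, u x * ‖pext (pc h (a + (l : ℝ) / (m * σ))
        (a + ((l : ℝ) + 1) / (m * σ))) x‖ₑ ^ p) ^ (2 / p)) ^ (p / 2) := by
  obtain ⟨C, hC, H⟩ := exists_decoupling_slow_weight
  obtain ⟨k, hk⟩ : ∃ k : ℝ → ℝ≥0∞, k = bw 100 := ⟨_, rfl⟩
  rw [← hk] at H ⊢
  refine ⟨C, hC, ?_⟩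
  intro p hp hp6 m hm σ hs1 D hD hDec a ha h hh hsupp u hum A hAt hu'
  have hp0 : 0 < p := by linarith
  have hm0 : (0 : ℝ) < m := by exact_mod_cast hm
  have hσ0 : 0 < σ := by linarith
  have hR : 0 < ((m : ℝ) * σ) ^ 2 := by positivity
  have hv := H p hp hp6 m hm D hD hDec (unitize h a σ) (unitize_integrable hh a hσ0) (by
      intro ξ hξ
      have := hsupp (a + σ⁻¹ * ξ) (right_ne_zero_of_mul hξ)
      have hi : 0 < σ⁻¹ := inv_pos.2 hσ0
      refine ⟨le_of_mul_le_mul_left (by linarith [this.1]) hi,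
        lt_of_mul_lt_mul_left (a := σ⁻¹) ?_ hi.le⟩
      have := this.2
      rw [one_div] at this
      linarith)
    (fun y => u (σ * y.1 - 2 * a * (σ ^ 2 * y.2), σ ^ 2 * y.2)) (by fun_prop) A hAt (by
      intro x z
      refine hu' _ _ _ _ ?_ ?_
      · have e : σ * x.1 - 2 * a * (σ ^ 2 * x.2) - (σ * z.1 - 2 * a * (σ ^ 2 * z.2)) =
            (m * σ) ^ 2 * (σ⁻¹ * ((x.1 - z.1) / (m : ℝ) ^ 2)) -
            (m * σ) ^ 2 * (2 * (a * ((x.2 - z.2) / (m : ℝ) ^ 2))) := by field_simp; ring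
        dsimp only
        rw [e, mul_add]
        refine (abs_sub _ _).trans (add_le_add ?_ ?_)
        · rw [abs_mul, abs_of_pos hR, abs_mul, abs_of_pos (inv_pos.2 hσ0)]
          exact mul_le_mul_of_nonneg_left (mul_le_of_le_one_left (abs_nonneg _)
            (inv_le_one_of_one_le₀ hs1)) hR.le
        · rw [abs_mul, abs_of_pos hR, abs_mul, abs_two, abs_mul]
          refine mul_le_mul_of_nonneg_left (mul_le_mul_of_nonneg_left
            (mul_le_of_le_one_left (abs_nonneg _) ha) zero_le_two) hR.le
      · have e : σ ^ 2 * x.2 - σ ^ 2 * z.2 = (m * σ) ^ 2 * ((x.2 - z.2) / (m : ℝ) ^ 2) := by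
          field_simp
        dsimp only
        rw [e, abs_mul, abs_of_pos hR])
  have key : ∀ f : ℝ → ℂ, Integrable f → ∫⁻ x, u x * ‖pext f x‖ₑ ^ p = ENNReal.ofReal (σ ^ 3) *
      ∫⁻ y : ℝ × ℝ, u (σ * y.1 - 2 * a * (σ ^ 2 * y.2), σ ^ 2 * y.2) *
        ‖pext (unitize f a σ) y‖ₑ ^ p := by
    intro f hf
    have hm1 : Measurable fun y : ℝ × ℝ => u (σ * y.1 - 2 * a * (σ ^ 2 * y.2), σ ^ 2 * y.2) *
        ‖pext (unitize f a σ) y‖ₑ ^ p := by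
      have := pext_enorm_measurable (unitize_integrable hf a hσ0)
      fun_prop
    rw [← lintegral_shear hm1 a hσ0]
    refine lintegral_congr fun x => ?_
    rw [enorm_pext_unitize f a hσ0]
    congr 2
    ext
    · simp only; field_simp; ring
    · simp only; field_simp
  have e2 : ∀ l : ℝ, a + σ⁻¹ * (l / m) = a + l / (m * σ) := fun l => by field_simp
  have hst : ENNReal.ofReal (σ ^ 3) ≠ ∞ := ENNReal.ofReal_ne_top
  have hs0 : ENNReal.ofReal (σ ^ 3) ≠ 0 := by
    rw [Ne, ENNReal.ofReal_eq_zero, not_le]; positivity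
  rw [key h hh]
  refine (mul_le_mul' le_rfl hv).trans ?_
  rw [mul_left_comm]
  refine mul_le_mul' le_rfl ?_
  rw [← ENNReal.mul_le_mul_iff_right (ENNReal.inv_ne_zero.2 hst) (ENNReal.inv_ne_top.2 hs0),
    ← mul_assoc, ENNReal.inv_mul_cancel hs0 hst, one_mul]
  refine sum_rpow_le_const_mul _ hp0 fun l _ => ?_
  rw [key _ (pc_integrable hh _ _), ← mul_assoc, ENNReal.inv_mul_cancel hs0 hst, one_mul,
    pc_unitize h a hσ0, e2, e2]

/-- Decoupling on an interval of length `1 / s` by parabolic rescaling. -/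
lemma exists_rescaled_decoupling : ∃ C : ℝ≥0∞, C ≠ ∞ ∧ ∀ p : ℝ, 2 ≤ p → p ≤ 6 → ∀ m s : ℕ,
    0 < m → 0 < s → ∀ D : ℝ, 0 ≤ D → DecIneq p m D → ∀ a : ℝ, |a| ≤ 1 → ∀ h : ℝ → ℂ, Integrable h →
    (∀ ξ, h ξ ≠ 0 → a ≤ ξ ∧ ξ < a + 1 / s) → ∀ c : ℝ × ℝ,
    ∫⁻ x, ENNReal.ofReal (wB c (((m : ℝ) * s) ^ 2) x) * ‖pext h x‖ₑ ^ p ≤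
      C * (1 + ENNReal.ofReal D ^ p) *
      (∑ l ∈ Finset.range m, (∫⁻ x, ENNReal.ofReal (wB c (((m : ℝ) * s) ^ 2) x) *
        ‖pext (pc h (a + (l : ℝ) / (m * s)) (a + ((l : ℝ) + 1) / (m * s))) x‖ₑ ^ p)
          ^ (2 / p)) ^ (p / 2) := by
  obtain ⟨C, hC, H⟩ := exists_rescaled_decoupling_of_weight
  obtain ⟨A, hAt, hA⟩ := exists_ofReal_wB_mul_bw_le
  refine ⟨C * A ^ 2, by finiteness, ?_⟩
  intro p hp hp6 m s hm hs D hD hDec a ha h hh hsupp c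
  have hm0 : (0 : ℝ) < m := by exact_mod_cast hm
  have hs1 : (1 : ℝ) ≤ s := by exact_mod_cast hs
  exact H p hp hp6 m hm s hs1 D hD hDec a ha h hh hsupp _
    (measurable_wB c (((m : ℝ) * s) ^ 2)).ennreal_ofReal A hAt
    fun x y v w h1 h2 => hA c (by positivity) x y v w h1 h2

lemma exists_one_le_mul_wB : ∃ C : ℝ≥0∞, C ≠ ∞ ∧ ∀ (c : ℝ × ℝ) {R : ℝ}, 0 < R → ∀ x ∈ sqr c R,
    1 ≤ C * ENNReal.ofReal (wB c R x) := by
  obtain ⟨A, hAt, hA⟩ := exists_ofReal_wB_mul_bw_le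
  obtain ⟨k, hk⟩ : ∃ k : ℝ≥0∞, k = bw 100 1 := ⟨_, rfl⟩
  have hk0 : k ≠ 0 := by rw [hk]; exact (bw_pos _ _).ne'
  have hkt : k ≠ ∞ := by rw [hk]; exact bw_ne_top _ _
  refine ⟨k⁻¹ * k⁻¹ * A, by finiteness, fun c R hR x hx => ?_⟩
  simp only [sqr, Set.mem_prod, Set.mem_Icc] at hx
  have h1 := hA c hR c x 1 1 (by
    rw [abs_one, abs_le]; constructor <;> linarith [hx.1.1, hx.1.2]) (by
    rw [abs_one, abs_le]; constructor <;> linarith [hx.2.1, hx.2.2])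
  rw [← hk, wB_eq] at h1
  simp only [sub_self, ne_eq, OfNat.ofNat_ne_zero, not_false_eq_true, zero_pow, add_zero,
    Real.sqrt_zero, zero_div, one_pow, inv_one, ENNReal.ofReal_one, one_mul] at h1
  calc (1 : ℝ≥0∞) = k⁻¹ * k⁻¹ * (k * k) := by
        rw [mul_mul_mul_comm, ENNReal.inv_mul_cancel hk0 hkt, one_mul]
    _ ≤ k⁻¹ * k⁻¹ * (A * ENNReal.ofReal (wB c R x)) := mul_le_mul' le_rfl h1
    _ = _ := by ring

lemma norm_ec_sub_one_le (t : ℝ) : ‖ec t - 1‖ ≤ 2 * Real.pi * |t| := by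
  have := Real.norm_exp_I_mul_ofReal_sub_one_le (x := 2 * Real.pi * t)
  rw [Real.norm_eq_abs, abs_mul, abs_of_pos Real.two_pi_pos] at this
  rw [ec]
  convert this using 4
  push_cast
  ring

lemma le_norm_pext_pc_one {ε R : ℝ} (hε : 0 < ε) (hε1 : ε ≤ 1) (hεR : 16 * (ε * R) ≤ 1)
    {x : ℝ × ℝ} (h1 : |x.1| ≤ R / 2) (h2 : |x.2| ≤ R / 2) :
    ε / 2 ≤ ‖pext (pc (fun _ => 1) 0 ε) x‖ := by
  have hR : 0 ≤ R := by linarith [abs_nonneg x.1]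
  have e : pext (pc (fun _ => 1) 0 ε) x = ∫ ξ in Set.Ico 0 ε, ec (ξ * x.1 + ξ ^ 2 * x.2) := by
    rw [pext, ← integral_indicator measurableSet_Ico]
    congr 1; ext ξ
    by_cases hξ : ξ ∈ Set.Ico 0 ε <;> simp [pc, hξ]
  have hi : IntegrableOn (fun ξ : ℝ => ec (ξ * x.1 + ξ ^ 2 * x.2)) (Set.Ico 0 ε) := by
    have : Continuous fun ξ : ℝ => ec (ξ * x.1 + ξ ^ 2 * x.2) := by
      have := continuous_ec; fun_prop
    exact (this.integrableOn_Icc (a := 0) (b := ε)).mono_set Set.Ico_subset_Icc_self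
  have hv : volume.real (Set.Ico 0 ε) = ε := by simp [hε.le]
  have h3 : ‖pext (pc (fun _ => 1) 0 ε) x - ε‖ ≤ 1 / 2 * ε := by
    have e2 : (ε : ℂ) = ∫ ξ in Set.Ico 0 ε, (1 : ℂ) := by simp [hε.le]
    rw [e, e2, ← integral_sub hi (by simp)]
    refine (norm_setIntegral_le_of_norm_le_const (C := 1 / 2) (by simp) fun ξ hξ => ?_).trans_eq
      (by rw [hv])
    refine (norm_ec_sub_one_le _).trans ?_
    have h4 : |ξ * x.1 + ξ ^ 2 * x.2| ≤ ε * R := by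
      refine (abs_add_le _ _).trans ?_
      rw [abs_mul, abs_mul, abs_pow, abs_of_nonneg hξ.1]
      have h5 : ξ * |x.1| ≤ ε * (R / 2) :=
        mul_le_mul hξ.2.le h1 (abs_nonneg _) hε.le
      have h6 : ξ ^ 2 ≤ ε := by nlinarith [hξ.1, hξ.2]
      have h7 : ξ ^ 2 * |x.2| ≤ ε * (R / 2) := mul_le_mul h6 h2 (abs_nonneg _) hε.le
      linarith
    nlinarith [Real.pi_lt_four, Real.pi_pos, abs_nonneg (ξ * x.1 + ξ ^ 2 * x.2)]
  have h8 := norm_sub_norm_le (ε : ℂ) (pext (pc (fun _ => 1) 0 ε) x)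
  rw [norm_sub_rev, Complex.norm_real, Real.norm_of_nonneg hε.le] at h8
  linarith

/-- Decoupling constants are bounded below. -/
lemma one_le_mul_of_decIneq {p : ℝ} (hp : 2 ≤ p) (hp6 : p ≤ 6) {n : ℕ} (hn : 0 < n) {D : ℝ}
    (hD : 0 ≤ D) (hDec : DecIneq p n D) : 1 ≤ 1024 * ENNReal.ofReal D ^ p := by
  have hp0 : 0 < p := by linarith
  have hn1 : (1 : ℝ) ≤ n := by exact_mod_cast hn
  have hn0 : (0 : ℝ) < n := by linarith
  obtain ⟨R, hR⟩ : ∃ R, R = (n : ℝ) ^ 2 := ⟨_, rfl⟩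
  have hR1 : 1 ≤ R := by rw [hR]; exact one_le_pow₀ hn1
  have hRn : n ≤ R := by rw [hR]; nlinarith
  have hR0 : 0 < R := by linarith
  obtain ⟨ε, hε⟩ : ∃ ε : ℝ, ε = 1 / (16 * R) := ⟨_, rfl⟩
  have hε0 : 0 < ε := by rw [hε]; positivity
  have hεR : 16 * (ε * R) = 1 := by rw [hε]; field_simp
  have hεn : ε ≤ 1 / n := by
    rw [hε]; exact one_div_le_one_div_of_le hn0 (by linarith)
  have hε1 : ε ≤ 1 := hεn.trans (by rw [div_le_one hn0]; exact hn1)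
  have hint : Integrable (pc (fun _ => (1 : ℂ)) 0 ε) := by
    rw [pc, integrable_indicator_iff measurableSet_Ico]; simp
  have hdec := (decIneq_iff hp0 hn hD).1 hDec (pc (fun _ => 1) 0 ε) hint.integrableOn 0
  have e0 : ∀ v : ℝ, ε ≤ v → pc (pc (fun _ => (1 : ℂ)) 0 ε) 0 v = pc (fun _ => 1) 0 ε := by
    intro v hv
    rw [pc, Set.indicator_eq_self]
    intro ξ hξ
    have := pc_apply_ne_zero hξ
    exact ⟨this.1, this.2.trans_le hv⟩
  have e1 : ∀ l ∈ Finset.range n, l ≠ 0 →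
      (∫⁻ x, ‖pext (pc (pc (fun _ => (1 : ℂ)) 0 ε) ((l : ℝ) / n) (((l : ℝ) + 1) / n)) x‖ₑ ^ p *
        ENNReal.ofReal (wB 0 ((n : ℝ) ^ 2) x)) ^ (2 / p) = 0 := by
    intro l _ hl0
    have h0 : pc (pc (fun _ => (1 : ℂ)) 0 ε) ((l : ℝ) / n) (((l : ℝ) + 1) / n) = 0 := by
      ext ξ
      by_contra hξ
      have h1 := pc_apply_ne_zero hξ
      have h2 := pc_apply_ne_zero (Set.indicator_apply_ne_zero.1 hξ).2
      have h3 : 1 / (n : ℝ) ≤ l / n := by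
        have : (1 : ℝ) ≤ l := by exact_mod_cast Nat.one_le_iff_ne_zero.2 hl0
        gcongr
      linarith
    rw [h0]
    simp [pext, hp0]
  rw [e0 1 hε1, Finset.sum_eq_single_of_mem 0 (Finset.mem_range.2 hn) e1, Nat.cast_zero, zero_div,
    zero_add, e0 _ hεn, ← ENNReal.rpow_mul, div_mul_div_cancel₀ hp0.ne', div_self two_ne_zero,
    ENNReal.rpow_one, ← hR] at hdec
  obtain ⟨ρ, hρ⟩ : ∃ ρ : ℝ≥0∞, ρ = ENNReal.ofReal R := ⟨_, rfl⟩
  have hρ0 : ρ ≠ 0 := by rw [hρ]; simpa using hR0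
  have hρt : ρ ≠ ∞ := by rw [hρ]; finiteness
  obtain ⟨η, hη⟩ : ∃ η : ℝ≥0∞, η = ENNReal.ofReal (ε / 2) := ⟨_, rfl⟩
  have hη0 : η ≠ 0 := by rw [hη]; simpa using hε0
  have hηt : η ≠ ∞ := by rw [hη]; finiteness
  have hlow : η ^ p * ρ ^ 2 ≤ ∫⁻ x in sqr 0 R, ‖pext (pc (fun _ => 1) 0 ε) x‖ₑ ^ p := by
    rw [hρ, ← volume_sqr 0, ← setLIntegral_const]
    refine setLIntegral_mono' (measurableSet_sqr 0 R) fun x hx => ?_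
    simp only [sqr, Set.mem_prod, Set.mem_Icc, Prod.fst_zero, Prod.snd_zero, zero_sub,
      zero_add] at hx
    refine ENNReal.rpow_le_rpow ?_ hp0.le
    rw [hη, ← ofReal_norm]
    exact ENNReal.ofReal_le_ofReal (le_norm_pext_pc_one hε0 hε1 hεR.le (abs_le.2 hx.1)
      (abs_le.2 hx.2))
  have hup : ∫⁻ x, ‖pext (pc (fun _ => 1) 0 ε) x‖ₑ ^ p * ENNReal.ofReal (wB 0 R x) ≤
      (2 * η) ^ p * (16 * ρ ^ 2) := by
    have h2η : 2 * η = ENNReal.ofReal ε := by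
      rw [hη, ← ENNReal.ofReal_ofNat, ← ENNReal.ofReal_mul zero_le_two]; congr 1; ring
    have hle : ∀ x, ‖pext (pc (fun _ => 1) 0 ε) x‖ₑ ≤ 2 * η := by
      intro x
      refine (enorm_pext_le x).trans_eq ?_
      rw [h2η]
      have : ∀ ξ : ℝ, ‖pc (fun _ => (1 : ℂ)) 0 ε ξ‖ₑ = (Set.Ico 0 ε).indicator (fun _ => 1) ξ := by
        intro ξ
        by_cases hξ : ξ ∈ Set.Ico 0 ε <;> simp [pc, hξ]
      simp_rw [this]
      rw [lintegral_indicator measurableSet_Ico]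
      simp
    calc _ ≤ ∫⁻ x : ℝ × ℝ, (2 * η) ^ p * (bw 50 ((x.1 - (0 : ℝ × ℝ).1) / R) *
          bw 50 ((x.2 - (0 : ℝ × ℝ).2) / R)) := lintegral_mono fun x =>
            mul_le_mul' (ENNReal.rpow_le_rpow (hle x) hp0.le) (ofReal_wB_le 0 hR0 x)
      _ ≤ _ := by
          rw [lintegral_const_mul' _ _ (by finiteness), hρ]
          exact mul_le_mul' le_rfl (lintegral_bw_mul_bw_le (by norm_num) 0 hR0)
  have h26 : (2 : ℝ≥0∞) ^ p ≤ 64 := by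
    calc (2 : ℝ≥0∞) ^ p ≤ 2 ^ (6 : ℝ) := ENNReal.rpow_le_rpow_of_exponent_le (by norm_num) hp6
      _ = 64 := by
        rw [show (6 : ℝ) = ((6 : ℕ) : ℝ) by norm_num, ENNReal.rpow_natCast]; norm_num
  have hfin := hlow.trans (hdec.trans (mul_le_mul' le_rfl hup))
  rw [ENNReal.mul_rpow_of_nonneg _ _ hp0.le] at hfin
  have h0 : η ^ p * ρ ^ 2 ≠ 0 := by
    have : η ^ p ≠ 0 := by simp [ENNReal.rpow_eq_zero_iff, hη0, hηt]
    positivity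
  have ht : η ^ p * ρ ^ 2 ≠ ∞ := by finiteness
  rw [← ENNReal.mul_le_mul_iff_right h0 ht, mul_one]
  refine hfin.trans ?_
  calc _ = η ^ p * ρ ^ 2 * (16 * 2 ^ p * ENNReal.ofReal D ^ p) := by ring
    _ ≤ η ^ p * ρ ^ 2 * (16 * 64 * ENNReal.ofReal D ^ p) := by gcongr
    _ = _ := by norm_num

lemma exists_decIneq {p : ℝ} (hp : 2 ≤ p) {n : ℕ} (hn : 0 < n) : ∃ D, 0 ≤ D ∧ DecIneq p n D := by
  have hp0 : 0 < p := by linarith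
  have hn0 : (n : ℝ) ≠ 0 := by exact_mod_cast hn.ne'
  obtain ⟨C, hC, H⟩ := exists_one_le_mul_wB
  have hKt : (n : ℝ≥0∞) ^ p * C ≠ ∞ := by finiteness
  refine ⟨((n : ℝ≥0∞) ^ p * C).toReal ^ (1 / p), by positivity, ?_⟩
  rw [decIneq_iff hp0 hn (by positivity)]
  intro g hg c
  rw [ENNReal.ofReal_rpow_of_nonneg (by positivity) hp0.le, ← Real.rpow_mul (by positivity),
    one_div_mul_cancel hp0.ne', Real.rpow_one, ENNReal.ofReal_toReal hKt]
  have hR : (0 : ℝ) < (n : ℝ) ^ 2 := by positivity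
  have hgi : Integrable (pc g 0 1) := by
    rw [pc, integrable_indicator_iff measurableSet_Ico]
    exact hg.mono_set Set.Ico_subset_Icc_self
  have hl : ∀ l ∈ Finset.range n, ∀ x,
      pext (pc (pc g 0 1) ((l : ℝ) / n) (((l : ℝ) + 1) / n)) x =
      pext (pc g ((l : ℝ) / n) (((l : ℝ) + 1) / n)) x := by
    intro l hl x
    rw [pc_pc (by positivity)]
    rw [div_le_one (by positivity)]
    exact_mod_cast Finset.mem_range.1 hl
  have hsum : ∀ x, ‖pext (pc g 0 1) x‖ₑ ≤ ∑ l ∈ Finset.range n,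
      ‖pext (pc (pc g 0 1) ((l : ℝ) / n) (((l : ℝ) + 1) / n)) x‖ₑ := by
    intro x
    have h1 := pext_sum (Finset.range n)
      (fun l : ℕ => pc_integrable hgi ((l : ℝ) / n) (((l : ℝ) + 1) / n)) x
    rw [← show pc g 0 1 = _ from funext fun ξ => pc_eq_sum (fun ξ h => pc_apply_ne_zero h) hn ξ]
      at h1
    rw [h1]
    exact enorm_sum_le _ _
  set S := (∑ l ∈ Finset.range n, (∫⁻ x, ‖pext (pc g ((l : ℝ) / n) (((l : ℝ) + 1) / n)) x‖ₑ ^ p *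
          ENNReal.ofReal (wB c ((n : ℝ) ^ 2) x)) ^ (2 / p)) ^ (p / 2) with hS
  calc ∫⁻ x in sqr c ((n : ℝ) ^ 2), ‖pext (pc g 0 1) x‖ₑ ^ p
      ≤ ∫⁻ x in sqr c ((n : ℝ) ^ 2), (∑ l ∈ Finset.range n,
          ‖pext (pc (pc g 0 1) ((l : ℝ) / n) (((l : ℝ) + 1) / n)) x‖ₑ) ^ p :=
        lintegral_mono fun x => ENNReal.rpow_le_rpow (hsum x) hp0.le
    _ ≤ (∑ l ∈ Finset.range n, (∫⁻ x in sqr c ((n : ℝ) ^ 2),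
          ‖pext (pc (pc g 0 1) ((l : ℝ) / n) (((l : ℝ) + 1) / n)) x‖ₑ ^ p) ^ (1 / p)) ^ p :=
        lintegral_sum_rpow_le _ (fun l => (pext_enorm_measurable
          (pc_integrable hgi _ _)).aemeasurable) (by linarith)
    _ ≤ (∑ l ∈ Finset.range n, (C * S) ^ (1 / p)) ^ p := by
        refine ENNReal.rpow_le_rpow (Finset.sum_le_sum fun l hl' =>
          ENNReal.rpow_le_rpow ?_ (by positivity)) hp0.le
        simp_rw [hl l hl']
        have h2 := le_sum_rpow hl' hp0 fun l : ℕ =>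
          ∫⁻ x, ‖pext (pc g ((l : ℝ) / n) (((l : ℝ) + 1) / n)) x‖ₑ ^ p *
          ENNReal.ofReal (wB c ((n : ℝ) ^ 2) x)
        refine le_trans ?_ (mul_le_mul' (le_refl C) h2)
        rw [← lintegral_const_mul' _ _ hC]
        refine le_trans (setLIntegral_mono' (measurableSet_sqr c _) fun x hx => ?_)
          (setLIntegral_le_lintegral _ _)
        calc _ ≤ ‖pext (pc g ((l : ℝ) / n) (((l : ℝ) + 1) / n)) x‖ₑ ^ p *
              (C * ENNReal.ofReal (wB c ((n : ℝ) ^ 2) x)) :=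
              le_mul_of_one_le_right zero_le (H c hR x hx)
          _ = _ := by ring
    _ = (n : ℝ≥0∞) ^ p * C * S := by
        rw [Finset.sum_const, Finset.card_range, nsmul_eq_mul, ENNReal.mul_rpow_of_nonneg _ _ hp0.le,
          ← ENNReal.rpow_mul, one_div_mul_cancel hp0.ne', ENNReal.rpow_one, mul_assoc]

lemma dconst_spec {p : ℝ} (hp : 2 ≤ p) {n : ℕ} (hn : 0 < n) :
    0 ≤ Dconst p n ∧ DecIneq p n (Dconst p n) := by
  have hcl : IsClosed {D : ℝ | 0 ≤ D ∧ DecIneq p n D} := by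
    refine IsSeqClosed.isClosed fun u D hu hlim => ⟨ge_of_tendsto' hlim fun k => (hu k).1,
      fun g hg c => ?_⟩
    exact ge_of_tendsto' (hlim.mul_const _) fun k => (hu k).2 g hg c
  exact hcl.csInf_mem (exists_decIneq hp hn) ⟨0, fun D hD => hD.1⟩

/-- The normalized integral `|B|⁻¹ ∫ |E h| ^ p w_B`. -/
def avgw (p : ℝ) (c : ℝ × ℝ) (R : ℝ) (h : ℝ → ℂ) : ℝ≥0∞ :=
  ENNReal.ofReal (R ^ 2)⁻¹ * ∫⁻ x, ‖pext h x‖ₑ ^ p * ENNReal.ofReal (wB c R x)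

/-- The pieces of `g` on the intervals of length `1 / L` in `[i / k, (i + 1) / k)`. -/
def pcs (g : ℝ → ℂ) (i k : ℕ) (L : ℝ) (J : ℕ) : ℝ → ℂ :=
  pc g ((i : ℝ) / k + (J : ℝ) / L) ((i : ℝ) / k + ((J : ℝ) + 1) / L)

/-- `∑_J ‖E_J g‖²_{L²_#(w̃_Δ)}` over the intervals of length `1 / L` in `[i / k, (i + 1) / k)`. -/
def locSq (g : ℝ → ℂ) (i k L : ℕ) (d : ℝ × ℝ) : ℝ≥0∞ :=
  ∑ J ∈ Finset.range (L / k), avgp 2 d L (pcs g i k L J)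

/-- `∑_J ‖E_J g‖²_{L^p_#(w_B)}` over the intervals of length `1 / n` in `[i / k, (i + 1) / k)`. -/
def globSq (p : ℝ) (g : ℝ → ℂ) (i k n : ℕ) (c : ℝ × ℝ) : ℝ≥0∞ :=
  ∑ J ∈ Finset.range (n / k), avgw p c ((n : ℝ) ^ 2) (pcs g i k n J) ^ (2 / p)

lemma shLp_nonneg {p : ℝ} {R : ℝ} {w : ℝ × ℝ → ℝ} (hw : ∀ x, 0 ≤ w x) (f : ℝ × ℝ → ℂ) :
    0 ≤ shLp p R w f :=
  Real.rpow_nonneg (mul_nonneg (by positivity) (integral_nonneg fun x =>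
    mul_nonneg (by positivity) (hw x))) _

lemma ofReal_shLp {h : ℝ → ℂ} (hh : Integrable h) {w : ℝ × ℝ → ℝ} (hw : Integrable w)
    (h0 : ∀ x, 0 ≤ w x) (R : ℝ) {p : ℝ} (hp : 0 < p) :
    ENNReal.ofReal (shLp p R w (pext h) ^ 2) = (ENNReal.ofReal (R ^ 2)⁻¹ *
      ∫⁻ x, ‖pext h x‖ₑ ^ p * ENNReal.ofReal (w x)) ^ (2 / p) := by
  rw [ENNReal.ofReal_pow (shLp_nonneg h0 _), shLp, ← ENNReal.ofReal_rpow_of_nonneg,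
    ENNReal.ofReal_mul (by positivity), ofReal_integral_pext hh hw h0 hp, sq_rpow_one_div]
  · exact mul_nonneg (by positivity) (integral_nonneg fun x => mul_nonneg (by positivity) (h0 x))
  · positivity

lemma pcs_integrable {g : ℝ → ℂ} (hg : IntegrableOn g (Set.Icc 0 1)) {i k L J : ℕ} (hk : 0 < k)
    (hi : i < k) (hL : 0 < L) (hJ : J < L / k) : Integrable (pcs g i k L J) := by
  have hk0 : (0 : ℝ) < k := by exact_mod_cast hk
  have hL0 : (0 : ℝ) < L := by exact_mod_cast hL
  rw [pcs, pc, integrable_indicator_iff measurableSet_Ico]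
  refine hg.mono_set ((Set.Ico_subset_Icc_self).trans (Set.Icc_subset_Icc (by positivity) ?_))
  have h1 : (J + 1) * k ≤ L := (Nat.le_div_iff_mul_le hk).1 hJ
  have h2 : ((J : ℝ) + 1) / L ≤ 1 / k := by
    rw [div_le_div_iff₀ hL0 hk0, one_mul]; exact_mod_cast h1
  have h3 : ((i : ℝ) + 1) / k ≤ 1 := by
    rw [div_le_one hk0]; exact_mod_cast hi
  rw [add_div] at h3
  linarith

lemma bilIneq_iff {p : ℝ} (hp : 0 < p) {n k b : ℕ} (hn : 0 < n) (hk : 0 < k) (hb : 1 ≤ b)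
    {M : ℝ} (hM : 0 ≤ M) : BilIneq p n k b M ↔
    ∀ g : ℝ → ℂ, IntegrableOn g (Set.Icc 0 1) → ∀ c : ℝ × ℝ,
    ∀ i i' : ℕ, i < k → i' < k → (i + 1 < i' ∨ i' + 1 < i) →
    ENNReal.ofReal (((n ^ 2 / k ^ b : ℕ) : ℝ) ^ 2)⁻¹ *
        ∑ a ∈ Finset.range (n ^ 2 / k ^ b), ∑ a' ∈ Finset.range (n ^ 2 / k ^ b),
          (locSq g i k (k ^ b) (subCtr c ((n : ℝ) ^ 2) ((k ^ b : ℕ) : ℝ) a a') ^ (p / 4) *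
           locSq g i' k (k ^ b) (subCtr c ((n : ℝ) ^ 2) ((k ^ b : ℕ) : ℝ) a a') ^ (p / 4)) ≤
      ENNReal.ofReal M ^ p *
        (globSq p g i k n c ^ (p / 4) * globSq p g i' k n c ^ (p / 4)) := by
  have hn0 : (0 : ℝ) < n := by exact_mod_cast hn
  have hk0 : (0 : ℝ) < k := by exact_mod_cast hk
  have hp4 : 0 ≤ p / 4 := by positivity
  have hkb : k ^ b / k = k ^ (b - 1) := by
    rw [Nat.div_eq_iff_eq_mul_left hk (dvd_pow_self k (by omega)), ← pow_succ]; congr 1; omega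
  have hloc : ∀ g : ℝ → ℂ, IntegrableOn g (Set.Icc 0 1) → ∀ i, i < k → ∀ d : ℝ × ℝ,
      ENNReal.ofReal (∑ J ∈ Finset.range (k ^ (b - 1)), shLp 2 ((k : ℝ) ^ b)
        (wtB d ((k : ℝ) ^ b)) (extOp ((i : ℝ) / (k : ℝ) + (J : ℝ) / (k : ℝ) ^ b)
          ((i : ℝ) / (k : ℝ) + ((J : ℝ) + 1) / (k : ℝ) ^ b) g) ^ 2) = locSq g i k (k ^ b) d := by
    intro g hg i hi d
    rw [ENNReal.ofReal_sum_of_nonneg fun _ _ => sq_nonneg _, locSq, hkb]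
    refine Finset.sum_congr rfl fun J hJ => ?_
    have h1 : Integrable (pcs g i k ((k ^ b : ℕ) : ℝ) J) :=
      pcs_integrable hg hk hi (by positivity) (by rw [hkb]; exact Finset.mem_range.1 hJ)
    rw [pcs, Nat.cast_pow] at h1
    rw [extOp_eq_pext, ofReal_shLp h1 (integrable_wtB d (by positivity))
      (wtB_nonneg d (by positivity)) _ two_pos, div_self two_ne_zero, ENNReal.rpow_one, avgp, pcs,
      Nat.cast_pow]
    simp_rw [ofReal_wtB d (show (0 : ℝ) < (k : ℝ) ^ b by positivity)]
  have hglob : ∀ g : ℝ → ℂ, IntegrableOn g (Set.Icc 0 1) → ∀ i, i < k → ∀ c : ℝ × ℝ,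
      ENNReal.ofReal (∑ J ∈ Finset.range (n / k), shLp p ((n : ℝ) ^ 2) (wB c ((n : ℝ) ^ 2))
        (extOp ((i : ℝ) / (k : ℝ) + (J : ℝ) / (n : ℝ))
          ((i : ℝ) / (k : ℝ) + ((J : ℝ) + 1) / (n : ℝ)) g) ^ 2) = globSq p g i k n c := by
    intro g hg i hi c
    rw [ENNReal.ofReal_sum_of_nonneg fun _ _ => sq_nonneg _, globSq]
    refine Finset.sum_congr rfl fun J hJ => ?_
    have h1 : Integrable (pcs g i k (n : ℝ) J) :=
      pcs_integrable hg hk hi hn (Finset.mem_range.1 hJ)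
    rw [extOp_eq_pext]
    exact ofReal_shLp h1 (integrable_wB c (by positivity)) (wB_nonneg c (by positivity)) _ hp
  have hs : ∀ (s : Finset ℕ) (f : ℕ → ℝ), 0 ≤ ∑ J ∈ s, f J ^ 2 := fun s f =>
    Finset.sum_nonneg fun _ _ => sq_nonneg _
  refine forall_congr' fun g => forall_congr' fun hg => forall_congr' fun c =>
    forall_congr' fun i => forall_congr' fun i' => forall_congr' fun hi => forall_congr' fun hi' =>
    forall_congr' fun _ => ?_
  have hpos : ∀ (s : Finset ℕ) (f f' : ℕ → ℝ),
      0 ≤ (∑ J ∈ s, f J ^ 2) ^ (p / 4) * (∑ J ∈ s, f' J ^ 2) ^ (p / 4) := fun s f f' =>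
    mul_nonneg (Real.rpow_nonneg (hs _ _) _) (Real.rpow_nonneg (hs _ _) _)
  rw [← ENNReal.ofReal_le_ofReal_iff (mul_nonneg (by positivity) (hpos _ _ _)),
    ENNReal.ofReal_mul (by positivity), ENNReal.ofReal_mul (by positivity),
    ENNReal.ofReal_mul (Real.rpow_nonneg (hs _ _) _), ← ENNReal.ofReal_rpow_of_nonneg hM hp.le,
    ← ENNReal.ofReal_rpow_of_nonneg (hs _ _) hp4, ← ENNReal.ofReal_rpow_of_nonneg (hs _ _) hp4,
    hglob g hg i hi, hglob g hg i' hi', ENNReal.ofReal_sum_of_nonneg fun _ _ =>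
    Finset.sum_nonneg fun _ _ => hpos _ _ _]
  have e : ∀ a ∈ Finset.range (n ^ 2 / k ^ b), ENNReal.ofReal
      (∑ a' ∈ Finset.range (n ^ 2 / k ^ b),
          ((∑ J ∈ Finset.range (k ^ (b - 1)),
              shLp 2 ((k : ℝ) ^ b)
                (wtB (subCtr c ((n : ℝ) ^ 2) ((k : ℝ) ^ b) a a') ((k : ℝ) ^ b))
                (extOp ((i : ℝ) / (k : ℝ) + (J : ℝ) / (k : ℝ) ^ b)
                  ((i : ℝ) / (k : ℝ) + ((J : ℝ) + 1) / (k : ℝ) ^ b) g) ^ 2) ^ (p / 4) *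
            (∑ J ∈ Finset.range (k ^ (b - 1)),
              shLp 2 ((k : ℝ) ^ b)
                (wtB (subCtr c ((n : ℝ) ^ 2) ((k : ℝ) ^ b) a a') ((k : ℝ) ^ b))
                (extOp ((i' : ℝ) / (k : ℝ) + (J : ℝ) / (k : ℝ) ^ b)
                  ((i' : ℝ) / (k : ℝ) + ((J : ℝ) + 1) / (k : ℝ) ^ b) g) ^ 2) ^ (p / 4))) =
      ∑ a' ∈ Finset.range (n ^ 2 / k ^ b),
          (locSq g i k (k ^ b) (subCtr c ((n : ℝ) ^ 2) ((k ^ b : ℕ) : ℝ) a a') ^ (p / 4) *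
           locSq g i' k (k ^ b) (subCtr c ((n : ℝ) ^ 2) ((k ^ b : ℕ) : ℝ) a a') ^ (p / 4)) := by
    intro a _
    rw [ENNReal.ofReal_sum_of_nonneg fun _ _ => hpos _ _ _]
    refine Finset.sum_congr rfl fun a' _ => ?_
    rw [ENNReal.ofReal_mul (Real.rpow_nonneg (hs _ _) _), ← ENNReal.ofReal_rpow_of_nonneg (hs _ _) hp4,
      ← ENNReal.ofReal_rpow_of_nonneg (hs _ _) hp4, hloc g hg i hi, hloc g hg i' hi', Nat.cast_pow]
  rw [Finset.sum_congr rfl e]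

lemma sum_range_mul_eq {M : Type*} [AddCommMonoid M] (F : ℕ → M) (A N : ℕ) :
    ∑ m ∈ Finset.range (A * N), F m =
      ∑ J ∈ Finset.range A, ∑ l ∈ Finset.range N, F (J * N + l) := by
  induction A with
  | zero => simp
  | succ A ih => rw [Nat.succ_mul, Finset.sum_range_add, ih, Finset.sum_range_succ]

lemma mul_div_eq_div_mul {k L : ℕ} (hkL : k ∣ L) (N : ℕ) : L * N / k = L / k * N := by
  rw [mul_comm, Nat.mul_div_assoc _ hkL, mul_comm]

lemma pc_pcs (g : ℝ → ℂ) (i k : ℕ) {L N : ℕ} (hL : 0 < L) (J : ℕ) {l : ℕ} (hl : l < N) :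
    pc (pcs g i k L J) ((i : ℝ) / k + (J : ℝ) / L + l * (1 / ((L : ℝ) * N)))
      ((i : ℝ) / k + (J : ℝ) / L + (l + 1) * (1 / ((L : ℝ) * N))) =
      pcs g i k ((L * N : ℕ) : ℝ) (J * N + l) := by
  have hL0 : (0 : ℝ) < L := by exact_mod_cast hL
  have hN0 : (0 : ℝ) < N := by exact_mod_cast (Nat.zero_le l).trans_lt hl
  have hl1 : (l : ℝ) + 1 ≤ N := by exact_mod_cast hl
  rw [pcs, pc_pc, pcs]
  · congr 1 <;> (push_cast; field_simp; ring)
  · have : (0 : ℝ) ≤ l * (1 / ((L : ℝ) * N)) := by positivity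
    linarith
  · have : ((l : ℝ) + 1) * (1 / ((L : ℝ) * N)) ≤ 1 / L := by
      rw [mul_one_div, div_le_div_iff₀ (by positivity) hL0]; nlinarith
    rw [add_div]; linarith

lemma pc_pcs_self (g : ℝ → ℂ) (i k : ℕ) {L : ℕ} (J : ℕ) {b : ℝ}
    (hb : b = (i : ℝ) / k + ((J : ℝ) + 1) / L) :
    pc (pcs g i k L J) ((i : ℝ) / k + (J : ℝ) / L) b = pcs g i k L J := by
  rw [hb, pcs, pc_pc le_rfl le_rfl]

/-- Local orthogonality, summed over the intervals of length `1 / L`. -/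
lemma exists_sum_avgp_le_locSq : ∃ C : ℝ≥0∞, C ≠ ∞ ∧ ∀ g : ℝ → ℂ, IntegrableOn g (Set.Icc 0 1) →
    ∀ i k L N : ℕ, 0 < k → i < k → 0 < L → 0 < N → k ∣ L → ∀ d : ℝ × ℝ,
    ∑ J ∈ Finset.range (L / k), avgp 2 d ((L * N : ℕ) : ℝ) (pcs g i k L J) ≤
      C * locSq g i k (L * N) d := by
  obtain ⟨C, hC, h⟩ := exists_local_orthogonality
  refine ⟨C, hC, fun g hg i k L N hk hi hL hN hkL d => ?_⟩
  rw [locSq, mul_div_eq_div_mul hkL, sum_range_mul_eq, Finset.mul_sum]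
  refine Finset.sum_le_sum fun J hJ => ?_
  have hL0 : (0 : ℝ) < L := by exact_mod_cast hL
  have hN0 : (0 : ℝ) < N := by exact_mod_cast hN
  have h1 := h ((L : ℝ) * N) (by positivity) ((i : ℝ) / k + (J : ℝ) / L) N (pcs g i k L J)
    (pcs_integrable hg hk hi hL (Finset.mem_range.1 hJ)) d
  rw [pc_pcs_self] at h1
  swap
  · field_simp
    ring
  rw [Finset.sum_congr rfl fun l hl => by rw [pc_pcs g i k hL J (Finset.mem_range.1 hl)]] at h1
  simp only [avgp, ENNReal.rpow_two, Nat.cast_mul] at h1 ⊢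
  calc _ ≤ _ := mul_le_mul' le_rfl h1
    _ = _ := by rw [← Finset.mul_sum]; ring

lemma sum_bw_cover_le {K : ℕ} (hK : 2 ≤ K) : ∃ C : ℝ≥0∞, C ≠ ∞ ∧ ∀ (N : ℕ) (v X : ℝ), 0 < N →
    v = N * X + N / 2 - 1 / 2 → ∑ i ∈ Finset.range N, bw K (v - i) ≤ C * bw K X := by
  refine ⟨4 ^ K * 1000, by finiteness, fun N v X hN hv => ?_⟩
  have hN1 : (1 : ℝ) ≤ N := by exact_mod_cast hN
  have hN0 : (0 : ℝ) < N := by linarith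
  rcases le_or_gt |X| 1 with hX | hX
  · have h1 : (1 : ℝ≥0∞) ≤ 4 ^ K * bw K X := by
      have := bw_le_of_abs_le K (A := 4) (v := 0) (w := X) (by norm_num) (by
        rw [abs_zero]; linarith)
      rwa [show bw K 0 = 1 by simp [bw], ENNReal.ofReal_pow (by norm_num),
        ENNReal.ofReal_ofNat] at this
    calc ∑ i ∈ Finset.range N, bw K (v - i) ≤ ∑ i ∈ Finset.range N, bw 2 (v - i) :=
          Finset.sum_le_sum fun i _ => bw_anti hK _
      _ ≤ 1000 := (sum_bw_two_nat_le v N).trans (by norm_num)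
      _ = 1000 * 1 := (mul_one _).symm
      _ ≤ 1000 * (4 ^ K * bw K X) := mul_le_mul' le_rfl h1
      _ = _ := by ring
  · have h1 : ∀ i ∈ Finset.range N, bw K (v - i) ≤ ENNReal.ofReal ((4 / N) ^ K) * bw K X := by
      intro i hi
      have hi' : (i : ℝ) + 1 ≤ N := by exact_mod_cast Finset.mem_range.1 hi
      have hi0 : (0 : ℝ) ≤ i := by positivity
      refine bw_le_of_abs_le K (by positivity) ?_
      rw [div_mul_eq_mul_div, le_div_iff₀ hN0]
      have h2 : (N : ℝ) * |X| - N / 2 ≤ |v - i| := by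
        rcases abs_cases X with ⟨h, _⟩ | ⟨h, _⟩ <;> rw [h]
        · exact le_trans (by rw [hv]; linarith) (le_abs_self _)
        · exact le_trans (by rw [hv]; linarith) (neg_le_abs _)
      nlinarith
    refine (Finset.sum_le_sum h1).trans ?_
    rw [Finset.sum_const, Finset.card_range, nsmul_eq_mul, ← mul_assoc]
    refine mul_le_mul' ?_ le_rfl
    have h3 : (N : ℝ) * (4 / N) ^ K ≤ 4 ^ K := by
      rw [div_pow, mul_div_assoc', div_le_iff₀ (by positivity), mul_comm]
      exact mul_le_mul_of_nonneg_left (le_self_pow₀ hN1 (by omega)) (by positivity)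
    calc (N : ℝ≥0∞) * ENNReal.ofReal ((4 / N) ^ K) = ENNReal.ofReal (N * (4 / N) ^ K) := by
          rw [ENNReal.ofReal_mul hN0.le, ENNReal.ofReal_natCast]
      _ ≤ ENNReal.ofReal (4 ^ K) := ENNReal.ofReal_le_ofReal h3
      _ = 4 ^ K := by rw [ENNReal.ofReal_pow (by norm_num)]; norm_num
      _ ≤ 4 ^ K * 1000 := le_mul_of_one_le_right (by positivity) (by norm_num)

lemma exists_sum_wt_le_wB : ∃ C : ℝ≥0∞, C ≠ ∞ ∧ ∀ (N : ℕ) (L : ℝ) (c x : ℝ × ℝ), 0 < N → 0 < L →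
    ∑ i ∈ Finset.range N, ∑ j ∈ Finset.range N, wt (subCtr c (N * L) L i j) L x ≤
      C * ENNReal.ofReal (wB c (N * L) x) := by
  obtain ⟨C, hC, h⟩ := sum_bw_cover_le (K := 100) (by norm_num)
  refine ⟨C * C, by finiteness, fun N L c x hN hL => ?_⟩
  have hN0 : (0 : ℝ) < N := by exact_mod_cast hN
  have h1 : ∀ s t : ℝ, ∑ i ∈ Finset.range N, bw 100 ((t - (s - N * L / 2 + (i + 1 / 2) * L)) / L) ≤
      C * bw 100 ((t - s) / (N * L)) := by
    intro s t
    refine le_trans (le_of_eq ?_) (h N ((t - s) / L + N / 2 - 1 / 2) _ hN (by field_simp))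
    refine Finset.sum_congr rfl fun i _ => ?_
    congr 1; field_simp; ring
  calc ∑ i ∈ Finset.range N, ∑ j ∈ Finset.range N, wt (subCtr c (N * L) L i j) L x
      = (∑ i ∈ Finset.range N, bw 100 ((x.1 - (c.1 - N * L / 2 + (i + 1 / 2) * L)) / L)) *
        ∑ j ∈ Finset.range N, bw 100 ((x.2 - (c.2 - N * L / 2 + (j + 1 / 2) * L)) / L) := by
        rw [Finset.sum_mul_sum]; rfl
    _ ≤ C * bw 100 ((x.1 - c.1) / (N * L)) * (C * bw 100 ((x.2 - c.2) / (N * L))) :=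
        mul_le_mul' (h1 _ _) (h1 _ _)
    _ = C * C * wt c (N * L) x := by rw [wt]; ring
    _ ≤ _ := mul_le_mul' le_rfl (wt_le_ofReal_wB c (by positivity) x)

lemma pcs_eq_sum (g : ℝ → ℂ) (i k : ℕ) {L N : ℕ} (hL : 0 < L) (hN : 0 < N) (J : ℕ) (ξ : ℝ) :
    pcs g i k L J ξ = ∑ l ∈ Finset.range N, pcs g i k ((L * N : ℕ) : ℝ) (J * N + l) ξ := by
  have hL0 : (0 : ℝ) < L := by exact_mod_cast hL
  have hN0 : (0 : ℝ) < N := by exact_mod_cast hN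
  have h := pc_sum (pcs g i k L J) ((i : ℝ) / k + (J : ℝ) / L) (t := 1 / ((L : ℝ) * N))
    (by positivity) N ξ
  rw [pc_pcs_self g i k J (by field_simp; ring)] at h
  rw [h]
  exact Finset.sum_congr rfl fun l hl => by rw [pc_pcs g i k hL J (Finset.mem_range.1 hl)]

lemma index_lt {A N J l : ℕ} (hJ : J < A) (hl : l < N) : J * N + l < A * N := by
  calc J * N + l < J * N + N := by omega
    _ = (J + 1) * N := by ring
    _ ≤ A * N := Nat.mul_le_mul_right _ hJ

lemma enorm_pext_pcs_rpow_le {g : ℝ → ℂ} (hg : IntegrableOn g (Set.Icc 0 1)) {i k L N J : ℕ}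
    (hk : 0 < k) (hi : i < k) (hL : 0 < L) (hN : 0 < N) (hkL : k ∣ L) (hJ : J < L / k)
    {p : ℝ} (hp : 1 ≤ p) (x : ℝ × ℝ) :
    ‖pext (pcs g i k L J) x‖ₑ ^ p ≤ (N : ℝ≥0∞) ^ (p - 1) *
      ∑ l ∈ Finset.range N, ‖pext (pcs g i k ((L * N : ℕ) : ℝ) (J * N + l)) x‖ₑ ^ p := by
  have h0 : ∀ l ∈ Finset.range N, Integrable (pcs g i k ((L * N : ℕ) : ℝ) (J * N + l)) := fun l hl =>
    pcs_integrable hg hk hi (by positivity) (by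
      rw [mul_div_eq_div_mul hkL]; exact index_lt hJ (Finset.mem_range.1 hl))
  have h1 : pext (pcs g i k L J) x =
      ∑ l ∈ Finset.range N, pext (pcs g i k ((L * N : ℕ) : ℝ) (J * N + l)) x := by
    rw [show pcs g i k L J = _ from funext (pcs_eq_sum g i k hL hN J)]
    simp only [pext, Finset.sum_mul]
    exact integral_finsetSum _ fun l hl => integrable_mul_ec (h0 l hl) (by fun_prop)
  rw [h1]
  refine (ENNReal.rpow_le_rpow (enorm_sum_le _ _) (by linarith)).trans ?_
  refine (ENNReal.rpow_sum_le_const_mul_sum_rpow _ _ hp).trans ?_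
  rw [Finset.card_range]

lemma exists_locSq_le {p : ℝ} (hp : 2 ≤ p) (hp6 : p ≤ 6) {n k L : ℕ} (hn : 0 < n) (hk : 0 < k)
    (hkL : k ∣ L) (hLn : L ∣ n) : ∃ K : ℝ≥0∞, K ≠ ∞ ∧
    ∀ g : ℝ → ℂ, IntegrableOn g (Set.Icc 0 1) → ∀ c : ℝ × ℝ, ∀ i, i < k →
    ∀ a ∈ Finset.range (n ^ 2 / L), ∀ a' ∈ Finset.range (n ^ 2 / L),
      locSq g i k L (subCtr c ((n : ℝ) ^ 2) L a a') ≤ K * globSq p g i k n c := by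
  obtain ⟨C, hC, hcov⟩ := exists_sum_wt_le_wB
  obtain ⟨N, rfl⟩ := hLn
  have hL : 0 < L := Nat.pos_of_mul_pos_right hn
  have hN : 0 < N := Nat.pos_of_mul_pos_left hn
  have hL0 : (0 : ℝ) < L := by exact_mod_cast hL
  have hN0 : (0 : ℝ) < N := by exact_mod_cast hN
  have hR : ((L * N) ^ 2 / L : ℕ) = L * N ^ 2 := by
    rw [mul_pow, pow_two L, mul_assoc L L]; exact Nat.mul_div_cancel_left _ hL
  have hR' : ((L * N ^ 2 : ℕ) : ℝ) * L = ((L * N : ℕ) : ℝ) ^ 2 := by push_cast; ring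
  rw [hR]
  set R : ℝ := ((L * N : ℕ) : ℝ) ^ 2 with hRdef
  have hR0 : 0 < R := by positivity
  set V : ℝ≥0∞ := 256 * (ENNReal.ofReal ((L : ℝ) ^ 2)⁻¹ * ((N : ℝ≥0∞) ^ (p - 1) * (N * (C *
      ENNReal.ofReal (R ^ 2))))) with hV
  have hVt : V ≠ ∞ := by
    have : (N : ℝ≥0∞) ^ (p - 1) ≠ ∞ := ENNReal.rpow_ne_top_of_nonneg (by linarith) (by finiteness)
    finiteness
  refine ⟨(L / k : ℕ) * V ^ (2 / p), ?_, fun g hg c i hi a ha a' ha' => ?_⟩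
  · have : V ^ (2 / p) ≠ ∞ := ENNReal.rpow_ne_top_of_nonneg (by positivity) hVt
    finiteness
  have key : ∀ J ∈ Finset.range (L / k), avgp 2 (subCtr c R L a a') L (pcs g i k L J) ≤
      V ^ (2 / p) * globSq p g i k (L * N) c := by
    intro J hJ
    have hJ' := Finset.mem_range.1 hJ
    have hint := pcs_integrable hg hk hi hL hJ'
    have hw : ∀ x, wt (subCtr c R L a a') L x ≤ C * ENNReal.ofReal (wB c R x) := fun x => by
      have h := hcov (L * N ^ 2) L c x (by positivity) hL0
      rw [hR'] at h
      refine le_trans ?_ h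
      refine le_trans ?_ (Finset.single_le_sum (fun _ _ => zero_le) ha)
      exact Finset.single_le_sum (f := fun j => wt (subCtr c R L a j) L x)
        (fun _ _ => zero_le) ha'
    have hl : ∀ l ∈ Finset.range N, ∫⁻ x, ‖pext (pcs g i k ((L * N : ℕ) : ℝ) (J * N + l)) x‖ₑ ^ p *
        ENNReal.ofReal (wB c R x) ≤ ENNReal.ofReal (R ^ 2) * globSq p g i k (L * N) c ^ (p / 2) := by
      intro l hl
      have hm : J * N + l ∈ Finset.range (L * N / k) := by
        rw [Finset.mem_range, mul_div_eq_div_mul hkL]; exact index_lt hJ' (Finset.mem_range.1 hl)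
      have h1 : avgw p c R (pcs g i k ((L * N : ℕ) : ℝ) (J * N + l)) ≤
          globSq p g i k (L * N) c ^ (p / 2) := le_sum_rpow hm (by linarith) fun m =>
        avgw p c R (pcs g i k ((L * N : ℕ) : ℝ) m)
      refine le_trans (le_of_eq ?_) (mul_le_mul' le_rfl h1)
      rw [avgw, ← mul_assoc, ← ENNReal.ofReal_mul (by positivity),
        mul_inv_cancel₀ (by positivity), ENNReal.ofReal_one, one_mul]
    have h2 : avgp 2 (subCtr c R L a a') L (pcs g i k L J) ^ (p / 2) ≤
        V * globSq p g i k (L * N) c ^ (p / 2) := by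
      refine (avgp_two_rpow_le hint hp hp6 _ hL0).trans ?_
      rw [hV, mul_assoc, avgp, mul_assoc]
      refine mul_le_mul' le_rfl (mul_le_mul' le_rfl ?_)
      have hmeas : ∀ l ∈ Finset.range N, Measurable fun x =>
          ‖pext (pcs g i k ((L * N : ℕ) : ℝ) (J * N + l)) x‖ₑ ^ p * ENNReal.ofReal (wB c R x) :=
        fun l hl => ((pext_enorm_measurable (pcs_integrable hg hk hi hn (by
          rw [mul_div_eq_div_mul hkL]; exact index_lt hJ' (Finset.mem_range.1 hl)))).pow_const p).mul
          (measurable_wB c R).ennreal_ofReal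
      calc ∫⁻ x, ‖pext (pcs g i k L J) x‖ₑ ^ p * wt (subCtr c R L a a') L x
          ≤ ∫⁻ x, (N : ℝ≥0∞) ^ (p - 1) * C * ∑ l ∈ Finset.range N,
            ‖pext (pcs g i k ((L * N : ℕ) : ℝ) (J * N + l)) x‖ₑ ^ p * ENNReal.ofReal (wB c R x) := by
            refine lintegral_mono fun x => ?_
            refine (mul_le_mul' (enorm_pext_pcs_rpow_le hg hk hi hL hN hkL hJ' (by linarith) x)
              (hw x)).trans_eq ?_
            rw [← Finset.sum_mul]; ring
        _ = (N : ℝ≥0∞) ^ (p - 1) * C * ∑ l ∈ Finset.range N, ∫⁻ x,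
            ‖pext (pcs g i k ((L * N : ℕ) : ℝ) (J * N + l)) x‖ₑ ^ p * ENNReal.ofReal (wB c R x) := by
            rw [lintegral_const_mul _ (Finset.measurable_sum _ hmeas), lintegral_finsetSum' _ fun l hl =>
              (hmeas l hl).aemeasurable]
        _ ≤ (N : ℝ≥0∞) ^ (p - 1) * C * ∑ l ∈ Finset.range N,
            ENNReal.ofReal (R ^ 2) * globSq p g i k (L * N) c ^ (p / 2) :=
            mul_le_mul' le_rfl (Finset.sum_le_sum hl)
        _ = _ := by rw [Finset.sum_const, Finset.card_range, nsmul_eq_mul]; ring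
    have h3 := ENNReal.rpow_le_rpow h2 (show 0 ≤ 2 / p by positivity)
    have e : p / 2 * (2 / p) = 1 := by field_simp
    rwa [ENNReal.mul_rpow_of_nonneg _ _ (by positivity), ← ENNReal.rpow_mul, ← ENNReal.rpow_mul, e,
      ENNReal.rpow_one, ENNReal.rpow_one] at h3
  refine (Finset.sum_le_sum key).trans_eq ?_
  rw [Finset.sum_const, Finset.card_range, nsmul_eq_mul, mul_assoc]

lemma exists_bilIneq {p : ℝ} (hp : 2 ≤ p) (hp6 : p ≤ 6) {n k b : ℕ} (hn : 0 < n) (hk : 0 < k)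
    (hb : 1 ≤ b) (hkn : k ^ b ∣ n) : {M : ℝ | 0 ≤ M ∧ BilIneq p n k b M}.Nonempty := by
  obtain ⟨K, hK, h⟩ := exists_locSq_le hp hp6 hn hk (dvd_pow_self k (by omega)) hkn
  set S : ℕ := n ^ 2 / k ^ b
  set W : ℝ≥0∞ := ENNReal.ofReal ((S : ℝ) ^ 2)⁻¹ * (S * (S * (K ^ (p / 4) * K ^ (p / 4)))) with hW
  have hWt : W ≠ ∞ := by
    have : K ^ (p / 4) ≠ ∞ := ENNReal.rpow_ne_top_of_nonneg (by positivity) hK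
    finiteness
  refine ⟨W.toReal ^ (1 / p), by positivity, (bilIneq_iff (by linarith) hn hk hb
    (by positivity)).2 fun g hg c i i' hi hi' _ => ?_⟩
  have e : ENNReal.ofReal (W.toReal ^ (1 / p)) ^ p = W := by
    rw [← ENNReal.ofReal_rpow_of_nonneg (by positivity) (by positivity), ENNReal.ofReal_toReal hWt,
      ← ENNReal.rpow_mul, one_div_mul_cancel (by linarith), ENNReal.rpow_one]
  rw [e]
  have hmul : ∀ x y : ℝ≥0∞, (x * y) ^ (p / 4) = x ^ (p / 4) * y ^ (p / 4) := fun x y =>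
    ENNReal.mul_rpow_of_nonneg _ _ (by positivity)
  calc _ ≤ ENNReal.ofReal ((S : ℝ) ^ 2)⁻¹ * ∑ a ∈ Finset.range S, ∑ a' ∈ Finset.range S,
        ((K * globSq p g i k n c) ^ (p / 4) * (K * globSq p g i' k n c) ^ (p / 4)) := by
        refine mul_le_mul' le_rfl (Finset.sum_le_sum fun a ha => Finset.sum_le_sum fun a' ha' =>
          mul_le_mul' (ENNReal.rpow_le_rpow ?_ (by positivity))
            (ENNReal.rpow_le_rpow ?_ (by positivity)))
        · exact h g hg c i hi a ha a' ha'
        · exact h g hg c i' hi' a ha a' ha'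
    _ = _ := by
      simp only [Finset.sum_const, Finset.card_range, nsmul_eq_mul]
      rw [hmul, hmul, hW]; ring

lemma mconst_spec {p : ℝ} (hp : 2 ≤ p) (hp6 : p ≤ 6) {n k b : ℕ} (hn : 0 < n) (hk : 0 < k)
    (hb : 1 ≤ b) (hkn : k ^ b ∣ n) : 0 ≤ Mconst p n k b ∧ BilIneq p n k b (Mconst p n k b) := by
  have hcl : IsClosed {M : ℝ | 0 ≤ M ∧ BilIneq p n k b M} := by
    refine IsSeqClosed.isClosed fun u M hu hlim => ⟨ge_of_tendsto' hlim fun k => (hu k).1,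
      fun g hg c i i' hi hi' hii => ?_⟩
    have hl := hlim.rpow_const (p := p) (Or.inr (by linarith))
    exact ge_of_tendsto' (hl.mul_const _) fun j => (hu j).2 g hg c i i' hi hi' hii
  exact hcl.csInf_mem (exists_bilIneq hp hp6 hn hk hb hkn) ⟨0, fun M hM => hM.1⟩

lemma mconst_le {p : ℝ} {n k b : ℕ} {M : ℝ} (hM : 0 ≤ M) (h : BilIneq p n k b M) :
    Mconst p n k b ≤ M :=
  csInf_le ⟨0, fun _ hD => hD.1⟩ ⟨hM, h⟩

lemma sum_sum_mul_rpow_le {ι κ σ : Type*} (s : Finset ι) (s' : Finset κ) (t : Finset σ)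
    (f : ι → σ → ℝ≥0∞) (f' : κ → σ → ℝ≥0∞) {r : ℝ} (hr : 1 ≤ r) {A : ℝ≥0∞} (u : ι → ℝ≥0∞)
    (u' : κ → ℝ≥0∞)
    (h : ∀ i ∈ s, ∀ j ∈ s', ∑ x ∈ t, f i x ^ r * f' j x ^ r ≤ A * (u i * u' j)) :
    ∑ x ∈ t, (∑ i ∈ s, f i x) ^ r * (∑ j ∈ s', f' j x) ^ r ≤
      A * ((∑ i ∈ s, u i ^ (1 / r)) ^ r * (∑ j ∈ s', u' j ^ (1 / r)) ^ r) := by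
  have hr0 : 0 < r := by linarith
  have hm : ∀ x y : ℝ≥0∞, (x * y) ^ r = x ^ r * y ^ r := fun x y =>
    ENNReal.mul_rpow_of_nonneg _ _ hr0.le
  have hm' : ∀ x y : ℝ≥0∞, (x * y) ^ (1 / r) = x ^ (1 / r) * y ^ (1 / r) := fun x y =>
    ENNReal.mul_rpow_of_nonneg _ _ (by positivity)
  calc ∑ x ∈ t, (∑ i ∈ s, f i x) ^ r * (∑ j ∈ s', f' j x) ^ r
      = ∑ x ∈ t, (∑ z ∈ s ×ˢ s', f z.1 x * f' z.2 x) ^ r := by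
        refine Finset.sum_congr rfl fun x _ => ?_
        rw [← hm, Finset.sum_mul_sum, Finset.sum_product]
    _ ≤ (∑ z ∈ s ×ˢ s', (∑ x ∈ t, (f z.1 x * f' z.2 x) ^ r) ^ (1 / r)) ^ r :=
        sum_sum_rpow_le t (s ×ˢ s') (fun z x => f z.1 x * f' z.2 x) hr
    _ ≤ (∑ z ∈ s ×ˢ s', (A * (u z.1 * u' z.2)) ^ (1 / r)) ^ r := by
        refine ENNReal.rpow_le_rpow (Finset.sum_le_sum fun z hz => ?_) hr0.le
        refine ENNReal.rpow_le_rpow ?_ (by positivity)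
        simp_rw [hm]
        exact h _ (Finset.mem_product.1 hz).1 _ (Finset.mem_product.1 hz).2
    _ = (A ^ (1 / r) * ((∑ i ∈ s, u i ^ (1 / r)) * ∑ j ∈ s', u' j ^ (1 / r))) ^ r := by
        simp_rw [hm']
        rw [← Finset.mul_sum, Finset.sum_mul_sum, Finset.sum_product]
    _ = _ := by
        rw [hm, hm, ← ENNReal.rpow_mul, one_div_mul_cancel hr0.ne', ENNReal.rpow_one]

lemma pcs_ne_zero {g : ℝ → ℂ} {i k J : ℕ} {L : ℝ} {ξ : ℝ} (h : pcs g i k L J ξ ≠ 0) :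
    (i : ℝ) / k + (J : ℝ) / L ≤ ξ ∧ ξ < (i : ℝ) / k + (J : ℝ) / L + 1 / L := by
  have := pc_apply_ne_zero h
  rwa [add_div, ← add_assoc] at this

lemma pcs_endpoint {i k L J : ℕ} (hk : 0 < k) (hL : 0 < L) (hJ : J < L / k) :
    (i : ℝ) / k ≤ (i : ℝ) / k + (J : ℝ) / L ∧ (i : ℝ) / k + (J : ℝ) / L < ((i : ℝ) + 1) / k := by
  have hk0 : (0 : ℝ) < k := by exact_mod_cast hk
  have hL0 : (0 : ℝ) < L := by exact_mod_cast hL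
  have h1 : (J + 1) * k ≤ L := (Nat.le_div_iff_mul_le hk).1 hJ
  have h2 : ((J : ℝ) + 1) / L ≤ 1 / k := by
    rw [div_le_div_iff₀ hL0 hk0, one_mul]; exact_mod_cast h1
  have h3 : (0 : ℝ) ≤ (J : ℝ) / L := by positivity
  have h4 : (0 : ℝ) < 1 / L := by positivity
  rw [add_div] at h2 ⊢
  constructor <;> linarith

/-- Ball inflation for the product of the local square functions. -/
lemma exists_locSq_inflation : ∃ C : ℝ≥0∞, C ≠ ∞ ∧ ∀ p : ℝ, 4 ≤ p → p ≤ 6 →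
    ∀ g : ℝ → ℂ, IntegrableOn g (Set.Icc 0 1) → ∀ i i' k L : ℕ, i < k → i' < k →
    (i + 1 < i' ∨ i' + 1 < i) → 0 < L → ∀ d : ℝ × ℝ,
    ∑ x ∈ Finset.range L, ∑ y ∈ Finset.range L,
      locSq g i k L (subCtr d ((L : ℝ) ^ 2) L x y) ^ (p / 4) *
        locSq g i' k L (subCtr d ((L : ℝ) ^ 2) L x y) ^ (p / 4) ≤
      C * ENNReal.ofReal k * ENNReal.ofReal ((L : ℝ) ^ 2) *
        ((∑ J ∈ Finset.range (L / k),
            avgp (p / 2) d ((L : ℝ) ^ 2) (pcs g i k L J) ^ (1 / (p / 4))) ^ (p / 4) *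
          (∑ J ∈ Finset.range (L / k),
            avgp (p / 2) d ((L : ℝ) ^ 2) (pcs g i' k L J) ^ (1 / (p / 4))) ^ (p / 4)) := by
  obtain ⟨C, hC, H⟩ := exists_ball_inflation_pair
  refine ⟨C, hC, fun p hp4 hp6 g hg i i' k L hi hi' hii hL d => ?_⟩
  have hk : 0 < k := by omega
  have hk0 : (0 : ℝ) < k := by exact_mod_cast hk
  obtain ⟨F, hF⟩ : ∃ F : ℕ → ℕ → ℕ × ℕ → ℝ≥0∞, ∀ i J z, F i J z =
    avgp 2 (subCtr d ((L : ℝ) ^ 2) L z.1 z.2) L (pcs g i k L J) := ⟨_, fun _ _ _ => rfl⟩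
  obtain ⟨U, hU⟩ : ∃ U : ℕ → ℕ → ℝ≥0∞, ∀ i J, U i J =
    avgp (p / 2) d ((L : ℝ) ^ 2) (pcs g i k L J) := ⟨_, fun _ _ => rfl⟩
  have e : ∀ i x y, locSq g i k L (subCtr d ((L : ℝ) ^ 2) L x y) =
      ∑ J ∈ Finset.range (L / k), F i J (x, y) := fun i x y => by
    rw [locSq]; exact Finset.sum_congr rfl fun J _ => (hF i J (x, y)).symm
  simp_rw [e, ← hU]
  rw [← Finset.sum_product' (f := fun x y => (∑ J ∈ Finset.range (L / k), F i J (x, y)) ^ (p / 4) *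
    (∑ J ∈ Finset.range (L / k), F i' J (x, y)) ^ (p / 4))]
  refine sum_sum_mul_rpow_le _ _ _ (F i) (F i') (by linarith) _ _ ?_
  intro J hJ J' hJ'
  have hJ := Finset.mem_range.1 hJ
  have hJ' := Finset.mem_range.1 hJ'
  obtain ⟨e1, e2⟩ := pcs_endpoint (i := i) hk hL hJ
  obtain ⟨e3, e4⟩ := pcs_endpoint (i := i') hk hL hJ'
  have b1 : ((i : ℝ) + 1) / k ≤ 1 := by rw [div_le_one hk0]; exact_mod_cast hi
  have b2 : ((i' : ℝ) + 1) / k ≤ 1 := by rw [div_le_one hk0]; exact_mod_cast hi'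
  have b3 : (0 : ℝ) ≤ (i : ℝ) / k := by positivity
  have b4 : (0 : ℝ) ≤ (i' : ℝ) / k := by positivity
  have sep : 1 / (k : ℝ) ≤ |((i : ℝ) / k + (J : ℝ) / L) - ((i' : ℝ) / k + (J' : ℝ) / L)| := by
    rcases hii with h | h
    · have : ((i : ℝ) + 1) / k + 1 / k ≤ (i' : ℝ) / k := by
        rw [← add_div]; gcongr; exact_mod_cast h
      rw [abs_sub_comm]
      exact le_trans (by linarith) (le_abs_self _)
    · have : ((i' : ℝ) + 1) / k + 1 / k ≤ (i : ℝ) / k := by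
        rw [← add_div]; gcongr; exact_mod_cast h
      exact le_trans (by linarith) (le_abs_self _)
  have h1 := H L hL k (by exact_mod_cast hk) ((i : ℝ) / k + (J : ℝ) / L)
    ((i' : ℝ) / k + (J' : ℝ) / L) (by rw [abs_le]; constructor <;> linarith)
    (by rw [abs_le]; constructor <;> linarith) sep (by rw [abs_le]; constructor <;> linarith)
    (pcs g i k L J) (pcs g i' k L J') (pcs_integrable hg hk hi hL hJ)
    (pcs_integrable hg hk hi' hL hJ') (fun ξ h => ⟨(pcs_ne_zero h).1, (pcs_ne_zero h).2.le⟩)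
    (fun ξ h => ⟨(pcs_ne_zero h).1, (pcs_ne_zero h).2.le⟩) (p / 2) (by linarith) (by linarith) d
  rw [show p / 2 / 2 = p / 4 by ring, ← hU, ← hU] at h1
  rw [Finset.sum_product]
  simp_rw [hF]
  exact h1

lemma avgp_interpolation {h : ℝ → ℂ} (hh : Integrable h) {p : ℝ} (hp : 4 < p) (d : ℝ × ℝ) (R : ℝ) :
    avgp (p / 2) d R h ^ (1 / (p / 4)) ≤ avgp 2 d R h ^ (1 - (p - 4) / (p - 2)) *
      (avgp p d R h ^ (2 / p)) ^ ((p - 4) / (p - 2)) := by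
  set t : ℝ := (p - 4) / (p - 2) / 2 with ht
  have hp2 : 0 < p - 2 := by linarith
  have ht0 : 0 < t := by
    have : 0 < p - 4 := by linarith
    positivity
  have ht1 : t < 1 := by
    rw [ht, div_div, div_lt_one (by positivity)]; linarith
  have h1t : 0 < 1 - t := by linarith
  have hm := pext_enorm_measurable hh
  have hw := wt_measurable d R
  have hold := ENNReal.lintegral_mul_le_Lp_mul_Lq (volume : Measure (ℝ × ℝ))
    (p := 1 / (1 - t)) (q := 1 / t)
    (f := fun x => (ENNReal.ofReal (R ^ 2)⁻¹ * (‖pext h x‖ₑ ^ (2 : ℝ) * wt d R x)) ^ (1 - t))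
    (g := fun x => (ENNReal.ofReal (R ^ 2)⁻¹ * (‖pext h x‖ₑ ^ p * wt d R x)) ^ t)
    (by
      rw [Real.holderConjugate_iff]
      constructor
      · rw [lt_div_iff₀ h1t]; linarith
      · simp) (by fun_prop) (by fun_prop)
  have key : avgp (p / 2) d R h ≤ avgp 2 d R h ^ (1 - t) * avgp p d R h ^ t := by
    simp only [← ENNReal.rpow_mul, one_div_one_div, mul_one_div_cancel h1t.ne',
      mul_one_div_cancel ht0.ne', ENNReal.rpow_one] at hold
    rw [lintegral_const_mul' _ _ (by finiteness), lintegral_const_mul' _ _ (by finiteness)] at hold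
    refine le_trans (le_of_eq ?_) hold
    rw [avgp, ← lintegral_const_mul' _ _ (by finiteness)]
    refine lintegral_congr fun x => ?_
    simp only [Pi.mul_apply]
    rw [ENNReal.mul_rpow_of_nonneg _ _ h1t.le, ENNReal.mul_rpow_of_nonneg _ _ h1t.le,
      ENNReal.mul_rpow_of_nonneg _ _ ht0.le, ENNReal.mul_rpow_of_nonneg _ _ ht0.le,
      ← ENNReal.rpow_mul, ← ENNReal.rpow_mul]
    have hs : ∀ a : ℝ≥0∞, a ^ (1 - t) * a ^ t = a := fun a => by
      rw [← ENNReal.rpow_add_of_nonneg _ _ h1t.le ht0.le, sub_add_cancel, ENNReal.rpow_one]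
    have he : ‖pext h x‖ₑ ^ (p / 2) = ‖pext h x‖ₑ ^ (2 * (1 - t)) * ‖pext h x‖ₑ ^ (p * t) := by
      rw [← ENNReal.rpow_add_of_nonneg _ _ (by positivity) (by nlinarith)]
      congr 1; rw [ht]; field_simp; ring
    rw [he]
    nth_rewrite 1 [← hs (ENNReal.ofReal (R ^ 2)⁻¹), ← hs (wt d R x)]
    ring
  refine (ENNReal.rpow_le_rpow key (by positivity)).trans_eq ?_
  rw [ENNReal.mul_rpow_of_nonneg _ _ (by positivity), ← ENNReal.rpow_mul, ← ENNReal.rpow_mul,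
    ← ENNReal.rpow_mul]
  congr 2 <;> (rw [ht]; field_simp; ring)

lemma sum_avgp_interpolation {ι : Type*} (s : Finset ι) {h : ι → ℝ → ℂ}
    (hh : ∀ j ∈ s, Integrable (h j)) {p : ℝ} (hp : 4 < p) (d : ℝ × ℝ) (R : ℝ) :
    (∑ j ∈ s, avgp (p / 2) d R (h j) ^ (1 / (p / 4))) ^ (p / 4) ≤
      ((∑ j ∈ s, avgp 2 d R (h j)) ^ (p / 4)) ^ (1 - (p - 4) / (p - 2)) *
        ((∑ j ∈ s, avgp p d R (h j) ^ (2 / p)) ^ (p / 4)) ^ ((p - 4) / (p - 2)) := by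
  have hp2 : 0 < p - 2 := by linarith
  have h0 : 0 < (p - 4) / (p - 2) := div_pos (by linarith) hp2
  have h1 : (p - 4) / (p - 2) < 1 := by rw [div_lt_one hp2]; linarith
  have key := (Finset.sum_le_sum fun j hj => avgp_interpolation (hh j hj) hp d R).trans
    (sum_rpow_mul_rpow_le s (fun j => avgp 2 d R (h j)) (fun j => avgp p d R (h j) ^ (2 / p)) h0 h1)
  refine (ENNReal.rpow_le_rpow key (by positivity)).trans_eq ?_
  rw [ENNReal.mul_rpow_of_nonneg _ _ (by positivity), ← ENNReal.rpow_mul, ← ENNReal.rpow_mul,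
    ← ENNReal.rpow_mul, ← ENNReal.rpow_mul]
  congr 2 <;> ring

/-- Passing from the averages over the squares of side `R` to the ambient square. -/
lemma exists_sum_avgp_le_avgw : ∃ C : ℝ≥0∞, C ≠ ∞ ∧ ∀ p : ℝ, 2 ≤ p → ∀ (S : ℕ) (R : ℝ) (c : ℝ × ℝ),
    0 < S → 0 < R → ∀ (ι : Type) (s : Finset ι) (h : ι → ℝ → ℂ), (∀ j ∈ s, Integrable (h j)) →
    ENNReal.ofReal ((S : ℝ) ^ 2)⁻¹ * ∑ x ∈ Finset.range S, ∑ y ∈ Finset.range S,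
      (∑ j ∈ s, avgp p (subCtr c (S * R) R x y) R (h j) ^ (2 / p)) ^ (p / 2) ≤
    C * (∑ j ∈ s, avgw p c (S * R) (h j) ^ (2 / p)) ^ (p / 2) := by
  obtain ⟨C, hC, hcov⟩ := exists_sum_wt_le_wB
  refine ⟨C, hC, fun p hp S R c hS hR ι s h hh => ?_⟩
  have hS0 : (0 : ℝ) < S := by exact_mod_cast hS
  have hp0 : 0 < p := by linarith
  have e : 1 / (p / 2) = 2 / p := by rw [one_div_div]
  have hone : ∀ a : ℝ≥0∞, (a ^ (2 / p)) ^ (p / 2) = a := fun a => by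
    rw [← ENNReal.rpow_mul, show 2 / p * (p / 2) = 1 by field_simp, ENNReal.rpow_one]
  have hone' : ∀ a : ℝ≥0∞, (a ^ (p / 2)) ^ (2 / p) = a := fun a => by
    rw [← ENNReal.rpow_mul, show p / 2 * (2 / p) = 1 by field_simp, ENNReal.rpow_one]
  have hin : ∀ j ∈ s, ∑ z ∈ Finset.range S ×ˢ Finset.range S,
      avgp p (subCtr c (S * R) R z.1 z.2) R (h j) ≤
      C * ENNReal.ofReal ((S : ℝ) ^ 2) * avgw p c (S * R) (h j) := by
    intro j hj
    have hm := pext_enorm_measurable (hh j hj)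
    have hwm : ∀ d, Measurable (wt d R) := fun d => wt_measurable d R
    have hB := (measurable_wB c (S * R)).ennreal_ofReal
    simp only [avgp]
    rw [← Finset.mul_sum, ← lintegral_finsetSum' _ fun z _ => by fun_prop]
    calc _ ≤ ENNReal.ofReal (R ^ 2)⁻¹ * ∫⁻ x, C * (‖pext (h j) x‖ₑ ^ p *
          ENNReal.ofReal (wB c (S * R) x)) := by
          refine mul_le_mul' le_rfl (lintegral_mono fun x => ?_)
          rw [← Finset.mul_sum, Finset.sum_product, mul_left_comm]
          exact mul_le_mul' le_rfl (hcov S R c x hS hR)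
      _ = _ := by
          rw [lintegral_const_mul' _ _ hC, avgw, show ENNReal.ofReal (R ^ 2)⁻¹ =
            ENNReal.ofReal ((S : ℝ) ^ 2) * ENNReal.ofReal ((S * R) ^ 2)⁻¹ by
              rw [← ENNReal.ofReal_mul (by positivity), mul_pow, mul_inv,
                mul_inv_cancel_left₀ (by positivity)]]
          ring
  have hmink := sum_sum_rpow_le (Finset.range S ×ˢ Finset.range S) s
    (fun j z => avgp p (subCtr c (S * R) R z.1 z.2) R (h j) ^ (2 / p)) (r := p / 2) (by linarith)
  simp_rw [hone, e] at hmink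
  rw [← Finset.sum_product' (f := fun x y =>
    (∑ j ∈ s, avgp p (subCtr c (S * R) R x y) R (h j) ^ (2 / p)) ^ (p / 2))]
  calc _ ≤ ENNReal.ofReal ((S : ℝ) ^ 2)⁻¹ *
        (∑ j ∈ s, (C * ENNReal.ofReal ((S : ℝ) ^ 2) * avgw p c (S * R) (h j)) ^ (2 / p)) ^ (p / 2) := by
        refine mul_le_mul' le_rfl (hmink.trans (ENNReal.rpow_le_rpow (Finset.sum_le_sum fun j hj =>
          ENNReal.rpow_le_rpow (hin j hj) (by positivity)) (by positivity)))
    _ = ENNReal.ofReal ((S : ℝ) ^ 2)⁻¹ * (C * ENNReal.ofReal ((S : ℝ) ^ 2)) *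
        (∑ j ∈ s, avgw p c (S * R) (h j) ^ (2 / p)) ^ (p / 2) := by
        simp_rw [ENNReal.mul_rpow_of_nonneg (C * ENNReal.ofReal ((S : ℝ) ^ 2)) _
          (show 0 ≤ 2 / p by positivity)]
        rw [← Finset.mul_sum, ENNReal.mul_rpow_of_nonneg _ _ (show 0 ≤ p / 2 by positivity), hone]
        ring
    _ = _ := by
        rw [mul_left_comm (ENNReal.ofReal _), ← ENNReal.ofReal_mul (by positivity),
          inv_mul_cancel₀ (by positivity), ENNReal.ofReal_one, mul_one]

/-- Decoupling of the pieces of length `1 / L` into the pieces of length `1 / (L * N)`. -/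
lemma exists_sum_avgw_le_globSq : ∃ C : ℝ≥0∞, C ≠ ∞ ∧ ∀ p : ℝ, 2 ≤ p → p ≤ 6 →
    ∀ g : ℝ → ℂ, IntegrableOn g (Set.Icc 0 1) → ∀ i k L N : ℕ, i < k → 0 < L → 0 < N → k ∣ L →
    ∀ c : ℝ × ℝ,
    (∑ J ∈ Finset.range (L / k), avgw p c (((L * N : ℕ) : ℝ) ^ 2) (pcs g i k L J) ^ (2 / p)) ^ (p / 2) ≤
      C * ENNReal.ofReal (Dconst p N) ^ p * globSq p g i k (L * N) c ^ (p / 2) := by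
  obtain ⟨C, hC, H⟩ := exists_rescaled_decoupling
  refine ⟨C * 1025, by finiteness, fun p hp hp6 g hg i k L N hi hL hN hkL c => ?_⟩
  have hk : 0 < k := by omega
  have hk0 : (0 : ℝ) < k := by exact_mod_cast hk
  have hp0 : 0 < p := by linarith
  obtain ⟨hD0, hD⟩ := dconst_spec hp hN
  have hD1 := one_le_mul_of_decIneq hp hp6 hN hD0 hD
  have hL0 : (0 : ℝ) < L := by exact_mod_cast hL
  have hN0 : (0 : ℝ) < N := by exact_mod_cast hN
  set D := Dconst p N
  set A : ℝ≥0∞ := C * 1025 * ENNReal.ofReal D ^ p with hA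
  have hDD : 1 + ENNReal.ofReal D ^ p ≤ 1025 * ENNReal.ofReal D ^ p := by
    calc _ ≤ 1024 * ENNReal.ofReal D ^ p + ENNReal.ofReal D ^ p := by gcongr
      _ = _ := by ring
  have key : ∀ J ∈ Finset.range (L / k), avgw p c (((L * N : ℕ) : ℝ) ^ 2) (pcs g i k L J) ^ (2 / p) ≤
      A ^ (2 / p) * ∑ l ∈ Finset.range N,
        avgw p c (((L * N : ℕ) : ℝ) ^ 2) (pcs g i k ((L * N : ℕ) : ℝ) (J * N + l)) ^ (2 / p) := by
    intro J hJ
    have hJ := Finset.mem_range.1 hJ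
    obtain ⟨e1, e2⟩ := pcs_endpoint (i := i) hk hL hJ
    have b1 : ((i : ℝ) + 1) / k ≤ 1 := by rw [div_le_one hk0]; exact_mod_cast hi
    have b3 : (0 : ℝ) ≤ (i : ℝ) / k := by positivity
    have h1 := H p hp hp6 N L hN hL D hD0 hD ((i : ℝ) / k + (J : ℝ) / L)
      (by rw [abs_le]; constructor <;> linarith) (pcs g i k L J) (pcs_integrable hg hk hi hL hJ)
      (fun ξ h => pcs_ne_zero h) c
    rw [Finset.sum_congr rfl fun l hl => by
      rw [show (l : ℝ) / ((N : ℝ) * L) = l * (1 / ((L : ℝ) * N)) by rw [mul_one_div, mul_comm (N : ℝ)],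
        show ((l : ℝ) + 1) / ((N : ℝ) * L) = (l + 1) * (1 / ((L : ℝ) * N)) by
          rw [mul_one_div, mul_comm (N : ℝ)],
        pc_pcs g i k hL J (Finset.mem_range.1 hl)],
      show ((N : ℝ) * L) ^ 2 = ((L * N : ℕ) : ℝ) ^ 2 by push_cast; ring] at h1
    have hw : ∀ h : ℝ → ℂ, ∫⁻ x, ENNReal.ofReal (wB c (((L * N : ℕ) : ℝ) ^ 2) x) * ‖pext h x‖ₑ ^ p =
        ENNReal.ofReal ((((L * N : ℕ) : ℝ) ^ 2) ^ 2) * avgw p c (((L * N : ℕ) : ℝ) ^ 2) h := fun h => by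
      rw [avgw, ← mul_assoc, ← ENNReal.ofReal_mul (by positivity),
        mul_inv_cancel₀ (by positivity), ENNReal.ofReal_one, one_mul]
      exact lintegral_congr fun x => mul_comm _ _
    simp_rw [hw] at h1
    obtain ⟨Z, hZ⟩ : ∃ Z, Z = ENNReal.ofReal ((((L * N : ℕ) : ℝ) ^ 2) ^ 2) := ⟨_, rfl⟩
    have hZ0 : Z ≠ 0 := by
      rw [hZ, Ne, ENNReal.ofReal_eq_zero, not_le]; positivity
    have hZt : Z ≠ ∞ := by rw [hZ]; finiteness
    simp_rw [← hZ, ENNReal.mul_rpow_of_nonneg Z _ (show 0 ≤ 2 / p by positivity)] at h1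
    rw [← Finset.mul_sum, ENNReal.mul_rpow_of_nonneg _ _ (show 0 ≤ p / 2 by positivity),
      ← ENNReal.rpow_mul, show 2 / p * (p / 2) = 1 by field_simp, ENNReal.rpow_one,
      mul_left_comm, ENNReal.mul_le_mul_iff_right hZ0 hZt] at h1
    have h2 := h1.trans (mul_le_mul' (mul_le_mul' le_rfl hDD) le_rfl)
    rw [← mul_assoc C, ← hA] at h2
    refine (ENNReal.rpow_le_rpow h2 (by positivity)).trans_eq ?_
    rw [ENNReal.mul_rpow_of_nonneg _ _ (by positivity), ← ENNReal.rpow_mul,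
      show p / 2 * (2 / p) = 1 by field_simp, ENNReal.rpow_one]
  calc _ ≤ (∑ J ∈ Finset.range (L / k), A ^ (2 / p) * ∑ l ∈ Finset.range N,
        avgw p c (((L * N : ℕ) : ℝ) ^ 2) (pcs g i k ((L * N : ℕ) : ℝ) (J * N + l)) ^ (2 / p)) ^ (p / 2) :=
        ENNReal.rpow_le_rpow (Finset.sum_le_sum key) (by positivity)
    _ = _ := by
      rw [globSq, mul_div_eq_div_mul hkL, sum_range_mul_eq, ← Finset.mul_sum,
        ENNReal.mul_rpow_of_nonneg _ _ (show 0 ≤ p / 2 by positivity), ← ENNReal.rpow_mul,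
        show 2 / p * (p / 2) = 1 by field_simp, ENNReal.rpow_one]

lemma rpow_self_add (w : ℝ≥0∞) {t : ℝ} (h0 : 0 ≤ t) (h1 : t ≤ 1) : w ^ (1 - t) * w ^ t = w := by
  rw [← ENNReal.rpow_add_of_nonneg _ _ (by linarith) h0, sub_add_cancel, ENNReal.rpow_one]

lemma rpow_le_self_of_one_le {E : ℝ≥0∞} (hE : 1 ≤ E) {t : ℝ} (h1 : t ≤ 1) : E ^ t ≤ E :=
  (ENNReal.rpow_le_rpow_of_exponent_le hE h1).trans_eq (ENNReal.rpow_one E)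

/-- Cauchy–Schwarz for averages. -/
lemma mul_sum_rpow_mul_rpow_le {σ : Type*} (t : Finset σ) (Y Y' : σ → ℝ≥0∞) (w : ℝ≥0∞) {r : ℝ} :
    w * ∑ z ∈ t, Y z ^ r * Y' z ^ r ≤
      (w * ∑ z ∈ t, Y z ^ (r * 2)) ^ (1 / 2 : ℝ) * (w * ∑ z ∈ t, Y' z ^ (r * 2)) ^ (1 / 2 : ℝ) := by
  have h := sum_rpow_mul_rpow_le t (fun z => Y z ^ (r * 2)) (fun z => Y' z ^ (r * 2))
    (t := 1 / 2) (by norm_num) (by norm_num)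
  have e : ∀ a : ℝ≥0∞, (a ^ (r * 2)) ^ (1 / 2 : ℝ) = a ^ r := fun a => by
    rw [← ENNReal.rpow_mul]; congr 1; ring
  have hw := rpow_self_add w (t := 1 / 2) (by norm_num) (by norm_num)
  norm_num only [show (1 : ℝ) - 1 / 2 = 1 / 2 by norm_num] at h hw
  simp_rw [e] at h
  calc _ ≤ w * _ := mul_le_mul' le_rfl h
    _ = _ := by
      rw [ENNReal.mul_rpow_of_nonneg _ _ (by norm_num), ENNReal.mul_rpow_of_nonneg _ _ (by norm_num)]
      nth_rewrite 1 [← hw]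
      ring

lemma mul_sum_le_of_interpolation {σ : Type*} (t : Finset σ) {Q Q' U V : σ → ℝ≥0∞}
    {α p : ℝ} (h0 : 0 < α) (h1 : α < 1) (hp : 0 < p) {w E F M D G : ℝ≥0∞} (hE : 1 ≤ E) (hF : 1 ≤ F)
    (hQ : ∀ z ∈ t, Q z * Q' z ≤ U z ^ (1 - α) * V z ^ α)
    (hU : w * ∑ z ∈ t, U z ≤ E * M ^ p * G) (hV : w * ∑ z ∈ t, V z ≤ F * D ^ p * G) :
    w * ∑ z ∈ t, Q z * Q' z ≤ E * F * (M ^ (1 - α) * D ^ α) ^ p * G := by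
  have h1' : 0 ≤ 1 - α := by linarith
  calc w * ∑ z ∈ t, Q z * Q' z ≤ w * ((∑ z ∈ t, U z) ^ (1 - α) * (∑ z ∈ t, V z) ^ α) :=
        mul_le_mul' le_rfl ((Finset.sum_le_sum hQ).trans (sum_rpow_mul_rpow_le t U V h0 h1))
    _ = (w * ∑ z ∈ t, U z) ^ (1 - α) * (w * ∑ z ∈ t, V z) ^ α := by
        rw [ENNReal.mul_rpow_of_nonneg _ _ h1', ENNReal.mul_rpow_of_nonneg _ _ h0.le]
        nth_rewrite 1 [← rpow_self_add w h0.le h1.le]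
        ring
    _ ≤ (E * M ^ p * G) ^ (1 - α) * (F * D ^ p * G) ^ α :=
        mul_le_mul' (ENNReal.rpow_le_rpow hU h1') (ENNReal.rpow_le_rpow hV h0.le)
    _ = E ^ (1 - α) * F ^ α * ((M ^ p) ^ (1 - α) * (D ^ p) ^ α) * (G ^ (1 - α) * G ^ α) := by
        simp only [ENNReal.mul_rpow_of_nonneg _ _ h1', ENNReal.mul_rpow_of_nonneg _ _ h0.le]
        ring
    _ = E ^ (1 - α) * F ^ α * (M ^ (1 - α) * D ^ α) ^ p * G := by
        rw [rpow_self_add G h0.le h1.le, ENNReal.mul_rpow_of_nonneg _ _ hp.le]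
        simp only [← ENNReal.rpow_mul]
        rw [mul_comm p, mul_comm p]
    _ ≤ _ := mul_le_mul' (mul_le_mul' (mul_le_mul' (rpow_le_self_of_one_le hE (by linarith))
        (rpow_le_self_of_one_le hF h1.le)) le_rfl) le_rfl

lemma mul_sum_rpow_mul_rpow_le_of_le {σ : Type*} (t : Finset σ) {X X' Y Y' : σ → ℝ≥0∞} {E w : ℝ≥0∞}
    (hE : 1 ≤ E) {r : ℝ} (hr : 0 ≤ r) (hr2 : r ≤ 2) (h : ∀ z ∈ t, X z ≤ E * Y z)
    (h' : ∀ z ∈ t, X' z ≤ E * Y' z) :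
    w * ∑ z ∈ t, X z ^ r * X' z ^ r ≤ E ^ 4 * (w * ∑ z ∈ t, Y z ^ r * Y' z ^ r) := by
  have hEr : E ^ r ≤ E ^ 2 := by
    rw [← ENNReal.rpow_two]; exact ENNReal.rpow_le_rpow_of_exponent_le hE hr2
  have hb : ∀ x y : ℝ≥0∞, x ≤ E * y → x ^ r ≤ E ^ 2 * y ^ r := fun x y hxy => by
    refine (ENNReal.rpow_le_rpow hxy hr).trans ?_
    rw [ENNReal.mul_rpow_of_nonneg _ _ hr]
    exact mul_le_mul' hEr le_rfl
  rw [mul_left_comm, Finset.mul_sum t _ (E ^ 4)]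
  refine mul_le_mul' le_rfl (Finset.sum_le_sum fun z hz => ?_)
  refine (mul_le_mul' (hb _ _ (h z hz)) (hb _ _ (h' z hz))).trans_eq ?_
  ring

lemma subCtr_subCtr (c : ℝ × ℝ) (R : ℝ) (L a a' x y : ℕ) :
    subCtr c R L (a * L + x) (a' * L + y) =
      subCtr (subCtr c R ((L : ℝ) ^ 2) a a') ((L : ℝ) ^ 2) L x y := by
  simp only [subCtr, Prod.mk.injEq]
  push_cast
  constructor <;> ring

lemma sum_sum_range_mul_eq {M : Type*} [AddCommMonoid M] (F : ℕ → ℕ → M) (S L : ℕ) :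
    ∑ a ∈ Finset.range (S * L), ∑ a' ∈ Finset.range (S * L), F a a' =
      ∑ z ∈ Finset.range S ×ˢ Finset.range S, ∑ x ∈ Finset.range L, ∑ y ∈ Finset.range L,
        F (z.1 * L + x) (z.2 * L + y) := by
  rw [sum_range_mul_eq, Finset.sum_product]
  refine Finset.sum_congr rfl fun a _ => ?_
  rw [Finset.sum_comm, sum_range_mul_eq]
  exact Finset.sum_congr rfl fun a' _ => Finset.sum_comm

/-- The key step for a single function: the bilinear average over squares of side `L` is bounded
by the one over squares of side `L ^ 2` and the linear decoupling constant. -/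
lemma exists_bilinear_step : ∃ C : ℝ≥0∞, C ≠ ∞ ∧ ∀ p : ℝ, 4 < p → p < 6 →
    ∀ g : ℝ → ℂ, IntegrableOn g (Set.Icc 0 1) → ∀ i i' k L N n S : ℕ, i < k → i' < k →
    (i + 1 < i' ∨ i' + 1 < i) → k ∣ L → 0 < L → 0 < N → n = L * (L * N) → S = L * N * (L * N) →
    ∀ (c : ℝ × ℝ) (M : ℝ≥0∞),
    ENNReal.ofReal ((S : ℝ) ^ 2)⁻¹ * ∑ a ∈ Finset.range S, ∑ a' ∈ Finset.range S,
        (locSq g i k (L * L) (subCtr c ((n : ℝ) ^ 2) ((L * L : ℕ) : ℝ) a a') ^ (p / 4) *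
         locSq g i' k (L * L) (subCtr c ((n : ℝ) ^ 2) ((L * L : ℕ) : ℝ) a a') ^ (p / 4)) ≤
      M ^ p * (globSq p g i k n c ^ (p / 4) * globSq p g i' k n c ^ (p / 4)) →
    ENNReal.ofReal (((S * L : ℕ) : ℝ) ^ 2)⁻¹ *
      ∑ a ∈ Finset.range (S * L), ∑ a' ∈ Finset.range (S * L),
        (locSq g i k L (subCtr c ((n : ℝ) ^ 2) L a a') ^ (p / 4) *
         locSq g i' k L (subCtr c ((n : ℝ) ^ 2) L a a') ^ (p / 4)) ≤
      C * ENNReal.ofReal k * (M ^ (1 - (p - 4) / (p - 2)) *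
        ENNReal.ofReal (Dconst p (L * N)) ^ ((p - 4) / (p - 2))) ^ p *
        (globSq p g i k n c ^ (p / 4) * globSq p g i' k n c ^ (p / 4)) := by
  obtain ⟨C₁, hC₁, hinf⟩ := exists_locSq_inflation
  obtain ⟨C₂, hC₂, horth⟩ := exists_sum_avgp_le_locSq
  obtain ⟨C₃, hC₃, hav⟩ := exists_sum_avgp_le_avgw
  obtain ⟨C₄, hC₄, hdec⟩ := exists_sum_avgw_le_globSq
  refine ⟨C₁ * ((1 + C₂) ^ 4 * (1 + C₃ * C₄)), by finiteness, ?_⟩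
  intro p hp4 hp6 g hg i i' k L N n S hi hi' hii hkL hL hN hn hS c M hM
  have hk : 0 < k := by omega
  have hL0 : (0 : ℝ) < L := by exact_mod_cast hL
  have hS0 : 0 < S := by rw [hS]; positivity
  have hp2 : 0 < p - 2 := by linarith
  set α := (p - 4) / (p - 2) with hα
  have h0 : 0 < α := div_pos (by linarith) hp2
  have h1 : α < 1 := by rw [hα, div_lt_one hp2]; linarith
  have hSR : (S : ℝ) * (L : ℝ) ^ 2 = (n : ℝ) ^ 2 := by rw [hS, hn]; push_cast; ring
  have hLL : ((L * L : ℕ) : ℝ) = (L : ℝ) ^ 2 := by push_cast; ring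
  rw [hLL] at hM
  set T := Finset.range S ×ˢ Finset.range S with hT
  set w := ENNReal.ofReal ((S : ℝ) ^ 2)⁻¹ with hw
  obtain ⟨d, hd⟩ : ∃ d : ℕ × ℕ → ℝ × ℝ, ∀ z, d z = subCtr c ((n : ℝ) ^ 2) ((L : ℝ) ^ 2) z.1 z.2 :=
    ⟨_, fun _ => rfl⟩
  obtain ⟨Q, hQ⟩ : ∃ Q : ℕ → ℕ × ℕ → ℝ≥0∞, ∀ i z, Q i z = (∑ J ∈ Finset.range (L / k),
    avgp (p / 2) (d z) ((L : ℝ) ^ 2) (pcs g i k L J) ^ (1 / (p / 4))) ^ (p / 4) := ⟨_, fun _ _ => rfl⟩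
  obtain ⟨X, hX⟩ : ∃ X : ℕ → ℕ × ℕ → ℝ≥0∞, ∀ i z, X i z = ∑ J ∈ Finset.range (L / k),
    avgp 2 (d z) ((L : ℝ) ^ 2) (pcs g i k L J) := ⟨_, fun _ _ => rfl⟩
  obtain ⟨Y, hY⟩ : ∃ Y : ℕ → ℕ × ℕ → ℝ≥0∞, ∀ i z, Y i z = ∑ J ∈ Finset.range (L / k),
    avgp p (d z) ((L : ℝ) ^ 2) (pcs g i k L J) ^ (2 / p) := ⟨_, fun _ _ => rfl⟩
  obtain ⟨G, hG⟩ : ∃ G : ℕ → ℝ≥0∞, ∀ i, G i = globSq p g i k n c := ⟨_, fun _ => rfl⟩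
  simp only [← hG] at hM ⊢
  have hX' : ∀ i, i < k → ∀ z ∈ T, X i z ≤ (1 + C₂) * locSq g i k (L * L) (d z) := by
    intro i hi z _
    have h := horth g hg i k L L hk hi hL hL hkL (d z)
    rw [hLL, ← hX] at h
    exact h.trans (mul_le_mul' le_add_self le_rfl)
  have hQX : ∀ i, i < k → ∀ z, Q i z ≤ (X i z ^ (p / 4)) ^ (1 - α) * (Y i z ^ (p / 4)) ^ α := by
    intro i hi z
    rw [hQ, hX, hY]
    exact sum_avgp_interpolation _ (fun J hJ => pcs_integrable hg hk hi hL (Finset.mem_range.1 hJ))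
      hp4 _ _
  have hYG : ∀ i, i < k → w * ∑ z ∈ T, Y i z ^ (p / 4 * 2) ≤
      (1 + C₃ * C₄) * ENNReal.ofReal (Dconst p (L * N)) ^ p * G i ^ (p / 2) := by
    intro i hi
    have h2 := hav p (by linarith) S ((L : ℝ) ^ 2) c hS0 (by positivity) ℕ (Finset.range (L / k))
      (fun J => pcs g i k L J) fun J hJ => pcs_integrable hg hk hi hL (Finset.mem_range.1 hJ)
    have h3 := hdec p (by linarith) hp6.le g hg i k L (L * N) hi hL (by positivity) hkL c
    rw [hSR, ← hw] at h2
    rw [← hn, ← hG] at h3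
    rw [hT, Finset.sum_product, show p / 4 * 2 = p / 2 by ring]
    simp only [hY, hd]
    refine h2.trans ((mul_le_mul' le_rfl h3).trans ?_)
    rw [← mul_assoc, ← mul_assoc]
    exact mul_le_mul' (mul_le_mul' le_add_self le_rfl) le_rfl
  have hU : w * ∑ z ∈ T, X i z ^ (p / 4) * X i' z ^ (p / 4) ≤
      (1 + C₂) ^ 4 * M ^ p * (G i ^ (p / 4) * G i' ^ (p / 4)) := by
    refine (mul_sum_rpow_mul_rpow_le_of_le T le_self_add (by linarith) (by linarith)
      (hX' i hi) (hX' i' hi')).trans ?_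
    rw [mul_assoc]
    refine mul_le_mul' le_rfl ?_
    rw [hT, Finset.sum_product]
    simp only [hd]
    exact hM
  have hV : w * ∑ z ∈ T, Y i z ^ (p / 4) * Y i' z ^ (p / 4) ≤
      (1 + C₃ * C₄) * ENNReal.ofReal (Dconst p (L * N)) ^ p * (G i ^ (p / 4) * G i' ^ (p / 4)) := by
    refine (mul_sum_rpow_mul_rpow_le T _ _ w).trans ?_
    refine (mul_le_mul' (ENNReal.rpow_le_rpow (hYG i hi) (by norm_num))
      (ENNReal.rpow_le_rpow (hYG i' hi') (by norm_num))).trans_eq ?_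
    rw [ENNReal.mul_rpow_of_nonneg _ _ (by norm_num : (0 : ℝ) ≤ 1 / 2),
      ENNReal.mul_rpow_of_nonneg _ (G i' ^ (p / 2)) (by norm_num : (0 : ℝ) ≤ 1 / 2),
      ← ENNReal.rpow_mul (G i), ← ENNReal.rpow_mul (G i'), show p / 2 * (1 / 2) = p / 4 by ring]
    have h := rpow_self_add ((1 + C₃ * C₄) * ENNReal.ofReal (Dconst p (L * N)) ^ p) (t := 1 / 2)
      (by norm_num) (by norm_num)
    rw [show (1 : ℝ) - 1 / 2 = 1 / 2 by norm_num] at h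
    nth_rewrite 3 [← h]
    ring
  have hfin := mul_sum_le_of_interpolation T (Q := Q i) (Q' := Q i')
    (U := fun z => X i z ^ (p / 4) * X i' z ^ (p / 4))
    (V := fun z => Y i z ^ (p / 4) * Y i' z ^ (p / 4)) h0 h1 (by linarith)
    (one_le_pow_of_one_le' (le_self_add : (1 : ℝ≥0∞) ≤ 1 + C₂) 4)
    (le_self_add : (1 : ℝ≥0∞) ≤ 1 + C₃ * C₄) (fun z _ => by
      refine (mul_le_mul' (hQX i hi z) (hQX i' hi' z)).trans_eq ?_
      rw [ENNReal.mul_rpow_of_nonneg _ _ (by linarith : 0 ≤ 1 - α),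
        ENNReal.mul_rpow_of_nonneg _ _ h0.le]
      ring) hU hV
  rw [sum_sum_range_mul_eq]
  simp only [subCtr_subCtr]
  rw [← hT, Nat.cast_mul, mul_pow, mul_inv, ENNReal.ofReal_mul (by positivity), ← hw]
  have hmain : ∀ z ∈ T, ∑ x ∈ Finset.range L, ∑ y ∈ Finset.range L,
      (locSq g i k L (subCtr (subCtr c ((n : ℝ) ^ 2) ((L : ℝ) ^ 2) z.1 z.2) ((L : ℝ) ^ 2) L x y) ^ (p / 4) *
        locSq g i' k L (subCtr (subCtr c ((n : ℝ) ^ 2) ((L : ℝ) ^ 2) z.1 z.2) ((L : ℝ) ^ 2) L x y) ^ (p / 4)) ≤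
      C₁ * ENNReal.ofReal k * ENNReal.ofReal ((L : ℝ) ^ 2) * (Q i z * Q i' z) := by
    intro z _
    rw [← hd, hQ, hQ]
    exact hinf p hp4.le hp6.le g hg i i' k L hi hi' hii hL (d z)
  refine (mul_le_mul' le_rfl (Finset.sum_le_sum hmain)).trans ?_
  rw [← Finset.mul_sum]
  have hcan : ENNReal.ofReal ((L : ℝ) ^ 2)⁻¹ * ENNReal.ofReal ((L : ℝ) ^ 2) = 1 := by
    rw [← ENNReal.ofReal_mul (by positivity), inv_mul_cancel₀ (by positivity), ENNReal.ofReal_one]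
  calc _ = (ENNReal.ofReal ((L : ℝ) ^ 2)⁻¹ * ENNReal.ofReal ((L : ℝ) ^ 2)) *
        (C₁ * ENNReal.ofReal k * (w * ∑ z ∈ T, Q i z * Q i' z)) := by ring
    _ ≤ 1 * _ := mul_le_mul' hcan.le (mul_le_mul' le_rfl hfin)
    _ = _ := by ring

lemma ofReal_step_const_le {p α K m d : ℝ} {C : ℝ≥0∞} (hC : C ≠ ∞) (hp : 1 ≤ p) (hα : 0 ≤ α)
    (hα1 : α ≤ 1) (hK : 0 ≤ K) (hm : 0 ≤ m) (hd : 0 ≤ d) :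
    C * ENNReal.ofReal K *
        (ENNReal.ofReal m ^ (1 - α) * ENNReal.ofReal d ^ α) ^ p ≤
      ENNReal.ofReal ((1 + C.toReal) * K ^ (1 / p) * m ^ (1 - α) * d ^ α) ^ p := by
  have hp0 : 0 < p := by linarith
  have hc : 1 ≤ 1 + C.toReal := by linarith [C.toReal_nonneg]
  have hCle : C ≤ ENNReal.ofReal (1 + C.toReal) ^ p := by
    calc C = ENNReal.ofReal C.toReal := (ENNReal.ofReal_toReal hC).symm
      _ ≤ ENNReal.ofReal (1 + C.toReal) := ENNReal.ofReal_le_ofReal (by linarith)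
      _ = ENNReal.ofReal (1 + C.toReal) ^ (1 : ℝ) := (ENNReal.rpow_one _).symm
      _ ≤ _ := ENNReal.rpow_le_rpow_of_exponent_le (ENNReal.one_le_ofReal.2 hc) hp
  have hKp : ENNReal.ofReal K = ENNReal.ofReal (K ^ (1 / p)) ^ p := by
    rw [ENNReal.ofReal_rpow_of_nonneg (by positivity) hp0.le, ← Real.rpow_mul hK,
      one_div_mul_cancel hp0.ne', Real.rpow_one]
  rw [ENNReal.ofReal_rpow_of_nonneg hm (by linarith), ENNReal.ofReal_rpow_of_nonneg hd hα,
    ENNReal.ofReal_mul (by positivity), ENNReal.ofReal_mul (by positivity),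
    ENNReal.ofReal_mul (by positivity), mul_assoc (_ * _),
    ENNReal.mul_rpow_of_nonneg (_ * _) _ hp0.le,
    ENNReal.mul_rpow_of_nonneg (ENNReal.ofReal (1 + _)) _ hp0.le, ← hKp]
  exact mul_le_mul' (mul_le_mul' hCle le_rfl) le_rfl

lemma one_le_rpow_mul_log {b k : ℕ} (hb : 1 ≤ b) (hk : 100 < k) :
    1 ≤ ((b : ℝ) * Real.log k) ^ (1 / 2 : ℝ) := by
  have hk' : (100 : ℝ) < k := by exact_mod_cast hk
  have hb' : (1 : ℝ) ≤ b := by exact_mod_cast hb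
  have hlog : 1 ≤ Real.log k := by
    rw [Real.le_log_iff_exp_le (by linarith)]
    linarith [Real.exp_one_lt_d9]
  exact Real.one_le_rpow (one_le_mul_of_one_le_of_one_le hb' hlog) (by norm_num)

end

/-- the key iteration estimate, with `α = (p-4)/(p-2)`, `δ = 1/n`, `ν = 1/k`:
`M_{p,b}(δ,ν) ≤ c ν^{-1/p} (b log(1/ν))^{1/2} M_{p,2b}(δ,ν)^{1-α} D_p(δ/ν^b)^α`. -/
theorem bilinear_iteration_step :
    ∃ c : ℝ, 0 < c ∧ ∀ p : ℝ, 4 < p → p < 6 → ∀ b : ℕ, 1 ≤ b →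
      ∀ n k : ℕ, 0 < n → 100 < k → k ^ (2 * b) ∣ n →
        Mconst p n k b ≤
          c * (k : ℝ) ^ (1 / p) * ((b : ℝ) * Real.log k) ^ (1 / 2 : ℝ) *
            Mconst p n k (2 * b) ^ (1 - (p - 4) / (p - 2)) *
            Dconst p (n / k ^ b) ^ ((p - 4) / (p - 2)) := by
  obtain ⟨C, hC, hstep⟩ := exists_bilinear_step
  have hc : 0 < 1 + C.toReal := by linarith [C.toReal_nonneg]
  refine ⟨1 + C.toReal, hc, fun p hp4 hp6 b hb n k hn hk hdvd => ?_⟩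
  have hk0 : 0 < k := by lia
  have hα : 0 ≤ (p - 4) / (p - 2) := div_nonneg (by linarith) (by linarith)
  have hα1 : (p - 4) / (p - 2) ≤ 1 := (div_le_one (by linarith)).2 (by linarith)
  obtain ⟨N, hN⟩ := hdvd
  have hN0 : 0 < N := Nat.pos_of_ne_zero fun h => by simp [h] at hN; lia
  have hL0 : 0 < k ^ b := pow_pos hk0 b
  have hLL : k ^ (2 * b) = k ^ b * k ^ b := by rw [two_mul, pow_add]
  have hnL : n = k ^ b * (k ^ b * N) := by rw [hN, hLL, mul_assoc]
  have hD : n / k ^ b = k ^ b * N := by rw [hnL, Nat.mul_div_cancel_left _ hL0]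
  have hS1 : n ^ 2 / k ^ b = k ^ b * N * (k ^ b * N) * k ^ b :=
    Nat.div_eq_of_eq_mul_left hL0 (by rw [hnL]; ring)
  have hS2 : n ^ 2 / k ^ (2 * b) = k ^ b * N * (k ^ b * N) :=
    Nat.div_eq_of_eq_mul_left (pow_pos hk0 _) (by rw [hLL, hnL]; ring)
  obtain ⟨hM0, hM⟩ := mconst_spec (p := p) (by linarith) hp6.le hn hk0
    (show 1 ≤ 2 * b by lia) ⟨N, hN⟩
  have hD0 : 0 ≤ Dconst p (n / k ^ b) :=
    (dconst_spec (by linarith) (by rw [hD]; positivity)).1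
  set m := Mconst p n k (2 * b)
  set d := Dconst p (n / k ^ b) with hd
  have hM' : 0 ≤ (1 + C.toReal) * (k : ℝ) ^ (1 / p) * m ^ (1 - (p - 4) / (p - 2)) *
      d ^ ((p - 4) / (p - 2)) := by positivity
  have key : Mconst p n k b ≤ (1 + C.toReal) * (k : ℝ) ^ (1 / p) *
      m ^ (1 - (p - 4) / (p - 2)) * d ^ ((p - 4) / (p - 2)) := by
    refine mconst_le hM' ((bilIneq_iff (by linarith) hn hk0 hb hM').2 ?_)
    intro g hg c i i' hi hi' hii
    have h2 := (bilIneq_iff (by linarith) hn hk0 (by lia) hM0).1 hM g hg c i i' hi hi' hii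
    rw [hS2, hLL] at h2
    have h1 := hstep p hp4 hp6 g hg i i' k (k ^ b) N n _ hi hi' hii
      (dvd_pow_self k (by lia)) hL0 hN0 hnL rfl c _ h2
    rw [hS1]
    refine h1.trans (mul_le_mul' ?_ le_rfl)
    rw [← hD, ← hd]
    exact ofReal_step_const_le hC (by linarith) hα hα1 (Nat.cast_nonneg k) hM0 hD0
  refine key.trans ?_
  rw [mul_right_comm _ (((b : ℝ) * Real.log k) ^ (1 / 2 : ℝ)),
    mul_right_comm _ (((b : ℝ) * Real.log k) ^ (1 / 2 : ℝ))]
  exact le_mul_of_one_le_right hM' (one_le_rpow_mul_log hb hk)
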